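/- arXiv:1506.01202 — 2 statements merged into one kernel-verified Lean document; each statement's English description precedes it below -/
import Mathlib

section
/- Let {p_k/q_k} ⊂ (0,1) be an irrationally tuned sequence of even rational parameters (that is, both p_k/q_k and the tunes τ(p_k/q_k) converge, and the tuned limit lim τ(p_k/q_k) is irrational), let ω_k = p_k + q_k, and let {B_k} be any sequence of associated blocks. Then for every integer N there is δ > 0 such that, for all sufficiently large k: at least N distinct plaid polygons contained in B_k have x-diameter at least δ·ω_k, and every point of B_k lies within distance ω_k/N of one of these polygons. -/
noncomputable section
open scoped Classical

/-- The representative of `x` modulo `2ℤ` lying in `[-1,1)`.  For the values arising in the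
plaid model (which are never congruent to an odd integer modulo `2ℤ`) this is the unique
representative in `(-1,1)`. -/
def nrm (x : ℝ) : ℝ := x - 2 * ⌊(x + 1) / 2⌋

/-- An even rational parameter `p/q`: coprime positive integers `p < q` with `p*q` even. -/
structure Param where
  p : ℕ
  q : ℕ
  p_pos : 0 < p
  p_lt_q : p < q
  coprime : Nat.Coprime p q
  even_pq : Even (p * q)

/-- `z` lies on a line of the family `𝓗` (horizontal lines with integer `y`-coordinate). -/
def onH (z : ℝ × ℝ) : Prop := ∃ n : ℤ, z.2 = (n : ℝ)

/-- `z` lies on a line of the family `𝓥` (vertical lines with integer `x`-coordinate). -/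
def onV (z : ℝ × ℝ) : Prop := ∃ n : ℤ, z.1 = (n : ℝ)

/-- The lightness condition on the pair of values `(F_A(z), F_B(z))`:
`F_A(z)·F_B(z) > 0` and `|F_B(z)| < |F_A(z)|`. -/
def lightPair (a b : ℝ) : Prop := a * b > 0 ∧ |b| < |a|

namespace Param

variable (π : Param)

def ω : ℕ := π.p + π.q

def P : ℝ := 2 * π.p / π.ω

def Q : ℝ := 2 * π.q / π.ω

/-- `z` lies on a line of `𝓟` (slope `-P`, integer `y`-intercept). -/
def onP (z : ℝ × ℝ) : Prop := ∃ n : ℤ, z.2 + π.P * z.1 = (n : ℝ)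

/-- `z` lies on a line of `𝓠` (slope `-Q`, integer `y`-intercept). -/
def onQ (z : ℝ × ℝ) : Prop := ∃ n : ℤ, z.2 + π.Q * z.1 = (n : ℝ)

def FH (z : ℝ × ℝ) : ℝ := nrm (2 * π.P * z.2)
def FV (z : ℝ × ℝ) : ℝ := nrm (2 * π.P * z.1)
def FP (z : ℝ × ℝ) : ℝ := nrm (π.P * z.2 + π.P ^ 2 * z.1 + 1)
def FQ (z : ℝ × ℝ) : ℝ := nrm (π.P * z.2 + π.P * π.Q * z.1 + 1)

/-- `z` is a light intersection point of type `P` on a horizontal (`𝓗`) line. -/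
def lightHP (z : ℝ × ℝ) : Prop := onH z ∧ π.onP z ∧ lightPair (π.FH z) (π.FP z)

/-- `z` is a light intersection point of type `Q` on a horizontal (`𝓗`) line. -/
def lightHQ (z : ℝ × ℝ) : Prop := onH z ∧ π.onQ z ∧ lightPair (π.FH z) (π.FQ z)

/-- `z` is a light intersection point of type `P` on a vertical (`𝓥`) line. -/
def lightVP (z : ℝ × ℝ) : Prop := onV z ∧ π.onP z ∧ lightPair (π.FV z) (π.FP z)

/-- `z` is a light intersection point of type `Q` on a vertical (`𝓥`) line. -/
def lightVQ (z : ℝ × ℝ) : Prop := onV z ∧ π.onQ z ∧ lightPair (π.FV z) (π.FQ z)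

/-- `z` is a light point (of some kind). -/
def light (z : ℝ × ℝ) : Prop := π.lightHP z ∨ π.lightHQ z ∨ π.lightVP z ∨ π.lightVQ z

/-- The number of light points, with the double-counting convention (a light point which is the
midpoint of the segment, lying simultaneously on a `𝓟` line and a `𝓠` line, counts twice), on
the horizontal unit segment from `(m,n)` to `(m+1,n)`. -/
def hLightCount (m n : ℤ) : ℕ :=
  Set.ncard {x : ℝ | x ∈ Set.Icc (m : ℝ) ((m : ℝ) + 1) ∧ π.lightHP (x, (n : ℝ))} +
  Set.ncard {x : ℝ | x ∈ Set.Icc (m : ℝ) ((m : ℝ) + 1) ∧ π.lightHQ (x, (n : ℝ)) ∧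
    (π.onP (x, (n : ℝ)) → x = (m : ℝ) + 1 / 2)}

/-- The number of light points on the vertical unit segment from `(m,n)` to `(m,n+1)`. -/
def vLightCount (m n : ℤ) : ℕ :=
  Set.ncard {y : ℝ | y ∈ Set.Icc (n : ℝ) ((n : ℝ) + 1) ∧ π.lightVP ((m : ℝ), y)} +
  Set.ncard {y : ℝ | y ∈ Set.Icc (n : ℝ) ((n : ℝ) + 1) ∧ π.lightVQ ((m : ℝ), y)}

/-- The horizontal unit segment from `(m,n)` to `(m+1,n)` is good: it contains exactly one
light point (with the double-counting convention). -/
def goodH (m n : ℤ) : Prop := π.hLightCount m n = 1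

/-- The vertical unit segment from `(m,n)` to `(m,n+1)` is good. -/
def goodV (m n : ℤ) : Prop := π.vLightCount m n = 1

end Param

namespace Param

variable (π : Param)

/-- The capacity of the horizontal line `y = c` of `𝓗` — and likewise of the vertical line
`x = c` of `𝓥`, since `F_V` is given by the same formula: `ω·|F_H|`. -/
def cap (c : ℤ) : ℝ := π.ω * |nrm (2 * π.P * c)|

/-- The mass of the `𝓟` line with `y`-intercept `(0,c)` — and likewise of the `𝓠` line with
`y`-intercept `(0,c)`, since `F_P` and `F_Q` restrict to the same value on these lines. -/
def mass (c : ℤ) : ℝ := π.ω * |nrm (π.P * c + 1)|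

/-- The block indexed by `(i,j)` : the translate of the square `[0,ω]²` by the lattice
vector `(ω² i, ω j)`. -/
def block (i j : ℤ) : Set (ℝ × ℝ) :=
  Set.Icc ((π.ω : ℝ) ^ 2 * i, (π.ω : ℝ) * j) ((π.ω : ℝ) ^ 2 * i + π.ω, (π.ω : ℝ) * j + π.ω)

end Param

namespace Param

variable (π : Param)

/-- The union of all the plaid polygons: in each integer unit square (with corners `(m,n)` and
`(m+1,n+1)`) we draw the segments connecting the center of the square to the midpoints of its
good edges. -/
def plaidSet : Set (ℝ × ℝ) :=
  {z | ∃ m n : ℤ,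
    (π.goodH m n ∧ z ∈ segment ℝ ((m : ℝ) + 1 / 2, (n : ℝ) + 1 / 2) ((m : ℝ) + 1 / 2, (n : ℝ))) ∨
    (π.goodH m (n + 1) ∧
      z ∈ segment ℝ ((m : ℝ) + 1 / 2, (n : ℝ) + 1 / 2) ((m : ℝ) + 1 / 2, (n : ℝ) + 1)) ∨
    (π.goodV m n ∧ z ∈ segment ℝ ((m : ℝ) + 1 / 2, (n : ℝ) + 1 / 2) ((m : ℝ), (n : ℝ) + 1 / 2)) ∨
    (π.goodV (m + 1) n ∧
      z ∈ segment ℝ ((m : ℝ) + 1 / 2, (n : ℝ) + 1 / 2) ((m : ℝ) + 1, (n : ℝ) + 1 / 2))}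

/-- A plaid polygon: a connected component of the union of the drawn segments. -/
def IsPlaidPolygon (Γ : Set (ℝ × ℝ)) : Prop :=
  ∃ z ∈ π.plaidSet, Γ = connectedComponentIn π.plaidSet z

end Param


def Lp (a b : ℤ) : Prop := b.natAbs < a.natAbs ∧ (a + b) % 2 = 1

def lam0 (a b : ℤ) : ZMod 2 := if Lp a b then 1 else 0

theorem zmod2_11 : (1:ZMod 2) + 1 = 0 := by decide

theorem dvdc {a b c : ℤ} (h : a ∣ b) (e : c = b) : a ∣ c := e ▸ h

theorem Lp_neg_left (a b : ℤ) : Lp (-a) b ↔ Lp a b := by unfold Lp; omega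
theorem Lp_neg_right (a b : ℤ) : Lp a (-b) ↔ Lp a b := by unfold Lp; omega
theorem lam0_neg_left (a b : ℤ) : lam0 (-a) b = lam0 a b := by
  unfold lam0; simp [Lp_neg_left]
theorem lam0_neg_right (a b : ℤ) : lam0 a (-b) = lam0 a b := by
  unfold lam0; simp [Lp_neg_right]

set_option maxHeartbeats 1000000 in
theorem lam0_step_aux (w a b t c1 c2 c3 c4 : ℤ) (hw : w % 2 = 1)
    (ha : 2 * a.natAbs < w) (hb : 2 * b.natAbs < w) (ht : 2 * t.natAbs < w)
    (hc1 : 2 * c1.natAbs < w) (hc3 : 2 * c3.natAbs < w)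
    (ha0 : 0 ≤ a) (hb0 : 0 ≤ b) (ht0 : 0 ≤ t)
    (h1 : c1 = b + t ∨ c1 = b + t - w) (h2 : c2 = b - t)
    (h3 : c3 = a + t ∨ c3 = a + t - w) (h4 : c4 = a - t) :
    lam0 a c1 + lam0 a c2 + lam0 b c3 + lam0 b c4 = 0 := by
  have hl : ∀ c x : ℤ, 0 ≤ x → (Lp x c ↔ (c < x ∧ -c < x ∧ (x + c) % 2 = 1)) := by
    intro c x hx; unfold Lp; omega
  have h11 := zmod2_11
  obtain ⟨s, hs⟩ : ∃ s, s = a + b + t := ⟨_, rfl⟩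
  unfold lam0
  simp only [hl _ _ ha0, hl _ _ hb0]
  subst h2 h4
  have hpar : s % 2 = 0 ∨ s % 2 = 1 := by omega
  have e2 : (a + (b - t)) % 2 = s % 2 := by omega
  have e4 : (b + (a - t)) % 2 = s % 2 := by omega
  rw [e2, e4]
  have hA : 2 * a < w := by omega
  have hB : 2 * b < w := by omega
  have hT : 2 * t < w := by omega
  have hC1 : 2 * c1 < w ∧ -2 * c1 < w := by omega
  have hC3 : 2 * c3 < w ∧ -2 * c3 < w := by omega
  clear e2 e4 hl ha hb ht hc1 hc3
  rcases h1 with rfl | rfl <;> rcases h3 with rfl | rfl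
  · have e1 : (a + (b + t)) % 2 = s % 2 := by omega
    have e3 : (b + (a + t)) % 2 = s % 2 := by omega
    rw [e1, e3]
    clear e1 e3 hw
    rcases hpar with h | h <;> rw [h] <;>
    split_ifs <;> first | (exfalso; omega) | simp [h11]
  · have e1 : (a + (b + t)) % 2 = s % 2 := by omega
    have e3 : (b + (a + t - w)) % 2 = 1 - s % 2 := by omega
    rw [e1, e3]
    clear e1 e3 hw
    rcases hpar with h | h <;> rw [h] <;>
    split_ifs <;> first | (exfalso; omega) | simp [h11]
  · have e1 : (a + (b + t - w)) % 2 = 1 - s % 2 := by omega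
    have e3 : (b + (a + t)) % 2 = s % 2 := by omega
    rw [e1, e3]
    clear e1 e3 hw
    rcases hpar with h | h <;> rw [h] <;>
    split_ifs <;> first | (exfalso; omega) | simp [h11]
  · have e1 : (a + (b + t - w)) % 2 = 1 - s % 2 := by omega
    have e3 : (b + (a + t - w)) % 2 = 1 - s % 2 := by omega
    rw [e1, e3]
    clear e1 e3 hw
    rcases hpar with h | h <;> rw [h] <;>
    split_ifs <;> first | (exfalso; omega) | simp [h11]

theorem lam0_base_aux (a b : ℤ) :
    lam0 a b + lam0 b a = lam0 a 0 + lam0 b 0 := by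
  have key : ((Lp a b ↔ Lp b a) ↔ (Lp a 0 ↔ Lp b 0)) := by
    unfold Lp
    omega
  unfold lam0
  have h11 := zmod2_11
  by_cases k1 : Lp a b <;> by_cases k2 : Lp b a <;> by_cases k3 : Lp a 0 <;>
    by_cases k4 : Lp b 0 <;> simp_all

namespace Param
variable (π : Param)

/-- balanced residue of `2 p n` mod `ω` -/
def bet (n : ℤ) : ℤ := Int.bmod (2 * π.p * n) π.ω

theorem ω_pos : 0 < π.ω := by have := π.p_pos; unfold ω; omega

theorem ω_odd : (π.ω : ℤ) % 2 = 1 := by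
  have h := π.even_pq
  have hc := π.coprime
  rw [Nat.even_mul] at h
  unfold ω
  have : ¬ (Even π.p ∧ Even π.q) := by
    rintro ⟨h1, h2⟩
    have : 2 ∣ Nat.gcd π.p π.q := Nat.dvd_gcd h1.two_dvd h2.two_dvd
    rw [hc] at this; omega
  simp only [Nat.even_iff] at *
  push_cast
  omega

theorem bet_dvd (n : ℤ) : (π.ω : ℤ) ∣ 2 * π.p * n - π.bet n := by
  unfold bet
  exact Int.dvd_self_sub_bmod

theorem bet_lt (n : ℤ) : 2 * ((π.bet n).natAbs : ℤ) < π.ω := by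
  unfold bet
  have h1 := Int.le_bmod (x := 2 * π.p * n) π.ω_pos
  have h2 := Int.bmod_lt (x := 2 * π.p * n) π.ω_pos
  have := π.ω_odd
  omega

theorem bet_unique (n b : ℤ) (h : (π.ω : ℤ) ∣ 2 * π.p * n - b) (hb : 2 * (b.natAbs : ℤ) < π.ω) :
    π.bet n = b := by
  have h1 := π.bet_dvd n
  have h2 := π.bet_lt n
  have h3 : (π.ω : ℤ) ∣ (π.bet n) - b := by
    have := dvd_sub h h1
    ring_nf at this ⊢
    exact this
  obtain ⟨c, hc⟩ := h3
  have : c = 0 := by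
    by_contra hne
    rcases lt_or_gt_of_ne hne with h | h
    · have : (π.ω : ℤ) * c ≤ - π.ω := by nlinarith [π.ω_pos]
      omega
    · have : (π.ω : ℤ) * c ≥ π.ω := by nlinarith [π.ω_pos]
      omega
  subst this; omega

theorem bet_neg (n : ℤ) : π.bet (-n) = - π.bet n := by
  apply bet_unique
  · have := (π.bet_dvd n).neg_right
    exact dvdc this (by ring)
  · have := π.bet_lt n; omega

theorem bet_zero : π.bet 0 = 0 := by
  apply bet_unique
  · simp
  · have := π.ω_pos; simp [this]

theorem bet_add_mul (n c : ℤ) : π.bet (n + π.ω * c) = π.bet n := by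
  apply bet_unique
  · have := dvd_add (π.bet_dvd n) (Dvd.intro (2 * π.p * c) rfl : (π.ω : ℤ) ∣ π.ω * (2 * π.p * c))
    exact dvdc this (by ring)
  · exact π.bet_lt n

theorem bet_congr {m n : ℤ} (h : (π.ω : ℤ) ∣ m - n) : π.bet m = π.bet n := by
  obtain ⟨c, hc⟩ := h
  have : m = n + π.ω * c := by omega
  rw [this, bet_add_mul]

theorem bet_ω : π.bet π.ω = 0 := by
  have := π.bet_add_mul 0 1
  simpa [bet_zero] using this

theorem gcd_two_p : IsCoprime (π.ω : ℤ) (2 * π.p : ℤ) := by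
  apply IsCoprime.mul_right
  · rw [Int.isCoprime_iff_gcd_eq_one]
    have h := π.ω_odd
    have : Nat.Coprime π.ω 2 := by
      rw [Nat.coprime_two_right, Nat.odd_iff]; omega
    exact this
  · rw [Nat.isCoprime_iff_coprime]
    unfold ω
    have := π.coprime
    simpa [Nat.coprime_comm] using this

theorem bet_inj {m n : ℤ} (h : π.bet m = π.bet n) : (π.ω : ℤ) ∣ m - n := by
  have h1 := dvd_sub (π.bet_dvd m) (π.bet_dvd n)
  rw [h] at h1
  have h2 : (π.ω : ℤ) ∣ 2 * π.p * (m - n) := by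
    exact dvdc h1 (by ring)
  exact π.gcd_two_p.dvd_of_dvd_mul_left h2

theorem bet_add (m n : ℤ) : π.bet (m + n) = π.bet m + π.bet n ∨
    π.bet (m + n) = π.bet m + π.bet n - π.ω ∨ π.bet (m + n) = π.bet m + π.bet n + π.ω := by
  have h1 : (π.ω : ℤ) ∣ π.bet (m + n) - π.bet m - π.bet n := by
    have := dvd_sub (dvd_add (π.bet_dvd m) (π.bet_dvd n)) (π.bet_dvd (m + n))
    exact dvdc this (by ring)
  obtain ⟨c, hc⟩ := h1
  have h2 := π.bet_lt m
  have h3 := π.bet_lt n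
  have h4 := π.bet_lt (m + n)
  have h5 : c < 2 := by
    by_contra h; push Not at h
    have : (π.ω : ℤ) * c ≥ 2 * π.ω := by nlinarith [π.ω_pos]
    omega
  have h6 : -2 < c := by
    by_contra h; push Not at h
    have : (π.ω : ℤ) * c ≤ -2 * π.ω := by nlinarith [π.ω_pos]
    omega
  have : c = -1 ∨ c = 0 ∨ c = 1 := by omega
  rcases this with rfl | rfl | rfl <;> omega

def Lam (n d : ℤ) : Prop := Lp (π.bet n) (π.bet d)
def lam (n d : ℤ) : ZMod 2 := lam0 (π.bet n) (π.bet d)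

theorem lam_eq (n d : ℤ) : π.lam n d = if π.Lam n d then 1 else 0 := rfl

theorem lam_neg_left (n d : ℤ) : π.lam (-n) d = π.lam n d := by
  simp [lam, bet_neg, lam0_neg_left]
theorem lam_neg_right (n d : ℤ) : π.lam n (-d) = π.lam n d := by
  simp [lam, bet_neg, lam0_neg_right]
theorem Lam_neg_right (n d : ℤ) : π.Lam n (-d) ↔ π.Lam n d := by
  simp [Lam, bet_neg, Lp_neg_right]
theorem Lam_congr {n d n' d' : ℤ} (h : (π.ω : ℤ) ∣ n - n') (h' : (π.ω : ℤ) ∣ d - d') :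
    π.Lam n d ↔ π.Lam n' d' := by
  simp [Lam, π.bet_congr h, π.bet_congr h']
theorem lam_congr {n d n' d' : ℤ} (h : (π.ω : ℤ) ∣ n - n') (h' : (π.ω : ℤ) ∣ d - d') :
    π.lam n d = π.lam n' d' := by
  simp [lam, π.bet_congr h, π.bet_congr h']
theorem not_Lam_of_bet {n : ℤ} (h : π.bet n = 0) (d : ℤ) : ¬ π.Lam n d := by
  simp [Lam, h, Lp]
theorem lam_of_bet {n : ℤ} (h : π.bet n = 0) (d : ℤ) : π.lam n d = 0 := by
  rw [lam_eq, if_neg (π.not_Lam_of_bet h d)]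

theorem lam_base (n m : ℤ) : π.lam n m + π.lam m n = π.lam n 0 + π.lam m 0 := by
  simp only [lam, bet_zero]; exact lam0_base_aux _ _

/-- step with all betas nonnegative -/
theorem lam_step1 (n m t : ℤ) (hn : 0 ≤ π.bet n) (hm : 0 ≤ π.bet m) (ht : 0 ≤ π.bet t) :
    π.lam n (m + t) + π.lam n (m - t) + π.lam m (n + t) + π.lam m (n - t) = 0 := by
  have bn := π.bet_lt n
  have bm := π.bet_lt m
  have bt := π.bet_lt t
  have b1 := π.bet_lt (m + t)
  have b2 := π.bet_lt (m + -t)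
  have b3 := π.bet_lt (n + t)
  have b4 := π.bet_lt (n + -t)
  have e1 := π.bet_add m t
  have e2 := π.bet_add m (-t)
  have e3 := π.bet_add n t
  have e4 := π.bet_add n (-t)
  rw [sub_eq_add_neg, sub_eq_add_neg]
  rw [bet_neg] at e2 e4
  unfold lam
  apply lam0_step_aux π.ω _ _ (π.bet t) _ _ _ _ π.ω_odd <;> first | assumption | omega

theorem lam_step2 (n m t : ℤ) (hn : 0 ≤ π.bet n) (hm : 0 ≤ π.bet m) :
    π.lam n (m + t) + π.lam n (m - t) + π.lam m (n + t) + π.lam m (n - t) = 0 := by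
  rcases le_total 0 (π.bet t) with h | h
  · exact π.lam_step1 n m t hn hm h
  · have := π.lam_step1 n m (-t) hn hm (by rw [bet_neg]; omega)
    rw [← this]; simp only [sub_neg_eq_add, ← sub_eq_add_neg]; ring

theorem lam_step3 (n m t : ℤ) (hn : 0 ≤ π.bet n) :
    π.lam n (m + t) + π.lam n (m - t) + π.lam m (n + t) + π.lam m (n - t) = 0 := by
  rcases le_total 0 (π.bet m) with h | h
  · exact π.lam_step2 n m t hn h
  · have := π.lam_step2 n (-m) t hn (by rw [bet_neg]; omega)
    rw [← this]
    rw [lam_neg_left, lam_neg_left, ← π.lam_neg_right n (-m + t), ← π.lam_neg_right n (-m - t)]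
    ring_nf

theorem lam_step (n m t : ℤ) :
    π.lam n (m + t) + π.lam n (m - t) + π.lam m (n + t) + π.lam m (n - t) = 0 := by
  rcases le_total 0 (π.bet n) with h | h
  · exact π.lam_step3 n m t h
  · have := π.lam_step3 (-n) m t (by rw [bet_neg]; omega)
    rw [← this]
    rw [lam_neg_left, lam_neg_left, ← π.lam_neg_right m (-n + t), ← π.lam_neg_right m (-n - t)]
    ring_nf

/-- sum over `m - M ≤ d ≤ m + M` -/
def wsum (n m : ℤ) (M : ℕ) : ZMod 2 := ∑ d ∈ Finset.Icc (m - M) (m + M), π.lam n d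

theorem wsum_zero (n m : ℤ) : π.wsum n m 0 = π.lam n m := by simp [wsum]

theorem wsum_succ (n m : ℤ) (M : ℕ) : π.wsum n m (M + 1) =
    π.wsum n m M + (π.lam n (m + (M + 1)) + π.lam n (m - (M + 1))) := by
  have : Finset.Icc (m - ((M + 1 : ℕ) : ℤ)) (m + ((M + 1 : ℕ) : ℤ)) =
      insert (m + (M + 1)) (insert (m - (M + 1)) (Finset.Icc (m - (M:ℤ)) (m + M))) := by
    ext x; simp only [Finset.mem_Icc, Finset.mem_insert]; push_cast; omega
  unfold wsum
  rw [this, Finset.sum_insert, Finset.sum_insert]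
  · ring
  · simp only [Finset.mem_Icc]; omega
  · simp only [Finset.mem_Icc, Finset.mem_insert]; omega

theorem duality (n m : ℤ) (M : ℕ) :
    π.wsum n m M + π.wsum m n M = π.lam n 0 + π.lam m 0 := by
  induction M with
  | zero => rw [wsum_zero, wsum_zero, lam_base]
  | succ M ih =>
    rw [wsum_succ, wsum_succ, ← ih]
    have := π.lam_step n m (M + 1)
    linear_combination this

end Param


theorem nrm_spec (x : ℝ) : ∃ k : ℤ, x = nrm x + 2 * k ∧ -1 ≤ nrm x ∧ nrm x < 1 := by
  refine ⟨⌊(x + 1) / 2⌋, by unfold nrm; ring, ?_, ?_⟩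
  · have := Int.floor_le ((x + 1) / 2); unfold nrm; linarith
  · have := Int.lt_floor_add_one ((x + 1) / 2); unfold nrm; linarith

theorem nrm_eq (x y : ℝ) (k : ℤ) (h : x = y + 2 * k) (h1 : -1 ≤ y) (h2 : y < 1) : nrm x = y := by
  have : ⌊(x + 1) / 2⌋ = k := by
    rw [Int.floor_eq_iff]; constructor <;> linarith
  unfold nrm; rw [this, h]; ring

namespace Param
variable (π : Param)

theorem ωR_pos : (0:ℝ) < π.ω := by exact_mod_cast π.ω_pos

theorem lightPair_iff_Lam (n d : ℤ) :
    lightPair (nrm (2 * π.P * n)) (nrm (π.P * ((n:ℝ) + d) + 1)) ↔ π.Lam n d := by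
  have hw := π.ωR_pos
  have hodd := π.ω_odd
  have bn := π.bet_lt n
  have bd := π.bet_lt d
  obtain ⟨c, hc⟩ := π.bet_dvd n
  obtain ⟨c', hc'⟩ := π.bet_dvd d
  have h1 : nrm (2 * π.P * n) = 2 * π.bet n / π.ω := by
    apply nrm_eq _ _ c
    · have : (2 * π.p * n : ℝ) - π.bet n = π.ω * c := by exact_mod_cast hc
      unfold P
      field_simp
      linarith
    · rw [le_div_iff₀ hw]
      have : -(π.ω : ℤ) ≤ 2 * π.bet n := by omega
      have : -(π.ω : ℝ) ≤ 2 * π.bet n := by exact_mod_cast this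
      linarith
    · rw [div_lt_iff₀ hw]
      have : 2 * π.bet n < (π.ω : ℤ) := by omega
      have : 2 * π.bet n < (π.ω : ℝ) := by exact_mod_cast this
      linarith
  obtain ⟨k, hk, hk1, hk2⟩ := nrm_spec (π.P * ((n:ℝ) + d) + 1)
  obtain ⟨i, hi⟩ : ∃ i : ℤ, i = 2 * π.p * (n + d) + π.ω - 2 * k * π.ω := ⟨_, rfl⟩
  have hf : nrm (π.P * ((n:ℝ) + d) + 1) = i / π.ω := by
    have : nrm (π.P * ((n:ℝ) + d) + 1) = (π.P * ((n:ℝ) + d) + 1) - 2 * k := by linarith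
    rw [this, hi]; unfold P; push_cast; field_simp
  rw [hf] at hk1 hk2
  rw [le_div_iff₀ hw] at hk1
  rw [div_lt_iff₀ hw] at hk2
  have hi1 : -(π.ω : ℤ) ≤ i := by
    have : -(π.ω : ℝ) ≤ i := by linarith
    exact_mod_cast this
  have hi2 : i < (π.ω : ℤ) := by
    have : (i:ℝ) < π.ω := by linarith
    exact_mod_cast this
  have hiodd : i % 2 = 1 := by
    have : i = 2 * (π.p * (n + d) - k * π.ω) + π.ω := by rw [hi]; ring
    omega
  have hLP : lightPair (nrm (2 * π.P * n)) (nrm (π.P * ((n:ℝ) + d) + 1)) ↔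
      (i - π.bet n).natAbs < (π.bet n).natAbs := by
    rw [h1, hf]
    unfold lightPair
    have e1 : 2 * (π.bet n:ℝ) / π.ω * (i / π.ω) > 0 ↔ π.bet n * i > 0 := by
      have : 2 * (π.bet n:ℝ) / π.ω * (i / π.ω) = (π.bet n * i : ℝ) * (2 / (π.ω * π.ω)) := by
        field_simp
      rw [this, gt_iff_lt, mul_pos_iff_of_pos_right (by positivity)]
      exact_mod_cast Iff.rfl
    have e2 : |(i / π.ω : ℝ)| < |2 * (π.bet n:ℝ) / π.ω| ↔ |i| < |2 * π.bet n| := by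
      rw [abs_div, abs_div, div_lt_div_iff_of_pos_right (by positivity)]
      exact_mod_cast Iff.rfl
    rw [e1, e2, gt_iff_lt, mul_pos_iff, Int.abs_eq_natAbs, Int.abs_eq_natAbs]
    omega
  rw [hLP]
  unfold Lam Lp
  constructor
  · intro h
    have : π.bet d = i - π.bet n := by
      apply bet_unique
      · refine ⟨-c - 1 + 2 * k, ?_⟩
        rw [hi]
        linear_combination (-1) * hc
      · omega
    omega
  · rintro ⟨ha, hb⟩
    have hdv : i - (π.bet n + π.bet d) = π.ω * (c + c' + 1 - 2 * k) := by
      rw [hi]; linear_combination hc + hc'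
    obtain ⟨e, he⟩ : ∃ e, e = c + c' + 1 - 2 * k := ⟨_, rfl⟩
    rw [← he] at hdv
    have he1 : e < 2 := by
      by_contra h; push Not at h
      have : (π.ω : ℤ) * e ≥ 2 * π.ω := by nlinarith [π.ω_pos]
      omega
    have he2 : -2 < e := by
      by_contra h; push Not at h
      have : (π.ω : ℤ) * e ≤ -2 * π.ω := by nlinarith [π.ω_pos]
      omega
    have : e = -1 ∨ e = 0 ∨ e = 1 := by omega
    rcases this with rfl | rfl | rfl <;> omega

theorem lightHP_iff (x : ℝ) (n : ℤ) :
    π.lightHP (x, (n:ℝ)) ↔ ∃ d : ℤ, π.P * x = d ∧ π.Lam n d := by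
  unfold lightHP onH onP FH FP
  constructor
  · rintro ⟨-, ⟨N, hN⟩, h⟩
    refine ⟨N - n, by push_cast; linarith, ?_⟩
    rw [← lightPair_iff_Lam]
    convert h using 2
    push_cast
    simp only at hN ⊢
    linear_combination (-π.P) * hN
  · rintro ⟨d, hd, h⟩
    refine ⟨⟨n, rfl⟩, ⟨n + d, by push_cast; linarith⟩, ?_⟩
    rw [← lightPair_iff_Lam] at h
    convert h using 2
    simp only
    linear_combination (π.P) * hd

theorem lightHQ_iff (x : ℝ) (n : ℤ) :
    π.lightHQ (x, (n:ℝ)) ↔ ∃ d : ℤ, π.Q * x = d ∧ π.Lam n d := by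
  unfold lightHQ onH onQ FH FQ
  constructor
  · rintro ⟨-, ⟨N, hN⟩, h⟩
    refine ⟨N - n, by push_cast; linarith, ?_⟩
    rw [← lightPair_iff_Lam]
    convert h using 2
    push_cast
    simp only at hN ⊢
    linear_combination (-π.P) * hN
  · rintro ⟨d, hd, h⟩
    refine ⟨⟨n, rfl⟩, ⟨n + d, by push_cast; linarith⟩, ?_⟩
    rw [← lightPair_iff_Lam] at h
    convert h using 2
    simp only
    linear_combination (π.P) * hd

theorem lightVP_iff (m : ℤ) (y : ℝ) :
    π.lightVP ((m:ℝ), y) ↔ ∃ d : ℤ, y + π.P * m = m + d ∧ π.Lam m d := by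
  unfold lightVP onV onP FV FP
  constructor
  · rintro ⟨-, ⟨N, hN⟩, h⟩
    refine ⟨N - m, by push_cast; linarith, ?_⟩
    rw [← lightPair_iff_Lam]
    convert h using 2
    push_cast
    simp only at hN ⊢
    linear_combination (-π.P) * hN
  · rintro ⟨d, hd, h⟩
    refine ⟨⟨m, rfl⟩, ⟨m + d, by push_cast; linarith⟩, ?_⟩
    rw [← lightPair_iff_Lam] at h
    convert h using 2
    simp only
    linear_combination (π.P) * hd

theorem lightVQ_iff (m : ℤ) (y : ℝ) :
    π.lightVQ ((m:ℝ), y) ↔ ∃ d : ℤ, y + π.Q * m = m + d ∧ π.Lam m d := by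
  unfold lightVQ onV onQ FV FQ
  constructor
  · rintro ⟨-, ⟨N, hN⟩, h⟩
    refine ⟨N - m, by push_cast; linarith, ?_⟩
    rw [← lightPair_iff_Lam]
    convert h using 2
    push_cast
    simp only at hN ⊢
    linear_combination (-π.P) * hN
  · rintro ⟨d, hd, h⟩
    refine ⟨⟨m, rfl⟩, ⟨m + d, by push_cast; linarith⟩, ?_⟩
    rw [← lightPair_iff_Lam] at h
    convert h using 2
    simp only
    linear_combination (π.P) * hd

theorem onP_iff (x : ℝ) (n : ℤ) : π.onP (x, (n:ℝ)) ↔ ∃ d : ℤ, π.P * x = d := by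
  unfold onP
  constructor
  · rintro ⟨N, hN⟩; exact ⟨N - n, by push_cast; simp only at hN; linarith⟩
  · rintro ⟨d, hd⟩; exact ⟨n + d, by push_cast; linarith⟩

theorem P_mul_ω : π.P * π.ω = 2 * π.p := by
  have := π.ωR_pos; unfold P; field_simp
theorem Q_mul_ω : π.Q * π.ω = 2 * π.q := by
  have := π.ωR_pos; unfold Q; field_simp
theorem P_add_Q : π.P + π.Q = 2 := by
  have := π.ωR_pos
  have h : (π.ω:ℝ) = π.p + π.q := by unfold ω; push_cast; ring
  unfold P Q; field_simp; linarith

theorem P_pos : 0 < π.P := by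
  have := π.ωR_pos; have h : (0:ℝ) < π.p := by exact_mod_cast π.p_pos
  unfold P; positivity
theorem P_lt_one : π.P < 1 := by
  have := π.ωR_pos
  have h : (π.ω:ℝ) = π.p + π.q := by unfold ω; push_cast; ring
  have h2 : (π.p:ℝ) < π.q := by exact_mod_cast π.p_lt_q
  unfold P; rw [div_lt_one this]; linarith
theorem one_lt_Q : 1 < π.Q := by have := π.P_lt_one; have := π.P_add_Q; linarith
theorem Q_lt_two : π.Q < 2 := by have := π.P_pos; have := π.P_add_Q; linarith

/-- Translation invariance -/
theorem hLightCount_translate (A B m n : ℤ) :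
    π.hLightCount ((π.ω:ℤ) ^ 2 * A + m) ((π.ω:ℤ) * B + n) = π.hLightCount m n := by
  have hL : ∀ d e : ℤ, π.Lam ((π.ω:ℤ) * B + n) (d + π.ω * e) ↔ π.Lam n d := by
    intro d e; apply Lam_congr
    · exact ⟨B, by ring⟩
    · exact ⟨e, by ring⟩
  have hP : ∀ x : ℝ, π.P * ((π.ω:ℝ) ^ 2 * A + x) = π.P * x + ((π.ω * (2 * π.p * A) : ℤ) : ℝ) := by
    intro x; have := π.P_mul_ω; push_cast; linear_combination (π.ω * A : ℝ) * this
  have hQ : ∀ x : ℝ, π.Q * ((π.ω:ℝ) ^ 2 * A + x) = π.Q * x + ((π.ω * (2 * π.q * A) : ℤ) : ℝ) := by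
    intro x; have := π.Q_mul_ω; push_cast; linear_combination (π.ω * A : ℝ) * this
  have hLP : ∀ x, π.lightHP ((π.ω:ℝ) ^ 2 * A + x, (((π.ω:ℤ) * B + n : ℤ) : ℝ)) ↔
      π.lightHP (x, (n : ℝ)) := by
    intro x
    rw [lightHP_iff, lightHP_iff, hP]
    constructor
    · rintro ⟨d, hd, h⟩
      refine ⟨d - π.ω * (2 * π.p * A), ?_, ?_⟩
      · push_cast at hd ⊢; linarith
      · rw [← hL _ (2 * π.p * A)]; simpa using h
    · rintro ⟨d, hd, h⟩
      exact ⟨d + π.ω * (2 * π.p * A), by rw [hd]; push_cast; ring, (hL _ _).2 h⟩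
  have hLQ : ∀ x, π.lightHQ ((π.ω:ℝ) ^ 2 * A + x, (((π.ω:ℤ) * B + n : ℤ) : ℝ)) ↔
      π.lightHQ (x, (n : ℝ)) := by
    intro x
    rw [lightHQ_iff, lightHQ_iff, hQ]
    constructor
    · rintro ⟨d, hd, h⟩
      refine ⟨d - π.ω * (2 * π.q * A), ?_, ?_⟩
      · push_cast at hd ⊢; linarith
      · rw [← hL _ (2 * π.q * A)]; simpa using h
    · rintro ⟨d, hd, h⟩
      exact ⟨d + π.ω * (2 * π.q * A), by rw [hd]; push_cast; ring, (hL _ _).2 h⟩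
  have hOP : ∀ x, π.onP ((π.ω:ℝ) ^ 2 * A + x, (((π.ω:ℤ) * B + n : ℤ) : ℝ)) ↔
      π.onP (x, (n : ℝ)) := by
    intro x
    rw [onP_iff, onP_iff, hP]
    constructor
    · rintro ⟨d, hd⟩
      exact ⟨d - π.ω * (2 * π.p * A), by push_cast at hd ⊢; linarith⟩
    · rintro ⟨d, hd⟩
      exact ⟨d + π.ω * (2 * π.p * A), by rw [hd]; push_cast; ring⟩
  have hinj : Function.Injective (fun x : ℝ => (π.ω:ℝ) ^ 2 * A + x) := add_right_injective _
  unfold hLightCount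
  congr 1
  · symm
    rw [← Set.ncard_image_of_injective _ hinj]
    symm
    congr 1
    ext x
    simp only [Set.mem_ofPred_eq, Set.mem_image, Set.mem_Icc]
    constructor
    · rintro ⟨⟨h1, h2⟩, h3⟩
      refine ⟨x - (π.ω:ℝ) ^ 2 * A, ⟨⟨?_, ?_⟩, ?_⟩, by ring⟩
      · push_cast at h1; linarith
      · push_cast at h2; linarith
      · rw [← hLP]; convert h3 using 2; ring
    · rintro ⟨y, ⟨⟨h1, h2⟩, h3⟩, rfl⟩
      refine ⟨⟨?_, ?_⟩, (hLP y).2 h3⟩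
      · push_cast; linarith
      · push_cast; linarith
  · symm
    rw [← Set.ncard_image_of_injective _ hinj]
    symm
    congr 1
    ext x
    simp only [Set.mem_ofPred_eq, Set.mem_image, Set.mem_Icc]
    constructor
    · rintro ⟨⟨h1, h2⟩, h3, h4⟩
      obtain ⟨y, rfl⟩ : ∃ y, x = (π.ω:ℝ) ^ 2 * A + y := ⟨x - (π.ω:ℝ) ^ 2 * A, by ring⟩
      refine ⟨y, ⟨⟨?_, ?_⟩, (hLQ y).1 h3, ?_⟩, rfl⟩
      · push_cast at h1; linarith
      · push_cast at h2; linarith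
      · intro h5; have := h4 ((hOP y).2 h5); push_cast at this; linarith
    · rintro ⟨y, ⟨⟨h1, h2⟩, h3, h4⟩, rfl⟩
      refine ⟨⟨?_, ?_⟩, (hLQ y).2 h3, ?_⟩
      · push_cast; linarith
      · push_cast; linarith
      · intro h5; have := h4 ((hOP y).1 h5); push_cast; linarith

theorem vLightCount_translate (A B m n : ℤ) :
    π.vLightCount ((π.ω:ℤ) ^ 2 * A + m) ((π.ω:ℤ) * B + n) = π.vLightCount m n := by
  have hL : ∀ d e : ℤ, π.Lam ((π.ω:ℤ) ^ 2 * A + m) (d + π.ω * e) ↔ π.Lam m d := by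
    intro d e; apply Lam_congr
    · exact ⟨π.ω * A, by ring⟩
    · exact ⟨e, by ring⟩
  have hLP : ∀ y : ℝ, π.lightVP ((((π.ω:ℤ) ^ 2 * A + m : ℤ) : ℝ), (π.ω:ℝ) * B + y) ↔
      π.lightVP ((m : ℝ), y) := by
    intro y
    have hP := π.P_mul_ω
    rw [lightVP_iff, lightVP_iff]
    constructor
    · rintro ⟨d, hd, h⟩
      refine ⟨d - π.ω * (2 * π.p * A + B - π.ω * A), ?_, ?_⟩
      · push_cast at hd ⊢; linear_combination hd - (π.ω * A : ℝ) * hP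
      · rw [← hL _ (2 * π.p * A + B - π.ω * A)]; simpa using h
    · rintro ⟨d, hd, h⟩
      refine ⟨d + π.ω * (2 * π.p * A + B - π.ω * A), ?_, (hL _ _).2 h⟩
      push_cast; linear_combination hd + (π.ω * A : ℝ) * hP
  have hLQ : ∀ y : ℝ, π.lightVQ ((((π.ω:ℤ) ^ 2 * A + m : ℤ) : ℝ), (π.ω:ℝ) * B + y) ↔
      π.lightVQ ((m : ℝ), y) := by
    intro y
    have hP := π.Q_mul_ω
    rw [lightVQ_iff, lightVQ_iff]
    constructor
    · rintro ⟨d, hd, h⟩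
      refine ⟨d - π.ω * (2 * π.q * A + B - π.ω * A), ?_, ?_⟩
      · push_cast at hd ⊢; linear_combination hd - (π.ω * A : ℝ) * hP
      · rw [← hL _ (2 * π.q * A + B - π.ω * A)]; simpa using h
    · rintro ⟨d, hd, h⟩
      refine ⟨d + π.ω * (2 * π.q * A + B - π.ω * A), ?_, (hL _ _).2 h⟩
      push_cast; linear_combination hd + (π.ω * A : ℝ) * hP
  have hinj : Function.Injective (fun x : ℝ => (π.ω:ℝ) * B + x) := add_right_injective _
  unfold vLightCount
  congr 1
  · symm
    rw [← Set.ncard_image_of_injective _ hinj]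
    symm
    congr 1
    ext x
    simp only [Set.mem_ofPred_eq, Set.mem_image, Set.mem_Icc]
    constructor
    · rintro ⟨⟨h1, h2⟩, h3⟩
      obtain ⟨y, rfl⟩ : ∃ y, x = (π.ω:ℝ) * B + y := ⟨x - (π.ω:ℝ) * B, by ring⟩
      refine ⟨y, ⟨⟨?_, ?_⟩, (hLP y).1 h3⟩, rfl⟩
      · push_cast at h1; linarith
      · push_cast at h2; linarith
    · rintro ⟨y, ⟨⟨h1, h2⟩, h3⟩, rfl⟩
      refine ⟨⟨?_, ?_⟩, (hLP y).2 h3⟩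
      · push_cast; linarith
      · push_cast; linarith
  · symm
    rw [← Set.ncard_image_of_injective _ hinj]
    symm
    congr 1
    ext x
    simp only [Set.mem_ofPred_eq, Set.mem_image, Set.mem_Icc]
    constructor
    · rintro ⟨⟨h1, h2⟩, h3⟩
      obtain ⟨y, rfl⟩ : ∃ y, x = (π.ω:ℝ) * B + y := ⟨x - (π.ω:ℝ) * B, by ring⟩
      refine ⟨y, ⟨⟨?_, ?_⟩, (hLQ y).1 h3⟩, rfl⟩
      · push_cast at h1; linarith
      · push_cast at h2; linarith
    · rintro ⟨y, ⟨⟨h1, h2⟩, h3⟩, rfl⟩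
      refine ⟨⟨?_, ?_⟩, (hLQ y).2 h3⟩
      · push_cast; linarith
      · push_cast; linarith

end Param


namespace Param
variable (π : Param)

def kk (m : ℤ) : ℤ := if m ≤ 0 then -1 else (2 * π.p * m) / π.ω
def kk' (m : ℤ) : ℤ := 2 * m - 1 - π.kk m

theorem ωZ_pos : (0:ℤ) < π.ω := by exact_mod_cast π.ω_pos
theorem ωZ_eq : (π.ω:ℤ) = π.p + π.q := by unfold ω; push_cast; ring

theorem not_dvd_of {m : ℤ} (h0 : 0 < m) (h1 : m < π.ω) (d : ℤ) : 2 * π.p * m ≠ π.ω * d := by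
  intro h
  have : (π.ω:ℤ) ∣ m := π.gcd_two_p.dvd_of_dvd_mul_left ⟨d, h⟩
  have := Int.le_of_dvd h0 this
  omega

theorem le_kk {m : ℤ} (h : 0 < m) (d : ℤ) : d ≤ π.kk m ↔ π.ω * d ≤ 2 * π.p * m := by
  unfold kk; rw [if_neg (by omega), Int.le_ediv_iff_mul_le π.ωZ_pos, mul_comm]

theorem kk_lt {m : ℤ} (h : 0 ≤ m) (h1 : m < π.ω) (d : ℤ) :
    π.kk m < d ↔ 2 * π.p * m ≤ π.ω * d := by
  have hw := π.ωZ_pos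
  rcases h.eq_or_lt with rfl | h
  · simp only [kk, le_refl, if_true, mul_zero]
    rw [mul_nonneg_iff_of_pos_left hw]; omega
  · have := π.le_kk h d
    have h2 := π.not_dvd_of h h1 d
    rw [← not_le, this]; omega

theorem le_kk' {m : ℤ} (h : 0 < m) (d : ℤ) : d ≤ π.kk' m ↔ π.ω * d < 2 * π.q * m := by
  have := π.le_kk h (2 * m - d)
  have h2 := π.ωZ_eq
  have h3 : (π.ω:ℤ) * (2 * m - d) = 2 * π.p * m + 2 * π.q * m - π.ω * d := by rw [h2]; ring
  unfold kk'
  constructor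
  · intro h4
    by_contra h5
    have := this.2 (by omega)
    omega
  · intro h4
    by_contra h5
    have := this.1 (by omega)
    omega

theorem kk'_lt {m : ℤ} (h : 0 ≤ m) (h1 : m < π.ω) (d : ℤ) :
    π.kk' m < d ↔ 2 * π.q * m < π.ω * d := by
  have hw := π.ωZ_pos
  rcases h.eq_or_lt with rfl | h
  · simp only [kk', kk, le_refl, if_true, mul_zero]
    rw [mul_pos_iff_of_pos_left hw]; omega
  · have := π.le_kk' h d
    have h2 := π.not_dvd_of h h1 (2 * m - d)
    have h3 : (π.ω:ℤ) * (2 * m - d) = 2 * π.p * m + 2 * π.q * m - π.ω * d := by rw [ωZ_eq]; ring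
    rw [← not_le, this]; omega

theorem kk_mono1 {m : ℤ} (h : 0 ≤ m) (h1 : m < π.ω) : π.kk m ≤ π.kk (m + 1) := by
  by_contra hc
  push Not at hc
  have h2 := (π.le_kk (by omega : 0 < m + 1) (π.kk (m+1) + 1)).not.1 (by omega)
  have h3 := (π.kk_lt h h1 (π.kk m)).not.1 (by omega)
  have hp := π.p_pos
  have : (π.ω:ℤ) * (π.kk (m+1) + 1) ≤ π.ω * π.kk m := by
    apply mul_le_mul_of_nonneg_left _ π.ωZ_pos.le; omega
  push Not at h2 h3
  have h4 : (2 * π.p * (m + 1) : ℤ) = 2 * π.p * m + 2 * π.p := by ring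
  omega

theorem kk'_mono1 {m : ℤ} (h : 0 ≤ m) (h1 : m < π.ω) : π.kk' m ≤ π.kk' (m + 1) := by
  by_contra hc
  push Not at hc
  have h2 := (π.le_kk' (by omega : 0 < m + 1) (π.kk' (m+1) + 1)).not.1 (by omega)
  have h3 := (π.kk'_lt h h1 (π.kk' m)).not.1 (by omega)
  have hp := π.p_pos
  have hp := π.p_lt_q
  have : (π.ω:ℤ) * (π.kk' (m+1) + 1) ≤ π.ω * π.kk' m := by
    apply mul_le_mul_of_nonneg_left _ π.ωZ_pos.le; omega
  push Not at h2 h3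
  have h4 : (2 * π.q * (m + 1) : ℤ) = 2 * π.q * m + 2 * π.q := by ring
  omega

theorem kk_ge {m : ℤ} (h : 0 ≤ m) : -1 ≤ π.kk m := by
  rcases h.eq_or_lt with rfl | h
  · simp [kk]
  · rw [π.le_kk h]
    have := π.ωZ_pos
    have : (0:ℤ) ≤ 2 * π.p * m := by positivity
    omega

theorem kk_le {m : ℤ} (h : 0 ≤ m) : π.kk m ≤ m - 1 := by
  rcases h.eq_or_lt with rfl | h
  · simp [kk]
  · by_contra hc
    have := (π.le_kk h m).1 (by omega)
    have h2 : (2 * π.p : ℤ) < π.ω := by have := π.p_lt_q; rw [ωZ_eq]; omega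
    nlinarith

theorem kk_le_kk' {m : ℤ} (h : 0 ≤ m) : π.kk m ≤ π.kk' m := by
  have := π.kk_le h; unfold kk'; omega

/-- count of lights with index in `Ioc a b` -/
def cnt (n a b : ℤ) : ℕ := ((Finset.Ioc a b).filter (fun d => π.Lam n d)).card

theorem cnt_cast (n a b : ℤ) : (π.cnt n a b : ZMod 2) = ∑ d ∈ Finset.Ioc a b, π.lam n d := by
  simp only [cnt, lam_eq, Finset.sum_boole]

theorem hLightCount_eq {m : ℤ} (h : 0 ≤ m) (h1 : m < π.ω) (n : ℤ) :
    π.hLightCount m n = π.cnt n (π.kk m) (π.kk (m + 1)) + π.cnt n (π.kk' m) (π.kk' (m + 1)) := by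
  have hP := π.P_pos
  have hQ : 0 < π.Q := by linarith [π.one_lt_Q]
  have hw := π.ωR_pos
  have hPw := π.P_mul_ω
  have hQw := π.Q_mul_ω
  have hPQ := π.P_add_Q
  unfold hLightCount cnt
  congr 1
  · rw [← Set.ncard_coe_finset]
    symm
    rw [← Set.ncard_image_of_injective (f := fun d : ℤ => (d:ℝ) / π.P)]
    swap
    · intro a b hab
      simp only at hab
      rw [div_left_inj' hP.ne'] at hab; exact_mod_cast hab
    congr 1
    ext x
    simp only [Set.mem_ofPred_eq, Set.mem_image, Set.mem_Icc, lightHP_iff, Finset.coe_filter,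
      Finset.mem_Ioc, π.kk_lt h h1, π.le_kk (by omega : 0 < m + 1)]
    constructor
    · rintro ⟨d, ⟨⟨h2, h3⟩, h4⟩, rfl⟩
      have h2 : (2 * π.p * m : ℝ) ≤ π.ω * d := by exact_mod_cast h2
      have h3 : (π.ω * d : ℝ) ≤ 2 * π.p * (m + 1) := by exact_mod_cast h3
      rw [← hPw] at h2 h3
      refine ⟨⟨?_, ?_⟩, d, by field_simp, h4⟩
      · rw [le_div_iff₀ hP]; nlinarith
      · rw [div_le_iff₀ hP]; nlinarith
    · rintro ⟨⟨h2, h3⟩, d, h4, h5⟩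
      refine ⟨d, ⟨⟨?_, ?_⟩, h5⟩, by rw [← h4]; field_simp⟩
      · have : (2 * π.p * m : ℝ) ≤ π.ω * d := by
          rw [← h4, ← hPw]; nlinarith [mul_pos hP hw]
        exact_mod_cast this
      · have : (π.ω * d : ℝ) ≤ 2 * π.p * (m + 1) := by
          rw [← h4, ← hPw]; nlinarith [mul_pos hP hw]
        exact_mod_cast this
  · rw [← Set.ncard_coe_finset]
    symm
    rw [← Set.ncard_image_of_injective (f := fun d : ℤ => (d:ℝ) / π.Q)]
    swap
    · intro a b hab
      simp only at hab
      rw [div_left_inj' hQ.ne'] at hab; exact_mod_cast hab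
    congr 1
    ext x
    simp only [Set.mem_ofPred_eq, Set.mem_image, Set.mem_Icc, lightHQ_iff, Finset.coe_filter,
      Finset.mem_Ioc, π.kk'_lt h h1, π.le_kk' (by omega : 0 < m + 1), onP_iff]
    constructor
    · rintro ⟨d, ⟨⟨h2, h3⟩, h4⟩, rfl⟩
      have h2 : (2 * π.q * m : ℝ) < π.ω * d := by exact_mod_cast h2
      have h3 : (π.ω * d : ℝ) < 2 * π.q * (m + 1) := by exact_mod_cast h3
      rw [← hQw] at h2 h3
      have i1 : (m:ℝ) < d / π.Q := by rw [lt_div_iff₀ hQ]; nlinarith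
      have i2 : d / π.Q < (m:ℝ) + 1 := by rw [div_lt_iff₀ hQ]; nlinarith
      refine ⟨⟨i1.le, i2.le⟩, ⟨d, by field_simp, h4⟩, ?_⟩
      rintro ⟨e, he⟩
      have h6 : π.Q * (d / π.Q) = d := by field_simp
      have h5 : 2 * (d / π.Q) = ((d + e : ℤ) : ℝ) := by
        push_cast; rw [← he, ← h6, ← hPQ]; field_simp; ring
      have h7 : d + e = 2 * m + 1 := by
        have a1 : ((2 * m : ℤ) : ℝ) < ((d + e : ℤ) : ℝ) := by rw [← h5]; push_cast; linarith
        have a2 : ((d + e : ℤ) : ℝ) < ((2 * m + 2 : ℤ) : ℝ) := by rw [← h5]; push_cast; linarith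
        have a1 : 2 * m < d + e := by exact_mod_cast a1
        have a2 : d + e < 2 * m + 2 := by exact_mod_cast a2
        omega
      rw [h7] at h5; push_cast at h5; linarith
    · rintro ⟨⟨h2, h3⟩, ⟨d, h4, h5⟩, h6⟩
      have i1 : (m:ℝ) < x := by
        rcases h2.eq_or_lt with h7 | h7
        · exfalso
          have := h6 ⟨2 * m - d, by push_cast; rw [← h7] at h4 ⊢; rw [← h4]; linear_combination (m:ℝ) * hPQ⟩
          linarith
        · exact h7
      have i2 : x < (m:ℝ) + 1 := by
        rcases h3.eq_or_lt with h7 | h7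
        · exfalso
          have := h6 ⟨2 * (m + 1) - d, by
            push_cast; rw [h7] at h4 ⊢; rw [← h4]; linear_combination ((m:ℝ) + 1) * hPQ⟩
          linarith
        · exact h7
      refine ⟨d, ⟨⟨?_, ?_⟩, h5⟩, by rw [← h4]; field_simp⟩
      · have : (2 * π.q * m : ℝ) < π.ω * d := by
          rw [← h4, ← hQw]; nlinarith [mul_pos hQ hw]
        exact_mod_cast this
      · have : (π.ω * d : ℝ) < 2 * π.q * (m + 1) := by
          rw [← h4, ← hQw]; nlinarith [mul_pos hQ hw]
        exact_mod_cast this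

def MM (m : ℤ) : ℕ := (m - 1 - π.kk m).toNat

theorem MM_cast {m : ℤ} (h : 0 ≤ m) : (π.MM m : ℤ) = m - 1 - π.kk m := by
  have := π.kk_le h; unfold MM; omega

theorem bet_bdry {m : ℤ} (h : m = 0 ∨ m = π.ω) : π.bet m = 0 := by
  rcases h with rfl | rfl
  · exact π.bet_zero
  · exact π.bet_ω

theorem vLightCount_eq {m : ℤ} (h : 0 ≤ m) (h1 : m ≤ π.ω) (n : ℤ) :
    π.vLightCount m n = (if π.Lam m (n - π.MM m) then 1 else 0) +
      (if π.Lam m (n + π.MM m + 1) then 1 else 0) := by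
  have hPQ := π.P_add_Q
  unfold vLightCount
  simp only [lightVP_iff, lightVQ_iff]
  by_cases hb : m = 0 ∨ m = π.ω
  · have := π.not_Lam_of_bet (π.bet_bdry hb)
    simp [this]
  push Not at hb
  have h0 : 0 < m := by omega
  have h2 : m < π.ω := by omega
  have hw := π.ωR_pos
  have hPw := π.P_mul_ω
  have hM := π.MM_cast h
  -- k < P m < k+1
  have b1 : (π.kk m : ℝ) < π.P * m := by
    have a1 := (π.le_kk h0 (π.kk m)).1 le_rfl
    have a2 := π.not_dvd_of h0 h2 (π.kk m)
    have : (π.ω:ℤ) * π.kk m < 2 * π.p * m := by omega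
    have : (π.ω:ℝ) * π.kk m < 2 * π.p * m := by exact_mod_cast this
    rw [← hPw] at this
    nlinarith
  have b2 : π.P * m < π.kk m + 1 := by
    have a1 := (π.le_kk h0 (π.kk m + 1)).not.1 (by omega)
    push Not at a1
    have : (2 * π.p * m : ℝ) < π.ω * (π.kk m + 1) := by exact_mod_cast a1
    rw [← hPw] at this
    nlinarith
  have hMR : (π.MM m : ℝ) = m - 1 - π.kk m := by exact_mod_cast hM
  congr 1
  · have key : ∀ y : ℝ, (y ∈ Set.Icc (n:ℝ) (n + 1) ∧ ∃ d : ℤ, y + π.P * m = m + d ∧ π.Lam m d) ↔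
        (y = m + (n - π.MM m) - π.P * m ∧ π.Lam m (n - π.MM m)) := by
      intro y
      constructor
      · rintro ⟨⟨h3, h4⟩, d, h5, h6⟩
        have : d = n - π.MM m := by
          have a1 : (d:ℝ) < n + π.kk m + 1 - m + 1 := by linarith
          have a2 : (n + π.kk m - m : ℝ) < d := by linarith
          have a1 : d < n + π.kk m + 1 - m + 1 := by exact_mod_cast a1
          have a2 : n + π.kk m - m < d := by exact_mod_cast a2
          omega
        subst this
        refine ⟨by push_cast at h5; linarith, h6⟩
      · rintro ⟨rfl, h6⟩
        exact ⟨⟨by rw [hMR]; linarith, by rw [hMR]; linarith⟩, n - π.MM m, by push_cast; ring, h6⟩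
    simp only [key]
    split_ifs with h7 <;> simp [h7]
  · have key : ∀ y : ℝ, (y ∈ Set.Icc (n:ℝ) (n + 1) ∧ ∃ d : ℤ, y + π.Q * m = m + d ∧ π.Lam m d) ↔
        (y = m + (n + π.MM m + 1) - π.Q * m ∧ π.Lam m (n + π.MM m + 1)) := by
      intro y
      have hQ : π.Q = 2 - π.P := by linarith
      rw [hQ]
      constructor
      · rintro ⟨⟨h3, h4⟩, d, h5, h6⟩
        have : d = n + π.MM m + 1 := by
          have a1 : (d:ℝ) < n + m - π.kk m + 1 := by linarith
          have a2 : (n + m - π.kk m - 1 : ℝ) < d := by linarith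
          have a1 : d < n + m - π.kk m + 1 := by exact_mod_cast a1
          have a2 : n + m - π.kk m - 1 < d := by exact_mod_cast a2
          omega
        subst this
        refine ⟨by push_cast at h5; linarith, h6⟩
      · rintro ⟨rfl, h6⟩
        exact ⟨⟨by rw [hMR]; linarith, by rw [hMR]; linarith⟩, n + π.MM m + 1, by push_cast; ring, h6⟩
    simp only [key]
    split_ifs with h7 <;> simp [h7]

/-- the colour -/
def col (m n : ℤ) : ZMod 2 := π.lam n 0 + π.wsum n m (π.MM m)

theorem zmod2_add_self (a : ZMod 2) : a + a = 0 := by revert a; decide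

theorem col_dual (m n : ℤ) : π.col m n = π.lam m 0 + π.wsum m n (π.MM m) := by
  unfold col
  have := π.duality n m (π.MM m)
  have e := zmod2_add_self
  linear_combination this + e (π.lam n 0) - e (π.wsum m n (π.MM m))

theorem wsum_eq {m : ℤ} (h : 0 ≤ m) (n : ℤ) :
    π.wsum n m (π.MM m) = ∑ d ∈ Finset.Ioc (π.kk m) (π.kk' m), π.lam n d := by
  unfold wsum
  congr 1
  ext d
  rw [π.MM_cast h, Finset.mem_Icc, Finset.mem_Ioc]
  unfold kk'; omega

theorem sum_Ioc_consec (f : ℤ → ZMod 2) {a b c : ℤ} (h1 : a ≤ b) (h2 : b ≤ c) :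
    ∑ d ∈ Finset.Ioc a c, f d = ∑ d ∈ Finset.Ioc a b, f d + ∑ d ∈ Finset.Ioc b c, f d := by
  rw [← Finset.sum_union]
  · congr 1; ext; simp only [Finset.mem_union, Finset.mem_Ioc]; omega
  · rw [Finset.disjoint_left]; intro x; simp only [Finset.mem_Ioc]; omega

theorem col_sub_h {m : ℤ} (h : 0 ≤ m) (h1 : m < π.ω) (n : ℤ) :
    π.col m n + π.col (m + 1) n = (π.hLightCount m n : ZMod 2) := by
  rw [π.hLightCount_eq h h1]
  push_cast
  rw [cnt_cast, cnt_cast]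
  unfold col
  rw [π.wsum_eq h, π.wsum_eq (by omega)]
  have a1 := π.kk_ge h
  have a2 := π.kk_mono1 h h1
  have a3 := π.kk'_mono1 h h1
  have a4 := π.kk_le_kk' h
  have a5 := π.kk_le_kk' (by omega : 0 ≤ m + 1)
  have b1 := sum_Ioc_consec (π.lam n) a2 a5
  have b2 := sum_Ioc_consec (π.lam n) a4 a3
  have e := zmod2_add_self
  linear_combination e (π.lam n 0) + b2 - b1 + e (∑ d ∈ Finset.Ioc (π.kk m) (π.kk' m), π.lam n d)
    - e (∑ d ∈ Finset.Ioc (π.kk m) (π.kk (m+1)), π.lam n d)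

theorem zmod2_natCast_eq_one {c : ℕ} (h : c ≤ 2) : (c : ZMod 2) = 1 ↔ c = 1 := by
  interval_cases c <;> decide

theorem hLightCount_le {m : ℤ} (h : 0 ≤ m) (h1 : m < π.ω) (n : ℤ) : π.hLightCount m n ≤ 2 := by
  rw [π.hLightCount_eq h h1]
  have a2 := π.kk_mono1 h h1
  have a3 := π.kk'_mono1 h h1
  have b1 : π.cnt n (π.kk m) (π.kk (m + 1)) ≤ (π.kk (m+1) - π.kk m).toNat := by
    unfold cnt; refine (Finset.card_filter_le _ _).trans ?_; simp
  have b2 : π.cnt n (π.kk' m) (π.kk' (m + 1)) ≤ (π.kk' (m+1) - π.kk' m).toNat := by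
    unfold cnt; refine (Finset.card_filter_le _ _).trans ?_; simp
  unfold kk' at *
  omega

theorem goodH_iff {m : ℤ} (h : 0 ≤ m) (h1 : m < π.ω) (n : ℤ) :
    π.goodH m n ↔ π.col m n + π.col (m + 1) n = 1 := by
  rw [π.col_sub_h h h1, zmod2_natCast_eq_one (π.hLightCount_le h h1 n)]; rfl

theorem goodV_iff {m : ℤ} (h : 0 ≤ m) (h1 : m ≤ π.ω) (n : ℤ) :
    π.goodV m n ↔ π.col m n + π.col m (n + 1) = 1 := by
  have hc : π.vLightCount m n ≤ 2 := by
    rw [π.vLightCount_eq h h1]; split_ifs <;> simp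
  unfold goodV
  rw [← zmod2_natCast_eq_one hc, π.vLightCount_eq h h1, col_dual, col_dual]
  have e := zmod2_add_self
  have : π.wsum m (n + 1) (π.MM m) + π.lam m (n - π.MM m) =
      π.wsum m n (π.MM m) + π.lam m (n + π.MM m + 1) := by
    have h1 := sum_Ioc_consec (π.lam m) (a := n - π.MM m - 1) (b := n - π.MM m) (c := n + π.MM m + 1) (by omega) (by omega)
    have h2 := sum_Ioc_consec (π.lam m) (a := n - π.MM m - 1) (b := n + π.MM m) (c := n + π.MM m + 1) (by omega) (by omega)
    have e1 : ∀ a : ℤ, Finset.Ioc (a - 1) a = {a} := by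
      intro a; ext; simp only [Finset.mem_Ioc, Finset.mem_singleton]; omega
    have e2 := e1 (n + π.MM m + 1)
    rw [add_sub_cancel_right] at e2
    rw [h1, e1, e2] at h2
    simp only [Finset.sum_singleton] at h2
    unfold wsum
    have e3 : Finset.Icc (n + 1 - (π.MM m : ℤ)) (n + 1 + π.MM m) = Finset.Ioc (n - π.MM m) (n + π.MM m + 1) := by
      ext; simp only [Finset.mem_Ioc, Finset.mem_Icc]; omega
    have e4 : Finset.Icc (n - (π.MM m : ℤ)) (n + π.MM m) = Finset.Ioc (n - π.MM m - 1) (n + π.MM m) := by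
      ext; simp only [Finset.mem_Ioc, Finset.mem_Icc]; omega
    rw [e3, e4]
    linear_combination h2
  have e5 : π.lam m 0 + π.wsum m n (π.MM m) + (π.lam m 0 + π.wsum m (n + 1) (π.MM m)) =
      π.lam m (n - π.MM m) + π.lam m (n + π.MM m + 1) := by
    linear_combination this + e (π.lam m 0) + e (π.wsum m n (π.MM m)) - e (π.lam m (n - π.MM m))
  rw [e5, lam_eq, lam_eq]
  push_cast
  rfl

theorem col_x_bdry {m : ℤ} (h : m = 0 ∨ m = π.ω) (n : ℤ) : π.col m n = 0 := by
  have := π.lam_of_bet (π.bet_bdry h)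
  rw [col_dual]; simp [wsum, this]

theorem col_y_bdry {n : ℤ} (h : n = 0 ∨ n = π.ω) (m : ℤ) : π.col m n = 0 := by
  have := π.lam_of_bet (π.bet_bdry h)
  unfold col; simp [wsum, this]

end Param


section pset

variable (GH GV : ℤ → ℤ → Prop)

def pset : Set (ℝ × ℝ) :=
  {z | ∃ m n : ℤ,
    (GH m n ∧ z ∈ segment ℝ ((m : ℝ) + 1 / 2, (n : ℝ) + 1 / 2) ((m : ℝ) + 1 / 2, (n : ℝ))) ∨
    (GH m (n + 1) ∧
      z ∈ segment ℝ ((m : ℝ) + 1 / 2, (n : ℝ) + 1 / 2) ((m : ℝ) + 1 / 2, (n : ℝ) + 1)) ∨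
    (GV m n ∧ z ∈ segment ℝ ((m : ℝ) + 1 / 2, (n : ℝ) + 1 / 2) ((m : ℝ), (n : ℝ) + 1 / 2)) ∨
    (GV (m + 1) n ∧
      z ∈ segment ℝ ((m : ℝ) + 1 / 2, (n : ℝ) + 1 / 2) ((m : ℝ) + 1, (n : ℝ) + 1 / 2))}

def hmid (m n : ℤ) : ℝ × ℝ := ((m : ℝ) + 1 / 2, (n : ℝ))
def vmid (m n : ℤ) : ℝ × ℝ := ((m : ℝ), (n : ℝ) + 1 / 2)
def cmid (m n : ℤ) : ℝ × ℝ := ((m : ℝ) + 1 / 2, (n : ℝ) + 1 / 2)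

theorem seg_vert {x y1 y2 : ℝ} {z : ℝ × ℝ} (h : z ∈ segment ℝ (x, y1) (x, y2)) :
    z.1 = x ∧ ∃ t, 0 ≤ t ∧ t ≤ 1 ∧ z.2 = y1 + t * (y2 - y1) := by
  obtain ⟨a, b, ha, hb, hab, rfl⟩ := h
  constructor
  · simp only [Prod.smul_mk, Prod.mk_add_mk, smul_eq_mul]; rw [← add_mul, hab, one_mul]
  · refine ⟨b, hb, by linarith, ?_⟩
    simp only [Prod.smul_mk, Prod.mk_add_mk, smul_eq_mul]
    have : a = 1 - b := by linarith
    rw [this]; ring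

theorem seg_horiz {y x1 x2 : ℝ} {z : ℝ × ℝ} (h : z ∈ segment ℝ (x1, y) (x2, y)) :
    z.2 = y ∧ ∃ t, 0 ≤ t ∧ t ≤ 1 ∧ z.1 = x1 + t * (x2 - x1) := by
  obtain ⟨a, b, ha, hb, hab, rfl⟩ := h
  constructor
  · simp only [Prod.smul_mk, Prod.mk_add_mk, smul_eq_mul]; rw [← add_mul, hab, one_mul]
  · refine ⟨b, hb, by linarith, ?_⟩
    simp only [Prod.smul_mk, Prod.mk_add_mk, smul_eq_mul]
    have : a = 1 - b := by linarith
    rw [this]; ring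

theorem half_ne_int (m a : ℤ) : (m : ℝ) + 1 / 2 ≠ a := by
  intro h
  have : ((2 * m + 1 : ℤ) : ℝ) = ((2 * a : ℤ) : ℝ) := by push_cast; linarith
  have : 2 * m + 1 = 2 * a := by exact_mod_cast this
  omega

theorem near_half_int (m a : ℤ) (t : ℝ) (h0 : 0 ≤ t) (h1 : t ≤ 1)
    (h : (a:ℝ) = (m:ℝ) + 1 / 2 + t * ((m:ℝ) - (m + 1 / 2))) : a = m ∧ t = 1 := by
  have h2 : (m:ℝ) ≤ a := by linarith
  have h3 : (a:ℝ) < m + 1 := by linarith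
  have h2 : m ≤ a := by exact_mod_cast h2
  have h3 : a < m + 1 := by exact_mod_cast h3
  have : a = m := by omega
  subst this; exact ⟨rfl, by linarith⟩

theorem near_half_int' (m a : ℤ) (t : ℝ) (h0 : 0 ≤ t) (h1 : t ≤ 1)
    (h : (a:ℝ) = (m:ℝ) + 1 / 2 + t * ((m:ℝ) + 1 - (m + 1 / 2))) : a = m + 1 ∧ t = 1 := by
  have h2 : (m:ℝ) < a := by linarith
  have h3 : (a:ℝ) ≤ m + 1 := by linarith
  have h2 : m < a := by exact_mod_cast h2
  have h3 : a ≤ m + 1 := by exact_mod_cast h3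
  have : a = m + 1 := by omega
  subst this; push_cast at h; exact ⟨rfl, by linarith⟩

theorem pset_on_V {z : ℝ × ℝ} (hz : z ∈ pset GH GV) {a : ℤ} (ha : z.1 = a) :
    ∃ n, z = vmid a n ∧ GV a n := by
  obtain ⟨m, n, h | h | h | h⟩ := hz
  · obtain ⟨h1, -⟩ := seg_vert h.2
    rw [ha] at h1; exact absurd h1.symm (half_ne_int m a)
  · obtain ⟨h1, -⟩ := seg_vert h.2
    rw [ha] at h1; exact absurd h1.symm (half_ne_int m a)
  · obtain ⟨h1, t, h2, h3, h4⟩ := seg_horiz h.2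
    rw [ha] at h4
    obtain ⟨rfl, -⟩ := near_half_int m a t h2 h3 h4
    exact ⟨n, Prod.ext ha h1, h.1⟩
  · obtain ⟨h1, t, h2, h3, h4⟩ := seg_horiz h.2
    rw [ha] at h4
    obtain ⟨rfl, -⟩ := near_half_int' m a t h2 h3 h4
    exact ⟨n, Prod.ext ha h1, h.1⟩

theorem pset_on_H {z : ℝ × ℝ} (hz : z ∈ pset GH GV) {a : ℤ} (ha : z.2 = a) :
    ∃ m, z = hmid m a ∧ GH m a := by
  obtain ⟨m, n, h | h | h | h⟩ := hz
  · obtain ⟨h1, t, h2, h3, h4⟩ := seg_vert h.2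
    rw [ha] at h4
    obtain ⟨rfl, -⟩ := near_half_int n a t h2 h3 h4
    exact ⟨m, Prod.ext h1 ha, h.1⟩
  · obtain ⟨h1, t, h2, h3, h4⟩ := seg_vert h.2
    rw [ha] at h4
    obtain ⟨rfl, -⟩ := near_half_int' n a t h2 h3 h4
    exact ⟨m, Prod.ext h1 ha, h.1⟩
  · obtain ⟨h1, -⟩ := seg_horiz h.2
    rw [ha] at h1; exact absurd h1.symm (half_ne_int n a)
  · obtain ⟨h1, -⟩ := seg_horiz h.2
    rw [ha] at h1; exact absurd h1.symm (half_ne_int n a)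

/-- a component meeting the interior of a rectangle with no good boundary edges stays inside -/
theorem comp_in_rect {a b c d : ℤ}
    (h1 : ∀ n, c ≤ n → n < d → ¬ GV a n ∧ ¬ GV b n)
    (h2 : ∀ m, a ≤ m → m < b → ¬ GH m c ∧ ¬ GH m d)
    {z : ℝ × ℝ} (hz : z ∈ pset GH GV)
    (hz1 : z ∈ Set.Ioo (a:ℝ) b ×ˢ Set.Ioo (c:ℝ) d) :
    connectedComponentIn (pset GH GV) z ⊆ Set.Ioo (a:ℝ) b ×ˢ Set.Ioo (c:ℝ) d := by
  have hpre : IsPreconnected (connectedComponentIn (pset GH GV) z) :=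
    isPreconnected_connectedComponentIn
  have hsub := connectedComponentIn_subset (pset GH GV) z
  apply hpre.subset_left_of_subset_union (v := (Set.Icc (a:ℝ) b ×ˢ Set.Icc (c:ℝ) d)ᶜ)
  · exact isOpen_Ioo.prod isOpen_Ioo
  · exact (isClosed_Icc.prod isClosed_Icc).isOpen_compl
  · rw [Set.disjoint_compl_right_iff_subset]
    exact Set.prod_mono Set.Ioo_subset_Icc_self Set.Ioo_subset_Icc_self
  · intro y hy
    have hy' := hsub hy
    by_contra hcon
    simp only [Set.mem_union, not_or, Set.mem_compl_iff, not_not] at hcon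
    obtain ⟨k1, ⟨k2, k3⟩, k4, k5⟩ := hcon
    have key : y.1 = a ∨ y.1 = b ∨ y.2 = c ∨ y.2 = d := by
      by_contra hne
      push Not at hne
      exact k1 ⟨⟨lt_of_le_of_ne k2 (Ne.symm hne.1), lt_of_le_of_ne k3 hne.2.1⟩,
        lt_of_le_of_ne k4 (Ne.symm hne.2.2.1), lt_of_le_of_ne k5 hne.2.2.2⟩
    have hv : ∀ n : ℤ, (c:ℝ) ≤ n + 1 / 2 → (n:ℝ) + 1 / 2 ≤ d → c ≤ n ∧ n < d := by
      intro n e1 e2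
      have e1 : (c:ℝ) < n + 1 := by linarith
      have e2 : (n:ℝ) < d := by linarith
      have e1 : c < n + 1 := by exact_mod_cast e1
      have e2 : n < d := by exact_mod_cast e2
      omega
    have hh : ∀ n : ℤ, (a:ℝ) ≤ n + 1 / 2 → (n:ℝ) + 1 / 2 ≤ b → a ≤ n ∧ n < b := by
      intro n e1 e2
      have e1 : (a:ℝ) < n + 1 := by linarith
      have e2 : (n:ℝ) < b := by linarith
      have e1 : a < n + 1 := by exact_mod_cast e1
      have e2 : n < b := by exact_mod_cast e2
      omega
    rcases key with key | key | key | key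
    · obtain ⟨n, rfl, hg⟩ := pset_on_V GH GV hy' key
      obtain ⟨e1, e2⟩ := hv n k4 k5
      exact (h1 n e1 e2).1 hg
    · obtain ⟨n, rfl, hg⟩ := pset_on_V GH GV hy' key
      obtain ⟨e1, e2⟩ := hv n k4 k5
      exact (h1 n e1 e2).2 hg
    · obtain ⟨n, rfl, hg⟩ := pset_on_H GH GV hy' key
      obtain ⟨e1, e2⟩ := hh n k2 k3
      exact (h2 n e1 e2).1 hg
    · obtain ⟨n, rfl, hg⟩ := pset_on_H GH GV hy' key
      obtain ⟨e1, e2⟩ := hh n k2 k3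
      exact (h2 n e1 e2).2 hg
  · exact ⟨z, mem_connectedComponentIn hz, hz1⟩

def comp (z : ℝ × ℝ) : Set (ℝ × ℝ) := connectedComponentIn (pset GH GV) z

theorem comp_eq_of_segment {x y : ℝ × ℝ} (h : segment ℝ x y ⊆ pset GH GV) :
    comp GH GV y = comp GH GV x := by
  have hx : x ∈ segment ℝ x y := left_mem_segment ℝ x y
  have hy : y ∈ segment ℝ x y := right_mem_segment ℝ x y
  have hc : IsPreconnected (segment ℝ x y) := (convex_segment x y).isPreconnected
  exact (connectedComponentIn_eq (hc.subset_connectedComponentIn hx h hy)).symm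

theorem comp_S {m n : ℤ} (h : GH m n) : comp GH GV (hmid m n) = comp GH GV (cmid m n) :=
  comp_eq_of_segment GH GV fun _ hz => ⟨m, n, Or.inl ⟨h, hz⟩⟩
theorem comp_N {m n : ℤ} (h : GH m (n + 1)) :
    comp GH GV (hmid m (n + 1)) = comp GH GV (cmid m n) := by
  apply comp_eq_of_segment GH GV
  intro z hz
  refine ⟨m, n, Or.inr (Or.inl ⟨h, ?_⟩)⟩
  simpa [hmid, cmid] using hz
theorem comp_W {m n : ℤ} (h : GV m n) : comp GH GV (vmid m n) = comp GH GV (cmid m n) :=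
  comp_eq_of_segment GH GV fun _ hz => ⟨m, n, Or.inr (Or.inr (Or.inl ⟨h, hz⟩))⟩
theorem comp_E {m n : ℤ} (h : GV (m + 1) n) :
    comp GH GV (vmid (m + 1) n) = comp GH GV (cmid m n) := by
  apply comp_eq_of_segment GH GV
  intro z hz
  refine ⟨m, n, Or.inr (Or.inr (Or.inr ⟨h, ?_⟩))⟩
  simpa [vmid, cmid] using hz

theorem hmid_mem {m n : ℤ} (h : GH m n) : hmid m n ∈ pset GH GV :=
  ⟨m, n, Or.inl ⟨h, right_mem_segment _ _ _⟩⟩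
theorem vmid_mem {m n : ℤ} (h : GV m n) : vmid m n ∈ pset GH GV :=
  ⟨m, n, Or.inr (Or.inr (Or.inl ⟨h, right_mem_segment _ _ _⟩))⟩

def iH (Γ : Set (ℝ × ℝ)) (m n : ℤ) : ZMod 2 := if GH m n ∧ comp GH GV (hmid m n) = Γ then 1 else 0
def iV (Γ : Set (ℝ × ℝ)) (m n : ℤ) : ZMod 2 := if GV m n ∧ comp GH GV (vmid m n) = Γ then 1 else 0

structure Coloured (X0 Y0 W : ℤ) (C : ℤ → ℤ → ZMod 2) : Prop where
  posW : 0 < W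
  hH : ∀ m n, X0 ≤ m → m < X0 + W → (GH m n ↔ C m n + C (m + 1) n = 1)
  hV : ∀ m n, X0 ≤ m → m ≤ X0 + W → (GV m n ↔ C m n + C m (n + 1) = 1)
  bx0 : ∀ n, C X0 n = 0
  bx1 : ∀ n, C (X0 + W) n = 0
  by0 : ∀ m, C m Y0 = 0
  by1 : ∀ m, C m (Y0 + W) = 0

variable {GH GV} {X0 Y0 W : ℤ} {C : ℤ → ℤ → ZMod 2}

theorem zmod2_ite {p : Prop} [Decidable p] {a : ZMod 2} (h : p ↔ a = 1) :
    (if p then (1:ZMod 2) else 0) = a := by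
  split_ifs with hp
  · exact (h.1 hp).symm
  · have : a ≠ 1 := fun h' => hp (h.2 h')
    clear h; revert a; decide

theorem square_sum (hC : Coloured GH GV X0 Y0 W C) (Γ : Set (ℝ × ℝ)) {m : ℤ} (n : ℤ) (h0 : X0 ≤ m) (h1 : m < X0 + W) :
    iH GH GV Γ m n + iH GH GV Γ m (n + 1) + iV GH GV Γ m n + iV GH GV Γ (m + 1) n = 0 := by
  by_cases hΓ : comp GH GV (cmid m n) = Γ
  · have e1 : iH GH GV Γ m n = C m n + C (m + 1) n := by
      unfold iH
      apply zmod2_ite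
      rw [← hC.hH m n h0 h1]
      exact ⟨fun h => h.1, fun h => ⟨h, by rw [comp_S GH GV h, hΓ]⟩⟩
    have e2 : iH GH GV Γ m (n + 1) = C m (n + 1) + C (m + 1) (n + 1) := by
      unfold iH
      apply zmod2_ite
      rw [← hC.hH m (n + 1) h0 h1]
      exact ⟨fun h => h.1, fun h => ⟨h, by rw [comp_N GH GV h, hΓ]⟩⟩
    have e3 : iV GH GV Γ m n = C m n + C m (n + 1) := by
      unfold iV
      apply zmod2_ite
      rw [← hC.hV m n h0 (by omega)]
      exact ⟨fun h => h.1, fun h => ⟨h, by rw [comp_W GH GV h, hΓ]⟩⟩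
    have e4 : iV GH GV Γ (m + 1) n = C (m + 1) n + C (m + 1) (n + 1) := by
      unfold iV
      apply zmod2_ite
      rw [← hC.hV (m + 1) n (by omega) (by omega)]
      exact ⟨fun h => h.1, fun h => ⟨h, by rw [comp_E GH GV h, hΓ]⟩⟩
    rw [e1, e2, e3, e4]
    generalize C m n = a, C (m + 1) n = b, C m (n + 1) = c, C (m + 1) (n + 1) = d
    revert a b c d; decide
  · unfold iH iV
    rw [if_neg, if_neg, if_neg, if_neg]
    · simp
    · rintro ⟨h, h'⟩; rw [comp_E GH GV h] at h'; exact hΓ h'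
    · rintro ⟨h, h'⟩; rw [comp_W GH GV h] at h'; exact hΓ h'
    · rintro ⟨h, h'⟩; rw [comp_N GH GV h] at h'; exact hΓ h'
    · rintro ⟨h, h'⟩; rw [comp_S GH GV h] at h'; exact hΓ h'

def rr (GH GV : ℤ → ℤ → Prop) (X0 : ℤ) (Γ : Set (ℝ × ℝ)) (j : ℕ) (n : ℤ) : ZMod 2 :=
  ∑ i ∈ Finset.range j, iH GH GV Γ (X0 + i) n

theorem rr_step (hC : Coloured GH GV X0 Y0 W C) (Γ : Set (ℝ × ℝ)) (j : ℕ) (hj : (j:ℤ) ≤ W) (n : ℤ) :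
    rr GH GV X0 Γ j n + rr GH GV X0 Γ j (n + 1) = iV GH GV Γ (X0 + j) n := by
  induction j with
  | zero =>
    have : ¬ GV X0 n := by
      rw [hC.hV X0 n le_rfl (by have := hC.posW; omega), hC.bx0, hC.bx0]; decide
    simp [rr, iV, this]
  | succ j ih =>
    have ih := ih (by push_cast at hj; omega)
    have sq := square_sum hC Γ (m := X0 + j) n (by omega) (by push_cast at hj; omega)
    unfold rr at ih ⊢
    rw [Finset.sum_range_succ, Finset.sum_range_succ]
    push_cast
    rw [← add_assoc X0]
    have e := Param.zmod2_add_self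
    linear_combination ih + sq - e (iV GH GV Γ (X0 + j + 1) n)

theorem rr_full (hC : Coloured GH GV X0 Y0 W C) (Γ : Set (ℝ × ℝ)) (j : ℕ) (hj : (j:ℤ) = W) (t : ℕ) :
    rr GH GV X0 Γ j (Y0 + t) = 0 := by
  induction t with
  | zero =>
    unfold rr
    apply Finset.sum_eq_zero
    intro i hi
    rw [Finset.mem_range] at hi
    have : ¬ GH (X0 + i) Y0 := by
      rw [hC.hH (X0 + i) Y0 (by omega) (by omega), hC.by0, hC.by0]; decide
    simp [iH, this]
  | succ t ih =>
    have := rr_step hC Γ j hj.le (Y0 + t)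
    have h2 : ¬ GV (X0 + j) (Y0 + t) := by
      rw [hC.hV (X0 + j) (Y0 + t) (by have := hC.posW; omega) (by omega), hj, hC.bx1, hC.bx1]; decide
    rw [ih, iV, if_neg (fun h => h2 h.1), zero_add] at this
    push_cast
    rw [← add_assoc]; exact this

theorem sum_col (hC : Coloured GH GV X0 Y0 W C) (m n1 : ℤ) (h0 : X0 ≤ m) (h1 : m ≤ X0 + W) (t : ℕ) :
    ∑ i ∈ Finset.range t, (if GV m (n1 + i) then (1:ZMod 2) else 0) = C m n1 + C m (n1 + t) := by
  induction t with
  | zero => simp [Param.zmod2_add_self]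
  | succ t ih =>
    rw [Finset.sum_range_succ, ih]
    have : (if GV m (n1 + t) then (1:ZMod 2) else 0) = C m (n1 + t) + C m (n1 + t + 1) := by
      apply zmod2_ite
      rw [hC.hV _ _ h0 h1]
    rw [this]
    push_cast
    rw [← add_assoc n1]
    have e := Param.zmod2_add_self
    linear_combination e (C m (n1 + t))

theorem rr_tel (hC : Coloured GH GV X0 Y0 W C) (Γ : Set (ℝ × ℝ)) (j : ℕ) (hj : (j:ℤ) ≤ W) (n1 : ℤ) (t : ℕ) :
    ∑ i ∈ Finset.range t, iV GH GV Γ (X0 + j) (n1 + i) =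
      rr GH GV X0 Γ j n1 + rr GH GV X0 Γ j (n1 + t) := by
  induction t with
  | zero => simp [Param.zmod2_add_self]
  | succ t ih =>
    rw [Finset.sum_range_succ, ih, ← rr_step hC Γ j hj]
    push_cast
    rw [← add_assoc n1]
    have e := Param.zmod2_add_self
    linear_combination e (rr GH GV X0 Γ j (n1 + t))

theorem exists_of_sum_one {s : Finset ℕ} {f : ℕ → ZMod 2} (h : ∑ i ∈ s, f i = 1) :
    ∃ i ∈ s, f i = 1 := by
  by_contra hc
  push Not at hc
  have : ∀ i ∈ s, f i = 0 := by
    intro i hi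
    have := hc i hi
    generalize f i = a at this
    revert a; decide
  rw [Finset.sum_eq_zero this] at h
  exact absurd h (by decide)

theorem crossing (hC : Coloured GH GV X0 Y0 W C) (m n1 n2 : ℤ) (h0 : X0 ≤ m) (h1 : m ≤ X0 + W) (hn0 : Y0 ≤ n1) (hn : n1 ≤ n2)
    (hne : C m n1 ≠ C m n2) :
    ∃ n, n1 ≤ n ∧ n < n2 ∧ GV m n ∧ ∃ n', (n' = n1 ∨ n' = n2) ∧ ∃ m1 m2, X0 ≤ m1 ∧ m1 < m ∧
      m ≤ m2 ∧ m2 < X0 + W ∧ GH m1 n' ∧ GH m2 n' ∧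
      comp GH GV (hmid m1 n') = comp GH GV (vmid m n) ∧
      comp GH GV (hmid m2 n') = comp GH GV (vmid m n) := by
  obtain ⟨t, ht⟩ : ∃ t : ℕ, n2 = n1 + t := ⟨(n2 - n1).toNat, by omega⟩
  obtain ⟨j, hj⟩ : ∃ j : ℕ, m = X0 + j := ⟨(m - X0).toNat, by omega⟩
  obtain ⟨J, hJ⟩ : ∃ J : ℕ, (J:ℤ) = W := ⟨W.toNat, by have := hC.posW; omega⟩
  obtain ⟨s, hs⟩ : ∃ s : ℕ, n1 = Y0 + s := ⟨(n1 - Y0).toNat, by omega⟩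
  have hsum := sum_col hC m n1 h0 h1 t
  have h1' : C m n1 + C m (n1 + t) = 1 := by
    rw [← ht]
    generalize C m n1 = a, C m n2 = b at hne
    revert a b; decide
  rw [h1'] at hsum
  set F := (Finset.range t).image (fun i : ℕ => comp GH GV (vmid m (n1 + i))) with hF
  have hsplit : ∑ Γ ∈ F, ∑ i ∈ Finset.range t, iV GH GV Γ m (n1 + i) = 1 := by
    rw [Finset.sum_comm, ← hsum]
    apply Finset.sum_congr rfl
    intro i hi
    unfold iV
    by_cases hg : GV m (n1 + i)
    · simp only [hg, true_and, if_true]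
      rw [Finset.sum_ite_eq, if_pos]
      rw [hF]; exact Finset.mem_image_of_mem _ hi
    · simp [hg]
  obtain ⟨Γ, -, hΓ⟩ : ∃ Γ ∈ F, ∑ i ∈ Finset.range t, iV GH GV Γ m (n1 + i) = 1 := by
    by_contra hc
    push Not at hc
    have : ∀ i ∈ F, ∑ k ∈ Finset.range t, iV GH GV i m (n1 + k) = 0 := by
      intro i hi
      have := hc i hi
      generalize ∑ k ∈ Finset.range t, iV GH GV i m (n1 + k) = a at this
      revert a; decide
    rw [Finset.sum_eq_zero this] at hsplit
    exact absurd hsplit (by decide)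
  obtain ⟨i, hi, hi'⟩ := exists_of_sum_one hΓ
  have hgv : GV m (n1 + i) ∧ comp GH GV (vmid m (n1 + i)) = Γ := by
    by_contra hc
    rw [iV, if_neg hc] at hi'; exact absurd hi' (by decide)
  rw [hj, rr_tel hC Γ j (by omega) n1 t] at hΓ
  rw [Finset.mem_range] at hi
  refine ⟨n1 + i, by omega, by omega, hgv.1, ?_⟩
  have key : ∀ u : ℕ, rr GH GV X0 Γ j (Y0 + u) = 1 → ∃ m1 m2, X0 ≤ m1 ∧ m1 < m ∧
      m ≤ m2 ∧ m2 < X0 + W ∧ GH m1 (Y0 + u) ∧ GH m2 (Y0 + u) ∧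
      comp GH GV (hmid m1 (Y0 + u)) = comp GH GV (vmid m (n1 + i)) ∧
      comp GH GV (hmid m2 (Y0 + u)) = comp GH GV (vmid m (n1 + i)) := by
    intro u hu
    have hfull := rr_full hC Γ J hJ u
    have hu2 : ∑ i ∈ Finset.Ico j J, iH GH GV Γ (X0 + i) (Y0 + u) = 1 := by
      have := Finset.sum_range_add_sum_Ico (fun i : ℕ => iH GH GV Γ (X0 + i) (Y0 + u)) (show j ≤ J by omega)
      unfold rr at hfull hu
      rw [hfull, hu] at this
      generalize ∑ i ∈ Finset.Ico j J, iH GH GV Γ (X0 + i) (Y0 + u) = a at this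
      revert a; decide
    obtain ⟨i1, a1, a2⟩ := exists_of_sum_one hu
    obtain ⟨i2, b1, b2⟩ := exists_of_sum_one hu2
    rw [Finset.mem_range] at a1
    rw [Finset.mem_Ico] at b1
    have a3 : GH (X0 + i1) (Y0 + u) ∧ comp GH GV (hmid (X0 + i1) (Y0 + u)) = Γ := by
      by_contra hc
      rw [iH, if_neg hc] at a2; exact absurd a2 (by decide)
    have b3 : GH (X0 + i2) (Y0 + u) ∧ comp GH GV (hmid (X0 + i2) (Y0 + u)) = Γ := by
      by_contra hc
      rw [iH, if_neg hc] at b2; exact absurd b2 (by decide)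
    exact ⟨X0 + i1, X0 + i2, by omega, by omega, by omega, by omega, a3.1, b3.1,
      by rw [a3.2, hgv.2], by rw [b3.2, hgv.2]⟩
  have hor : rr GH GV X0 Γ j n1 = 1 ∨ rr GH GV X0 Γ j (n1 + t) = 1 := by
    generalize rr GH GV X0 Γ j n1 = a, rr GH GV X0 Γ j (n1 + t) = b at hΓ
    revert a b; decide
  rcases hor with h | h
  · refine ⟨n1, Or.inl rfl, ?_⟩
    rw [hs] at h ⊢
    rw [hs] at key
    exact key s h
  · refine ⟨n1 + t, Or.inr ht.symm, ?_⟩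
    have e : n1 + (t:ℤ) = Y0 + ((s + t : ℕ) : ℤ) := by rw [hs]; push_cast; ring
    rw [e] at h ⊢
    exact key _ h

end pset

namespace Param
variable (π : Param)

theorem plaidSet_eq : π.plaidSet = pset π.goodH π.goodV := rfl

theorem coloured (A B : ℤ) : Coloured π.goodH π.goodV ((π.ω:ℤ) ^ 2 * A) ((π.ω:ℤ) * B) π.ω
    (fun m n => π.col (m - (π.ω:ℤ) ^ 2 * A) (n - (π.ω:ℤ) * B)) where
  posW := π.ωZ_pos
  hH := by
    intro m n h0 h1
    have := π.hLightCount_translate A B (m - (π.ω:ℤ) ^ 2 * A) (n - (π.ω:ℤ) * B)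
    have h2 := π.goodH_iff (m := m - (π.ω:ℤ) ^ 2 * A) (by omega) (by omega) (n - (π.ω:ℤ) * B)
    unfold goodH at h2 ⊢
    rw [← this] at h2
    simp only [add_sub_cancel] at h2
    rw [h2, sub_add_eq_add_sub]
  hV := by
    intro m n h0 h1
    have := π.vLightCount_translate A B (m - (π.ω:ℤ) ^ 2 * A) (n - (π.ω:ℤ) * B)
    have h2 := π.goodV_iff (m := m - (π.ω:ℤ) ^ 2 * A) (by omega) (by omega) (n - (π.ω:ℤ) * B)
    unfold goodV at h2 ⊢
    rw [← this] at h2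
    simp only [add_sub_cancel] at h2
    rw [h2, sub_add_eq_add_sub]
  bx0 := fun n => π.col_x_bdry (Or.inl (by ring)) _
  bx1 := fun n => π.col_x_bdry (Or.inr (by ring)) _
  by0 := fun n => π.col_y_bdry (Or.inl (by ring)) _
  by1 := fun n => π.col_y_bdry (Or.inr (by ring)) _

end Param


namespace Param
variable (π : Param)

/-- a polygon from a colour change -/
theorem exists_polygon (A B m n1 n2 L : ℤ) (hm0 : 0 ≤ m) (hm1 : m ≤ π.ω) (h0 : 0 ≤ n1)
    (h12 : n1 ≤ n2) (h2 : n2 ≤ π.ω) (hL : 1 ≤ L) (hne : π.col m n1 ≠ π.col m n2)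
    (hc : ∀ m', m - L ≤ m' → m' ≤ m + L → 0 ≤ m' → m' ≤ π.ω →
      π.col m' n1 = π.col m n1 ∧ π.col m' n2 = π.col m n2) :
    ∃ n, n1 ≤ n ∧ n < n2 ∧ 0 < m ∧ m < π.ω ∧
      vmid ((π.ω:ℤ) ^ 2 * A + m) ((π.ω:ℤ) * B + n) ∈ π.plaidSet ∧
      connectedComponentIn π.plaidSet (vmid ((π.ω:ℤ) ^ 2 * A + m) ((π.ω:ℤ) * B + n)) ⊆
        π.block A B ∧
      2 * (L:ℝ) ≤ Metric.diam (Prod.fst '' connectedComponentIn π.plaidSet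
        (vmid ((π.ω:ℤ) ^ 2 * A + m) ((π.ω:ℤ) * B + n))) := by
  have hC := π.coloured A B
  have hmne : m ≠ 0 ∧ m ≠ π.ω := by
    constructor <;> intro h <;> apply hne
    · rw [π.col_x_bdry (Or.inl h), π.col_x_bdry (Or.inl h)]
    · rw [π.col_x_bdry (Or.inr h), π.col_x_bdry (Or.inr h)]
  obtain ⟨n, a1, a2, a3, n', a4, m1, m2, b1, b2, b3, b4, b5, b6, b7, b8⟩ :=
    crossing hC ((π.ω:ℤ) ^ 2 * A + m) ((π.ω:ℤ) * B + n1) ((π.ω:ℤ) * B + n2) (by omega) (by omega)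
      (by omega) (by omega) (by simpa using hne)
  have hmem := vmid_mem π.goodH π.goodV a3
  have hn : (π.ω:ℤ) * B + (n - (π.ω:ℤ) * B) = n := by ring
  have hrect : connectedComponentIn π.plaidSet (vmid ((π.ω:ℤ) ^ 2 * A + m) n) ⊆
      Set.Ioo ((((π.ω:ℤ) ^ 2 * A : ℤ)) : ℝ) (((π.ω:ℤ) ^ 2 * A + π.ω : ℤ) : ℝ) ×ˢ
      Set.Ioo ((((π.ω:ℤ) * B : ℤ)) : ℝ) (((π.ω:ℤ) * B + π.ω : ℤ) : ℝ) := by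
    apply comp_in_rect π.goodH π.goodV _ _ hmem
    · constructor
      · simp only [vmid]
        constructor <;> exact_mod_cast (by omega)
      · simp only [vmid]
        constructor
        · have : ((π.ω:ℤ) * B) ≤ n := by omega
          have : (((π.ω:ℤ) * B : ℤ) : ℝ) ≤ n := by exact_mod_cast this
          linarith
        · have : n + 1 ≤ ((π.ω:ℤ) * B) + π.ω := by omega
          have : (n:ℝ) + 1 ≤ (((π.ω:ℤ) * B + π.ω : ℤ) : ℝ) := by exact_mod_cast this
          linarith
    · intro k _ _
      rw [hC.hV _ _ le_rfl (by omega), hC.hV _ _ (by omega) le_rfl, hC.bx0, hC.bx0, hC.bx1, hC.bx1]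
      decide
    · intro k h1 h2
      rw [hC.hH _ _ h1 h2, hC.hH _ _ h1 h2, hC.by0, hC.by0, hC.by1, hC.by1]
      decide
  have hbd : Bornology.IsBounded (Prod.fst '' connectedComponentIn π.plaidSet
        (vmid ((π.ω:ℤ) ^ 2 * A + m) n)) := by
    apply (Metric.isBounded_Ioo ((((π.ω:ℤ) ^ 2 * A : ℤ)) : ℝ) (((π.ω:ℤ) ^ 2 * A + π.ω : ℤ) : ℝ)).subset
    rintro _ ⟨z, hz, rfl⟩
    exact (hrect hz).1
  refine ⟨n - (π.ω:ℤ) * B, by omega, by omega, by omega, by omega, ?_, ?_, ?_⟩ <;> rw [hn]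
  · exact hmem
  · intro z hz
    have := hrect hz
    obtain ⟨⟨c1, c2⟩, c3, c4⟩ := this
    push_cast at c1 c2 c3 c4
    exact ⟨⟨c1.le, c3.le⟩, c2.le, c4.le⟩
  · have e1 : hmid m1 n' ∈ connectedComponentIn π.plaidSet (vmid ((π.ω:ℤ) ^ 2 * A + m) n) := by
      have := mem_connectedComponentIn (hmid_mem π.goodH π.goodV b5)
      unfold comp at b7; rw [b7] at this; exact this
    have e2 : hmid m2 n' ∈ connectedComponentIn π.plaidSet (vmid ((π.ω:ℤ) ^ 2 * A + m) n) := by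
      have := mem_connectedComponentIn (hmid_mem π.goodH π.goodV b6)
      unfold comp at b8; rw [b8] at this; exact this
    have hd := Metric.dist_le_diam_of_mem hbd (Set.mem_image_of_mem _ e2) (Set.mem_image_of_mem _ e1)
    have hdist : (m2 - m1 : ℝ) ≤ dist (hmid m2 n').1 (hmid m1 n').1 := by
      rw [Real.dist_eq]; simp only [hmid]
      refine le_trans (le_of_eq ?_) (le_abs_self _); ring
    obtain ⟨nn, hnn, hnn'⟩ : ∃ nn, n' = (π.ω:ℤ) * B + nn ∧ (nn = n1 ∨ nn = n2) := by
      rcases a4 with h | h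
      · exact ⟨n1, h, Or.inl rfl⟩
      · exact ⟨n2, h, Or.inr rfl⟩
    have hcc : ∀ m', m - L ≤ m' → m' ≤ m + L → 0 ≤ m' → m' ≤ π.ω → π.col m' nn = π.col m nn := by
      intro m' x1 x2 x3 x4
      rcases hnn' with rfl | rfl
      · exact (hc m' x1 x2 x3 x4).1
      · exact (hc m' x1 x2 x3 x4).2
    have hg1 := (hC.hH m1 n' b1 (by omega)).1 b5
    have hg2 := (hC.hH m2 n' (by omega) b4).1 b6
    simp only [hnn, add_sub_cancel_left] at hg1 hg2
    have f1 : m1 - (π.ω:ℤ) ^ 2 * A < m - L := by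
      by_contra hcon
      rw [hcc (m1 - (π.ω:ℤ) ^ 2 * A) (by omega) (by omega) (by omega) (by omega),
        hcc (m1 + 1 - (π.ω:ℤ) ^ 2 * A) (by omega) (by omega) (by omega) (by omega), zmod2_add_self] at hg1
      exact absurd hg1 (by decide)
    have f2 : m + L ≤ m2 - (π.ω:ℤ) ^ 2 * A := by
      by_contra hcon
      rw [hcc (m2 - (π.ω:ℤ) ^ 2 * A) (by omega) (by omega) (by omega) (by omega),
        hcc (m2 + 1 - (π.ω:ℤ) ^ 2 * A) (by omega) (by omega) (by omega) (by omega), zmod2_add_self] at hg2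
      exact absurd hg2 (by decide)
    have f3 : 2 * L ≤ m2 - m1 := by omega
    have f3 : (2 * L : ℝ) ≤ m2 - m1 := by exact_mod_cast f3
    linarith

/-- count in one period -/
theorem period_count (n a : ℤ) :
    ((Finset.Ico a (a + π.ω)).filter (fun d => π.Lam n d)).card ≤ (π.bet n).natAbs := by
  have hmap : ∀ d ∈ (Finset.Ico a (a + π.ω)).filter (fun d => π.Lam n d),
      ((π.bet d + (π.bet n).natAbs - 1) / 2).toNat ∈ Finset.range (π.bet n).natAbs := by
    intro d hd
    rw [Finset.mem_filter] at hd
    obtain ⟨-, h1, h2⟩ := hd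
    rw [Finset.mem_range]; omega
  rw [← Finset.card_range (π.bet n).natAbs]
  apply Finset.card_le_card_of_injOn _ hmap
  intro d hd e he hde
  simp only [Finset.coe_filter, Finset.mem_Ico, Set.mem_ofPred_eq] at hd he hde
  obtain ⟨hd0, hd1, hd2⟩ := hd
  obtain ⟨he0, he1, he2⟩ := he
  have : π.bet d = π.bet e := by omega
  obtain ⟨c, hc⟩ := π.bet_inj this
  have : c = 0 := by
    by_contra hne
    rcases lt_or_gt_of_ne hne with h | h
    · have : (π.ω : ℤ) * c ≤ - π.ω := by nlinarith [π.ω_pos]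
      omega
    · have : (π.ω : ℤ) * c ≥ π.ω := by nlinarith [π.ω_pos]
      omega
  subst this; omega

theorem cnt_consec (n : ℤ) {a b c : ℤ} (h1 : a ≤ b) (h2 : b ≤ c) :
    π.cnt n a c = π.cnt n a b + π.cnt n b c := by
  unfold cnt
  rw [← Finset.card_union_of_disjoint, ← Finset.filter_union]
  · congr 2; ext; simp only [Finset.mem_union, Finset.mem_Ioc]; omega
  · apply Finset.disjoint_filter_filter
    rw [Finset.disjoint_left]; intro x; simp only [Finset.mem_Ioc]; omega

theorem kk_mono0 (j : ℕ) (hj : (j:ℤ) ≤ π.ω) : π.kk 0 ≤ π.kk j ∧ π.kk' 0 ≤ π.kk' j := by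
  induction j with
  | zero => simp
  | succ j ih =>
    push_cast at hj
    have := ih (by omega)
    have a := π.kk_mono1 (m := j) (by omega) (by omega)
    have b := π.kk'_mono1 (m := j) (by omega) (by omega)
    push_cast; omega

theorem sum_hLight (n : ℤ) (j : ℕ) (hj : (j:ℤ) ≤ π.ω) :
    ∑ i ∈ Finset.range j, π.hLightCount i n = π.cnt n (π.kk 0) (π.kk j) + π.cnt n (π.kk' 0) (π.kk' j) := by
  induction j with
  | zero => simp [cnt]
  | succ j ih =>
    push_cast at hj
    have hm := π.kk_mono0 j (by omega)
    rw [Finset.sum_range_succ, ih (by omega), π.hLightCount_eq (by omega) (by omega)]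
    have a := π.kk_mono1 (m := j) (by omega) (by omega)
    have b := π.kk'_mono1 (m := j) (by omega) (by omega)
    push_cast
    rw [π.cnt_consec n hm.1 a, π.cnt_consec n hm.2 b]; ring

theorem kk_ω : π.kk π.ω = 2 * π.p := by
  have := π.ωZ_pos
  unfold kk; rw [if_neg (by omega)]; exact Int.mul_ediv_cancel _ (by omega)

theorem hline_count (n : ℤ) :
    ((Finset.range π.ω).filter (fun i : ℕ => π.goodH i n)).card ≤ 2 * (π.bet n).natAbs := by
  have h1 : ((Finset.range π.ω).filter (fun i : ℕ => π.goodH i n)).card ≤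
      ∑ i ∈ Finset.range π.ω, π.hLightCount i n := by
    rw [Finset.card_filter]
    apply Finset.sum_le_sum
    intro i _
    unfold goodH
    split_ifs with h <;> omega
  refine h1.trans ?_
  rw [π.sum_hLight n π.ω le_rfl]
  have e1 : π.kk 0 = -1 := by simp [kk]
  have e2 : π.kk' 0 = 0 := by simp [kk', kk]
  have e3 : π.kk' π.ω = 2 * π.q - 1 := by
    have := π.ωZ_eq; unfold kk'; rw [kk_ω]; omega
  rw [e1, e2, e3, kk_ω]
  have e4 : π.cnt n 0 (2 * π.q - 1) = π.cnt n (2 * π.p) (2 * π.ω - 1) := by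
    have hw := π.ωZ_eq
    unfold cnt
    apply Finset.card_bij (fun d _ => 2 * (π.ω:ℤ) - d)
    · intro d hd
      simp only [Finset.mem_filter, Finset.mem_Ioc] at hd ⊢
      refine ⟨by omega, ?_⟩
      have := π.Lam_congr (n := n) (n' := n) (d := 2 * π.ω - d) (d' := -d) (by simp) ⟨2, by ring⟩
      rw [this, Lam_neg_right]; exact hd.2
    · intro d _ e _ h; omega
    · intro d hd
      simp only [Finset.mem_filter, Finset.mem_Ioc] at hd
      refine ⟨2 * π.ω - d, ?_, by ring⟩
      simp only [Finset.mem_filter, Finset.mem_Ioc]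
      refine ⟨by omega, ?_⟩
      have := π.Lam_congr (n := n) (n' := n) (d := 2 * π.ω - d) (d' := -d) (by simp) ⟨2, by ring⟩
      rw [this, Lam_neg_right]; exact hd.2
  have hpq := π.p_lt_q
  have hw := π.ωZ_eq
  rw [e4, ← π.cnt_consec n (by omega) (by omega), π.cnt_consec n (b := π.ω - 1) (by omega) (by omega)]
  have p1 := π.period_count n 0
  have p2 := π.period_count n π.ω
  have q1 : Finset.Ioc (-1) ((π.ω:ℤ) - 1) = Finset.Ico 0 (0 + (π.ω:ℤ)) := by
    ext; simp only [Finset.mem_Ioc, Finset.mem_Ico]; omega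
  have q2 : Finset.Ioc ((π.ω:ℤ) - 1) (2 * (π.ω:ℤ) - 1) = Finset.Ico (π.ω:ℤ) ((π.ω:ℤ) + (π.ω:ℤ)) := by
    ext; simp only [Finset.mem_Ioc, Finset.mem_Ico]; omega
  unfold cnt
  rw [q1, q2]; omega

theorem vline_count (m : ℤ) (h0 : 0 ≤ m) (h1 : m ≤ π.ω) :
    ((Finset.range π.ω).filter (fun i : ℕ => π.goodV m i)).card ≤ 2 * (π.bet m).natAbs := by
  have key : ∀ c : ℤ, ((Finset.range π.ω).filter (fun i : ℕ => π.Lam m (i + c))).card ≤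
      (π.bet m).natAbs := by
    intro c
    refine le_trans ?_ (π.period_count m c)
    apply Finset.card_le_card_of_injOn (fun i : ℕ => (i:ℤ) + c)
    · intro i hi
      simp only [Finset.coe_filter, Finset.mem_range, Set.mem_ofPred_eq, Finset.mem_Ico] at hi ⊢
      exact ⟨by omega, hi.2⟩
    · intro i _ j _ hij; simp only at hij; omega
  have h2 : ((Finset.range π.ω).filter (fun i : ℕ => π.goodV m i)).card ≤
      ((Finset.range π.ω).filter (fun i : ℕ => π.Lam m (i + (- π.MM m)))).card +
      ((Finset.range π.ω).filter (fun i : ℕ => π.Lam m (i + (π.MM m + 1)))).card := by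
    refine le_trans (Finset.card_le_card ?_) (Finset.card_union_le _ _)
    intro i hi
    rw [← Finset.filter_or]
    rw [Finset.mem_filter] at hi ⊢
    refine ⟨hi.1, ?_⟩
    have := hi.2
    unfold goodV at this
    rw [π.vLightCount_eq h0 h1] at this
    rw [← sub_eq_add_neg, ← add_assoc]
    by_contra hc
    push Not at hc
    simp [hc.1, hc.2] at this
  have := key (- π.MM m)
  have := key (π.MM m + 1)
  omega

end Param


namespace Param
variable (π : Param)

/-- number of good horizontal edges from `a` to `b` on the line `y = n` -/
def HE (a b n : ℤ) : ℕ := ((Finset.Ico a b).filter (fun m => π.goodH m n)).card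
/-- number of good vertical edges from `a` to `b` on the line `x = m` -/
def VE (a b m : ℤ) : ℕ := ((Finset.Ico a b).filter (fun n => π.goodV m n)).card

theorem card_Ico_consec (f : ℤ → Prop) {a b c : ℤ} (h1 : a ≤ b) (h2 : b ≤ c) :
    ((Finset.Ico a c).filter f).card =
      ((Finset.Ico a b).filter f).card + ((Finset.Ico b c).filter f).card := by
  rw [← Finset.card_union_of_disjoint, ← Finset.filter_union]
  · congr 2; ext; simp only [Finset.mem_union, Finset.mem_Ico]; omega
  · apply Finset.disjoint_filter_filter
    rw [Finset.disjoint_left]; intro x; simp only [Finset.mem_Ico]; omega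

theorem card_Ico_parity (f : ℤ → Prop) (C : ℤ → ZMod 2) {a b : ℤ} (hab : a ≤ b)
    (h : ∀ m, a ≤ m → m < b → (f m ↔ C m + C (m + 1) = 1)) :
    (((Finset.Ico a b).filter f).card : ZMod 2) = C a + C b := by
  obtain ⟨j, rfl⟩ : ∃ j : ℕ, b = a + j := ⟨(b - a).toNat, by omega⟩
  clear hab
  induction j with
  | zero => simp [zmod2_add_self]
  | succ j ih =>
    rw [card_Ico_consec f (b := a + j) (by omega) (by push_cast; omega)]
    push_cast
    rw [ih (fun m h1 h2 => h m h1 (by push_cast; omega))]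
    have e : Finset.Ico (a + (j:ℤ)) (a + ((j:ℤ) + 1)) = {a + (j:ℤ)} := by
      ext; simp only [Finset.mem_Ico, Finset.mem_singleton]; omega
    rw [e]
    have := h (a + j) (by omega) (by push_cast; omega)
    rw [Finset.filter_singleton]
    have h2 := zmod2_ite this
    have h3 : (((if f (a + (j:ℤ)) then ({a + (j:ℤ)} : Finset ℤ) else ∅).card : ℕ) : ZMod 2) =
      if f (a + (j:ℤ)) then 1 else 0 := by split_ifs <;> simp
    rw [h3, h2, ← add_assoc a]
    have := zmod2_add_self (C (a + j))
    linear_combination this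

theorem card_Ico_range (f : ℤ → Prop) (w : ℕ) :
    ((Finset.Ico (0:ℤ) w).filter f).card = ((Finset.range w).filter (fun i : ℕ => f i)).card := by
  symm
  apply Finset.card_bij (fun (i:ℕ) _ => (i:ℤ))
  · intro i hi; simp only [Finset.mem_filter, Finset.mem_range, Finset.mem_Ico] at hi ⊢
    exact ⟨by omega, hi.2⟩
  · intro i _ j _ h; simpa using h
  · intro i hi; simp only [Finset.mem_filter, Finset.mem_range, Finset.mem_Ico] at hi ⊢
    refine ⟨i.toNat, ⟨by omega, ?_⟩, by omega⟩
    rw [Int.toNat_of_nonneg hi.1.1]; exact hi.2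

theorem cells_sum (f : ℤ → Prop) (x : ℕ → ℤ) (L : ℕ) (hx : ∀ i < L, x i ≤ x (i + 1)) :
    x 0 ≤ x L ∧ ∑ i ∈ Finset.range L, ((Finset.Ico (x i) (x (i + 1))).filter f).card =
      ((Finset.Ico (x 0) (x L)).filter f).card := by
  induction L with
  | zero => simp
  | succ L ih =>
    obtain ⟨h1, h2⟩ := ih (fun i hi => hx i (by omega))
    have h3 := hx L (by omega)
    refine ⟨by omega, ?_⟩
    rw [Finset.sum_range_succ, h2, ← card_Ico_consec f h1 h3]

theorem shift_sum (f : ℕ → ℕ) (L : ℕ) : ∑ j ∈ Finset.range L, f j + ∑ j ∈ Finset.range L, f (j + 1) ≤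
    2 * ∑ j ∈ Finset.range (L + 1), f j := by
  have h1 := Finset.sum_range_succ f L
  have h2 := Finset.sum_range_succ' f L
  omega

/-- abstract zero cell -/
theorem zero_cell0 (x : ℕ → ℤ) (L : ℕ) (hx : ∀ i < L, x i < x (i + 1)) (h0 : x 0 = 0)
    (h1 : x L = π.ω) (hs : 8 * ∑ i ∈ Finset.range (L + 1), (π.bet (x i)).natAbs < 2 * L ^ 2) :
    ∃ i j, i < L ∧ j < L ∧
      (∀ n, x j ≤ n → n < x (j + 1) → ¬ π.goodV (x i) n ∧ ¬ π.goodV (x (i + 1)) n) ∧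
      (∀ m, x i ≤ m → m < x (i + 1) → ¬ π.goodH m (x j) ∧ ¬ π.goodH m (x (j + 1))) := by
  have hb : ∀ i ≤ L, 0 ≤ x i ∧ x i ≤ π.ω := by
    intro i hi
    have a1 := (cells_sum (fun _ => True) x i (fun i hi => (hx i (by omega)).le)).1
    have a2 := (cells_sum (fun _ => True) (fun t => x (i + t)) (L - i)
      (fun t ht => (hx (i + t) (by omega)).le)).1
    simp only [add_zero] at a2
    rw [show i + (L - i) = L by omega] at a2
    omega
  have hh : ∀ j, ∑ i ∈ Finset.range L, π.HE (x i) (x (i + 1)) (x j) ≤ 2 * (π.bet (x j)).natAbs := by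
    intro j
    unfold HE
    rw [(cells_sum (fun m => π.goodH m (x j)) x L (fun i hi => (hx i hi).le)).2, h0, h1, card_Ico_range]
    exact π.hline_count (x j)
  have hv : ∀ i ≤ L, ∑ j ∈ Finset.range L, π.VE (x j) (x (j + 1)) (x i) ≤ 2 * (π.bet (x i)).natAbs := by
    intro i hi
    unfold VE
    rw [(cells_sum (fun m => π.goodV (x i) m) x L (fun i hi => (hx i hi).le)).2, h0, h1, card_Ico_range]
    exact π.vline_count (x i) (hb i hi).1 (hb i hi).2
  set E : ℕ → ℕ → ℕ := fun i j => (π.HE (x i) (x (i + 1)) (x j) + π.HE (x i) (x (i + 1)) (x (j + 1))) +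
    (π.VE (x j) (x (j + 1)) (x i) + π.VE (x j) (x (j + 1)) (x (i + 1))) with hE
  set T := ∑ i ∈ Finset.range (L + 1), (π.bet (x i)).natAbs with hT
  have t1 : ∑ i ∈ Finset.range L, ∑ j ∈ Finset.range L,
      (π.HE (x i) (x (i + 1)) (x j) + π.HE (x i) (x (i + 1)) (x (j + 1))) ≤ 4 * T := by
    rw [Finset.sum_comm]
    simp only [Finset.sum_add_distrib]
    refine (shift_sum (fun j => ∑ i ∈ Finset.range L, π.HE (x i) (x (i + 1)) (x j)) L).trans ?_
    have : ∑ j ∈ Finset.range (L + 1), ∑ i ∈ Finset.range L, π.HE (x i) (x (i + 1)) (x j) ≤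
      ∑ j ∈ Finset.range (L + 1), 2 * (π.bet (x j)).natAbs := Finset.sum_le_sum fun j _ => hh j
    rw [← Finset.mul_sum] at this
    omega
  have t2 : ∑ i ∈ Finset.range L, ∑ j ∈ Finset.range L,
      (π.VE (x j) (x (j + 1)) (x i) + π.VE (x j) (x (j + 1)) (x (i + 1))) ≤ 4 * T := by
    simp only [Finset.sum_add_distrib]
    refine (shift_sum (fun i => ∑ j ∈ Finset.range L, π.VE (x j) (x (j + 1)) (x i)) L).trans ?_
    have : ∑ i ∈ Finset.range (L + 1), ∑ j ∈ Finset.range L, π.VE (x j) (x (j + 1)) (x i) ≤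
      ∑ j ∈ Finset.range (L + 1), 2 * (π.bet (x j)).natAbs :=
        Finset.sum_le_sum fun i hi => hv i (by rw [Finset.mem_range] at hi; omega)
    rw [← Finset.mul_sum] at this
    omega
  have t3 : ∃ i < L, ∃ j < L, E i j < 2 := by
    by_contra hc
    push Not at hc
    have : ∑ i ∈ Finset.range L, ∑ j ∈ Finset.range L, 2 ≤ ∑ i ∈ Finset.range L, ∑ j ∈ Finset.range L, E i j :=
      Finset.sum_le_sum fun i hi => Finset.sum_le_sum fun j hj =>
        hc i (Finset.mem_range.1 hi) j (Finset.mem_range.1 hj)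
    simp only [hE, Finset.sum_add_distrib (s := Finset.range L)] at this t1 t2
    simp only [Finset.sum_const, Finset.card_range, smul_eq_mul] at this
    have e : L * (L * 2) = 2 * L ^ 2 := by ring
    omega
  obtain ⟨i, hi, j, hj, hlt⟩ := t3
  have par : (E i j : ZMod 2) = 0 := by
    have hH : ∀ n, (π.HE (x i) (x (i + 1)) n : ZMod 2) = π.col (x i) n + π.col (x (i + 1)) n := by
      intro n
      apply card_Ico_parity _ (fun m => π.col m n) (hx i hi).le
      intro m a1 a2
      exact π.goodH_iff (by have := (hb i (by omega)).1; omega)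
        (by have := (hb (i + 1) (by omega)).2; omega) n
    have hV : ∀ i ≤ L, (π.VE (x j) (x (j + 1)) (x i) : ZMod 2) = π.col (x i) (x j) + π.col (x i) (x (j + 1)) := by
      intro i hi
      apply card_Ico_parity _ (fun n => π.col (x i) n) (hx j hj).le
      intro m a1 a2
      exact π.goodV_iff (hb i hi).1 (hb i hi).2 m
    simp only [hE]
    push_cast
    rw [hH, hH, hV i (by omega), hV (i + 1) (by omega)]
    have a1 := zmod2_add_self (π.col (x i) (x j))
    have a2 := zmod2_add_self (π.col (x (i + 1)) (x j))
    have a3 := zmod2_add_self (π.col (x i) (x (j + 1)))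
    have a4 := zmod2_add_self (π.col (x (i + 1)) (x (j + 1)))
    linear_combination a1 + a2 + a3 + a4
  have hE0 : E i j = 0 := by
    have : E i j = 0 ∨ E i j = 1 := by omega
    rcases this with h | h
    · exact h
    · rw [h] at par; exact absurd par (by decide)
  simp only [hE, HE, VE, Nat.add_eq_zero_iff, Finset.card_eq_zero, Finset.filter_eq_empty_iff,
    Finset.mem_Ico] at hE0
  obtain ⟨⟨c1, c2⟩, c3, c4⟩ := hE0
  exact ⟨i, j, hi, hj, fun n u v => ⟨c3 ⟨u, v⟩, c4 ⟨u, v⟩⟩, fun n u v => ⟨c1 ⟨u, v⟩, c2 ⟨u, v⟩⟩⟩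

/-- the lines of small capacity -/
def Xs (α : ℤ) (K : ℕ) : Finset ℤ :=
  insert (π.ω:ℤ) ((Finset.Icc (-(K:ℤ)) K).image (fun b => (b * α) % (π.ω:ℤ)))

theorem bet_mul_alpha {α : ℤ} (hα : π.bet α = 1 ∨ π.bet α = -1) (b : ℤ)
    (hb : 2 * (b.natAbs:ℤ) < π.ω) : π.bet (b * α) = π.bet α * b := by
  apply bet_unique
  · exact dvdc (Dvd.dvd.mul_left (π.bet_dvd α) b) (by ring)
  · rcases hα with h | h <;> rw [h] <;> omega

theorem sum_natAbs (K : ℕ) : ∑ b ∈ Finset.Icc (-(K:ℤ)) K, b.natAbs = K * (K + 1) := by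
  induction K with
  | zero => simp
  | succ K ih =>
    have e : Finset.Icc (-((K + 1 : ℕ):ℤ)) ((K + 1 : ℕ):ℤ) =
        insert (-((K:ℤ) + 1)) (insert ((K:ℤ) + 1) (Finset.Icc (-(K:ℤ)) K)) := by
      ext; simp only [Finset.mem_Icc, Finset.mem_insert]; push_cast; omega
    rw [e, Finset.sum_insert, Finset.sum_insert, ih]
    · have : (-((K:ℤ) + 1)).natAbs = K + 1 := by omega
      rw [this]
      have : ((K:ℤ) + 1).natAbs = K + 1 := by omega
      rw [this]; ring
    · simp only [Finset.mem_Icc]; omega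
    · simp only [Finset.mem_Icc, Finset.mem_insert]; omega

theorem zero_cell {α : ℤ} (hα : π.bet α = 1 ∨ π.bet α = -1) (K : ℕ) (hK : 2 * K < π.ω) :
    ∃ a b c d, a ∈ π.Xs α K ∧ b ∈ π.Xs α K ∧ c ∈ π.Xs α K ∧ d ∈ π.Xs α K ∧ a < b ∧ c < d ∧
      (∀ t ∈ π.Xs α K, ¬ (a < t ∧ t < b)) ∧ (∀ t ∈ π.Xs α K, ¬ (c < t ∧ t < d)) ∧
      (∀ n, c ≤ n → n < d → ¬ π.goodV a n ∧ ¬ π.goodV b n) ∧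
      (∀ m, a ≤ m → m < b → ¬ π.goodH m c ∧ ¬ π.goodH m d) := by
  have hw := π.ωZ_pos
  have hbet : ∀ b ∈ Finset.Icc (-(K:ℤ)) K, π.bet ((b * α) % (π.ω:ℤ)) = π.bet α * b := by
    intro b hb
    rw [Finset.mem_Icc] at hb
    rw [← π.bet_mul_alpha hα b (by omega)]
    apply π.bet_congr
    exact (Int.mod_modEq (b * α) π.ω).symm.dvd
  have hinj : Set.InjOn (fun b => (b * α) % (π.ω:ℤ)) (Finset.Icc (-(K:ℤ)) K) := by
    intro b hb c hc h
    have := hbet b hb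
    simp only at h
    rw [h, hbet c hc] at this
    rcases hα with h | h <;> rw [h] at this <;> omega
  have hni : (π.ω:ℤ) ∉ (Finset.Icc (-(K:ℤ)) K).image (fun b => (b * α) % (π.ω:ℤ)) := by
    intro h
    rw [Finset.mem_image] at h
    obtain ⟨b, -, h⟩ := h
    have := Int.emod_lt_of_pos (b * α) hw
    omega
  have hcard : (π.Xs α K).card = 2 * K + 1 + 1 := by
    unfold Xs
    rw [Finset.card_insert_of_notMem hni, Finset.card_image_of_injOn hinj, Int.card_Icc]; omega
  have hsum : ∑ t ∈ π.Xs α K, (π.bet t).natAbs = K * (K + 1) := by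
    unfold Xs
    rw [Finset.sum_insert hni, Finset.sum_image hinj, bet_ω, ← sum_natAbs K]
    simp only [Int.natAbs_zero, zero_add]
    apply Finset.sum_congr rfl
    intro b hb
    rw [hbet b hb]
    rcases hα with h | h <;> rw [h] <;> omega
  have hrange : ∀ t ∈ π.Xs α K, 0 ≤ t ∧ t ≤ π.ω := by
    intro t ht
    unfold Xs at ht
    rw [Finset.mem_insert, Finset.mem_image] at ht
    rcases ht with rfl | ⟨b, -, rfl⟩
    · omega
    · exact ⟨Int.emod_nonneg _ (by omega), (Int.emod_lt_of_pos _ hw).le⟩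
  have m0 : (0:ℤ) ∈ π.Xs α K := by
    unfold Xs
    rw [Finset.mem_insert, Finset.mem_image]
    exact Or.inr ⟨0, by simp, by simp⟩
  have mw : (π.ω:ℤ) ∈ π.Xs α K := by unfold Xs; exact Finset.mem_insert_self _ _
  set e := (π.Xs α K).orderEmbOfFin hcard with he
  have hsurj : ∀ t ∈ π.Xs α K, ∃ i, e i = t := by
    intro t ht
    have : t ∈ Set.range e := by rw [he, Finset.range_orderEmbOfFin]; exact ht
    exact this
  have hmem : ∀ i, e i ∈ π.Xs α K := fun i => Finset.orderEmbOfFin_mem _ _ i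
  set x : ℕ → ℤ := fun i => if h : i < 2 * K + 1 + 1 then e ⟨i, h⟩ else 0 with hxdef
  have hx : ∀ i (h : i < 2 * K + 1 + 1), x i = e ⟨i, h⟩ := by
    intro i h; simp only [hxdef, dif_pos h]
  have hlt : ∀ i < 2 * K + 1, x i < x (i + 1) := by
    intro i hi
    rw [hx i (by omega), hx (i + 1) (by omega)]
    exact e.strictMono (by simp [Fin.lt_def])
  have hgap : ∀ i < 2 * K + 1, ∀ t ∈ π.Xs α K, ¬ (x i < t ∧ t < x (i + 1)) := by
    intro i hi t ht ⟨h1, h2⟩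
    obtain ⟨⟨j, hj⟩, rfl⟩ := hsurj t ht
    rw [hx i (by omega), e.lt_iff_lt, Fin.lt_def] at h1
    rw [hx (i + 1) (by omega), e.lt_iff_lt, Fin.lt_def] at h2
    simp only at h1 h2
    omega
  have hx0 : x 0 = 0 := by
    obtain ⟨j, hj⟩ := hsurj 0 m0
    rw [hx 0 (by omega)]
    have h1 : e ⟨0, by omega⟩ ≤ e j := e.monotone (by simp [Fin.le_def])
    have := (hrange _ (hmem ⟨0, by omega⟩)).1
    omega
  have hxL : x (2 * K + 1) = π.ω := by
    obtain ⟨j, hj⟩ := hsurj _ mw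
    rw [hx _ (by omega)]
    have h1 : e j ≤ e ⟨2 * K + 1, by omega⟩ := e.monotone (by have := j.2; simp only [Fin.le_def]; omega)
    have := (hrange _ (hmem ⟨2 * K + 1, by omega⟩)).2
    omega
  have hs : ∑ i ∈ Finset.range (2 * K + 1 + 1), (π.bet (x i)).natAbs = K * (K + 1) := by
    rw [← hsum, Finset.sum_range]
    apply Finset.sum_bij (fun (i : Fin (2 * K + 1 + 1)) _ => e i)
    · intro i _; exact hmem i
    · intro i _ j _ h; exact e.injective h
    · intro t ht
      obtain ⟨i, hi⟩ := hsurj t ht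
      exact ⟨i, Finset.mem_univ _, hi⟩
    · intro i _
      rw [hx _ i.2]
  obtain ⟨i, j, hi, hj, h1, h2⟩ := π.zero_cell0 x (2 * K + 1) hlt hx0 hxL (by rw [hs]; nlinarith)
  have hmx : ∀ i < 2 * K + 1 + 1, x i ∈ π.Xs α K := fun i hi => by rw [hx i hi]; exact hmem _
  exact ⟨x i, x (i + 1), x j, x (j + 1), hmx _ (by omega), hmx _ (by omega), hmx _ (by omega),
    hmx _ (by omega), hlt i hi, hlt j hj, hgap i hi, hgap j hj, h1, h2⟩

theorem Xs_range {α : ℤ} {K : ℕ} {t : ℤ} (ht : t ∈ π.Xs α K) : 0 ≤ t ∧ t ≤ π.ω := by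
  have hw := π.ωZ_pos
  unfold Xs at ht
  rw [Finset.mem_insert, Finset.mem_image] at ht
  rcases ht with rfl | ⟨b, -, rfl⟩
  · omega
  · exact ⟨Int.emod_nonneg _ (by omega), (Int.emod_lt_of_pos _ hw).le⟩

/-- a zero cell traps polygons, in any block -/
theorem trapped (A B a b c d : ℤ) (ha : 0 ≤ a) (hb : b ≤ π.ω) (hab : a < b)
    (h1 : ∀ n, c ≤ n → n < d → ¬ π.goodV a n ∧ ¬ π.goodV b n)
    (h2 : ∀ m, a ≤ m → m < b → ¬ π.goodH m c ∧ ¬ π.goodH m d)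
    (m n : ℤ) (hm : a < m) (hm' : m < b) (hn : c ≤ n) (hn' : n < d)
    (hz : vmid ((π.ω:ℤ) ^ 2 * A + m) ((π.ω:ℤ) * B + n) ∈ π.plaidSet) :
    Metric.diam (Prod.fst '' connectedComponentIn π.plaidSet
        (vmid ((π.ω:ℤ) ^ 2 * A + m) ((π.ω:ℤ) * B + n))) ≤ (b - a : ℝ) := by
  have hC := π.coloured A B
  have hH : ∀ m n : ℤ, 0 ≤ m → m < π.ω →
      (π.goodH ((π.ω:ℤ) ^ 2 * A + m) ((π.ω:ℤ) * B + n) ↔ π.goodH m n) := by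
    intro m n h0 h1
    rw [hC.hH _ _ (by omega) (by omega), π.goodH_iff h0 h1]
    simp only [add_sub_cancel_left, add_assoc]
  have hV : ∀ m n : ℤ, 0 ≤ m → m ≤ π.ω →
      (π.goodV ((π.ω:ℤ) ^ 2 * A + m) ((π.ω:ℤ) * B + n) ↔ π.goodV m n) := by
    intro m n h0 h1
    rw [hC.hV _ _ (by omega) (by omega), π.goodV_iff h0 h1]
    simp only [add_sub_cancel_left, add_assoc]
  set X0 := (π.ω:ℤ) ^ 2 * A
  set Y0 := (π.ω:ℤ) * B
  have hsub := comp_in_rect π.goodH π.goodV (a := X0 + a) (b := X0 + b) (c := Y0 + c) (d := Y0 + d)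
    (by
      intro n u v
      have := h1 (n - Y0) (by omega) (by omega)
      rw [← hV a _ (by omega) (by omega), ← hV b _ (by omega) (by omega)] at this
      simpa using this)
    (by
      intro m u v
      have := h2 (m - X0) (by omega) (by omega)
      rw [← hH (m - X0) c (by omega) (by omega), ← hH (m - X0) d (by omega) (by omega)] at this
      simpa using this) hz
    (by
      simp only [vmid]
      refine ⟨⟨?_, ?_⟩, ?_, ?_⟩
      · exact Int.cast_lt.2 (by omega : X0 + a < X0 + m)
      · exact Int.cast_lt.2 (by omega : X0 + m < X0 + b)
      · have : ((Y0 + c : ℤ) : ℝ) ≤ ((Y0 + n : ℤ) : ℝ) := by exact_mod_cast (by omega)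
        simp only; linarith
      · have : ((Y0 + n : ℤ) : ℝ) + 1 ≤ ((Y0 + d : ℤ) : ℝ) := by exact_mod_cast (by omega)
        simp only; linarith)
  have hsub2 : Prod.fst '' connectedComponentIn π.plaidSet (vmid (X0 + m) (Y0 + n)) ⊆
      Set.Icc ((X0 + a : ℤ) : ℝ) ((X0 + b : ℤ) : ℝ) := by
    rintro _ ⟨z, hz, rfl⟩
    have := (hsub hz).1
    exact ⟨this.1.le, this.2.le⟩
  refine (Metric.diam_mono hsub2 (Metric.isBounded_Icc _ _)).trans ?_
  rw [Real.diam_Icc (by exact_mod_cast (by omega))]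
  push_cast; linarith

end Param


/-- one-sided density of the multiples of an irrational number -/
theorem dens {θ : ℝ} (hθ : Irrational θ) {a b : ℝ} (hab : a < b) (J : ℕ) :
    ∃ j : ℕ, J ≤ j ∧ ∃ N : ℤ, a < j * θ + N ∧ j * θ + N < b := by
  have hd : Dense (AddSubgroup.closure {θ, 1} : Set ℝ) := by
    rw [dense_addSubgroupClosure_pair_iff]; simpa using hθ
  obtain ⟨u, hu, hu0, hu1⟩ := hd.exists_between (show (0:ℝ) < min (b - a) 1 by
    apply lt_min <;> linarith)
  have hu : u ∈ AddSubgroup.closure {θ, 1} := hu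
  rw [AddSubgroup.mem_closure_pair] at hu
  obtain ⟨m, n, rfl⟩ := hu
  simp only [zsmul_eq_mul, mul_one] at hu0 hu1
  have hub := lt_of_lt_of_le hu1 (min_le_left _ _)
  have hu1 := lt_of_lt_of_le hu1 (min_le_right _ _)
  have hm : m ≠ 0 := by
    rintro rfl
    simp only [Int.cast_zero, zero_mul, zero_add] at hu0 hu1
    have h0 : 0 < n := by exact_mod_cast hu0
    have h1 : n < 1 := by exact_mod_cast hu1
    omega
  set u := m * θ + n with hu
  rcases lt_or_gt_of_ne hm with hm | hm
  · -- go down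
    set N0 : ℤ := ⌈b - J * θ⌉ with hN0
    have h1 : b ≤ J * θ + N0 := by have := Int.le_ceil (b - J * θ); linarith
    set c : ℕ := ⌊(J * θ + N0 - b) / u⌋₊ + 1 with hc
    have hc0 : (c:ℝ) = ⌊(J * θ + N0 - b) / u⌋₊ + 1 := by rw [hc]; push_cast; ring
    have c1 : (J * θ + N0 - b) < c * u := by
      have := Nat.lt_floor_add_one ((J * θ + N0 - b) / u)
      rw [div_lt_iff₀ hu0] at this
      rw [hc0]; exact this
    have c2 : (c - 1) * u ≤ J * θ + N0 - b := by
      have := Nat.floor_le (show 0 ≤ (J * θ + N0 - b) / u by apply div_nonneg <;> linarith)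
      rw [le_div_iff₀ hu0] at this
      rw [hc0]; linarith
    refine ⟨J + c * m.natAbs, by omega, N0 - c * n, ?_⟩
    have e : ((J + c * m.natAbs : ℕ) : ℝ) = J - c * m := by
      have : (m.natAbs : ℝ) = -m := by rw [Nat.cast_natAbs, abs_of_neg hm]; push_cast; ring
      push_cast; rw [this]; ring
    rw [e]; push_cast
    constructor <;> nlinarith
  · set N0 : ℤ := ⌊a - J * θ⌋ with hN0
    have h1 : J * θ + N0 ≤ a := by have := Int.floor_le (a - J * θ); linarith
    set c : ℕ := ⌊(a - (J * θ + N0)) / u⌋₊ + 1 with hc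
    have hc0 : (c:ℝ) = ⌊(a - (J * θ + N0)) / u⌋₊ + 1 := by rw [hc]; push_cast; ring
    have c1 : (a - (J * θ + N0)) < c * u := by
      have := Nat.lt_floor_add_one ((a - (J * θ + N0)) / u)
      rw [div_lt_iff₀ hu0] at this
      rw [hc0]; exact this
    have c2 : (c - 1) * u ≤ a - (J * θ + N0) := by
      have := Nat.floor_le (show 0 ≤ (a - (J * θ + N0)) / u by apply div_nonneg <;> linarith)
      rw [le_div_iff₀ hu0] at this
      rw [hc0]; linarith
    refine ⟨J + c * m.natAbs, by omega, N0 + c * n, ?_⟩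
    have e : ((J + c * m.natAbs : ℕ) : ℝ) = J + c * m := by
      have : (m.natAbs : ℝ) = m := by rw [Nat.cast_natAbs, abs_of_pos hm]
      push_cast; rw [this]
    rw [e]; push_cast
    constructor <;> nlinarith

theorem generic_pt (τ : ℝ) (U : Finset ℝ) (hU : (0:ℝ) ∉ U) {a b : ℝ} (hab : a < b) :
    ∃ X, a < X ∧ X < b ∧ ∀ u ∈ U, ∀ c N : ℤ, u * X - c * τ ≠ N := by
  have hc : Set.Countable (⋃ u ∈ U, ⋃ c : ℤ, ⋃ N : ℤ, ({(N + c * τ) / u} : Set ℝ)) := by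
    refine Set.Countable.biUnion U.countable_toSet fun u _ => ?_
    exact Set.countable_iUnion fun c => Set.countable_iUnion fun N => Set.countable_singleton _
  obtain ⟨X, hX, h1, h2⟩ := (hc.dense_compl ℝ).exists_between hab
  refine ⟨X, h1, h2, fun u hu c N h => hX ?_⟩
  simp only [Set.mem_iUnion]
  refine ⟨u, hu, c, N, ?_⟩
  have : u ≠ 0 := fun h => hU (h ▸ hu)
  rw [Set.mem_singleton_iff, eq_div_iff this]; linarith

theorem floor_near {y : ℝ} (hy : ∀ N : ℤ, y ≠ N) : ∃ η > 0, ∀ y', |y' - y| ≤ η → ⌊y'⌋ = ⌊y⌋ := by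
  have h1 : (⌊y⌋:ℝ) < y := lt_of_le_of_ne (Int.floor_le y) (hy _).symm
  have h2 := Int.lt_floor_add_one y
  refine ⟨min (y - ⌊y⌋) (⌊y⌋ + 1 - y) / 2, by
    apply half_pos; apply lt_min <;> linarith, fun y' h => ?_⟩
  have a1 := min_le_left (y - ⌊y⌋) (⌊y⌋ + 1 - y)
  have a2 := min_le_right (y - ⌊y⌋) (⌊y⌋ + 1 - y)
  rw [abs_le] at h
  rw [Int.floor_eq_iff]
  constructor <;> linarith

open Filter Topology in
theorem floor_ev {y : ℝ} (hy : ∀ N : ℤ, y ≠ N) : ∀ᶠ y' in 𝓝 y, ⌊y'⌋ = ⌊y⌋ := by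
  obtain ⟨η, h0, h⟩ := floor_near hy
  filter_upwards [Metric.ball_mem_nhds y h0] with y' hy'
  rw [Metric.mem_ball, Real.dist_eq] at hy'
  exact h y' hy'.le

def chiX (P Q τ X : ℝ) (a : ℤ) : ℤ := ⌊Q * X - a * τ⌋ - ⌊P * X - a * τ⌋

/-- limiting colour -/
def Dlim (P Q τ X : ℝ) (j : ℕ) : ZMod 2 :=
  j + ((∑ r ∈ Finset.range j, chiX P Q τ X (2 * r + 1 - j) : ℤ) : ZMod 2)

def psiX (P Q X y : ℝ) : ℤ := ⌊Q * X - y⌋ - ⌊P * X - y⌋ + ⌊Q * X + y⌋ - ⌊P * X + y⌋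

theorem Dlim_add_two (P Q τ X : ℝ) (j : ℕ) :
    Dlim P Q τ X (j + 2) = Dlim P Q τ X j + (psiX P Q X ((j + 1) * τ) : ZMod 2) := by
  unfold Dlim
  rw [Finset.sum_range_succ, Finset.sum_range_succ']
  have e1 : ∀ r : ℕ, (2 * ((r + 1 : ℕ):ℤ) + 1 - ((j + 2 : ℕ):ℤ)) = 2 * (r:ℤ) + 1 - j := by
    intro r; push_cast; ring
  simp only [e1]
  have e2 : chiX P Q τ X (2 * (j:ℤ) + 1 - j) +
      chiX P Q τ X (2 * ((0 : ℕ):ℤ) + 1 - ((j + 2 : ℕ):ℤ)) = psiX P Q X ((j + 1) * τ) := by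
    unfold chiX psiX
    have a1 : ((2 * (j:ℤ) + 1 - j : ℤ) : ℝ) * τ = (j + 1) * τ := by
      push_cast; ring
    have a2 : ((2 * ((0 : ℕ):ℤ) + 1 - ((j + 2 : ℕ):ℤ) : ℤ) : ℝ) * τ = -((j + 1) * τ) := by
      push_cast; ring
    rw [a1, a2, sub_neg_eq_add, sub_neg_eq_add]; ring
  rw [← e2]
  push_cast
  have : (2 : ZMod 2) = 0 := by decide
  linear_combination this

theorem Dlim_add (P Q τ X : ℝ) (j t : ℕ) :
    Dlim P Q τ X (j + 2 * t) = Dlim P Q τ X j +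
      ((∑ r ∈ Finset.range t, psiX P Q X (j * τ + (1 + 2 * r) * τ) : ℤ) : ZMod 2) := by
  induction t with
  | zero => simp
  | succ t ih =>
    rw [show j + 2 * (t + 1) = j + 2 * t + 2 by ring, Dlim_add_two, ih, Finset.sum_range_succ]
    push_cast
    rw [add_assoc, show (j + 2 * t + 1 : ℝ) * τ = j * τ + (1 + 2 * t) * τ by ring]

theorem psiX_int (P Q X y : ℝ) (N : ℤ) : psiX P Q X (y + N) = psiX P Q X y := by
  unfold psiX
  rw [← sub_sub, ← sub_sub, ← add_assoc, ← add_assoc]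
  simp only [Int.floor_sub_intCast, Int.floor_add_intCast]; ring

open Filter Topology in
theorem jump (P Q τ X : ℝ) (hτ : Irrational τ) (h1 : ∀ c N : ℤ, (Q - P) * X - c * τ ≠ N)
    (h2 : ∀ c N : ℤ, (2 * Q) * X - c * τ ≠ N) (h3 : ∀ c N : ℤ, (P + Q) * X - c * τ ≠ N)
    (r0 : ℕ) (i0 : ℤ) (t : ℕ) (ht : r0 < t) (y : ℝ) (hy : y = Q * X - (1 + 2 * r0) * τ - i0) :
    ∃ C : ℤ, ∀ᶠ s in 𝓝 y,
      ∑ r ∈ Finset.range t, psiX P Q X (s + (1 + 2 * r) * τ) = C + ⌊y - s⌋ := by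
  have hP : ∀ r : ℕ, ∀ᶠ s in 𝓝 y, ⌊P * X - (s + (1 + 2 * r) * τ)⌋ = ⌊P * X - (y + (1 + 2 * r) * τ)⌋ := by
    intro r
    have hc : Continuous fun s : ℝ => P * X - (s + (1 + 2 * r) * τ) := by fun_prop
    apply hc.continuousAt.eventually (floor_ev _)
    intro N hN
    apply h1 (2 * r0 - 2 * r) (i0 - N)
    push_cast
    rw [hy] at hN; linarith
  have hP' : ∀ r : ℕ, ∀ᶠ s in 𝓝 y, ⌊P * X + (s + (1 + 2 * r) * τ)⌋ = ⌊P * X + (y + (1 + 2 * r) * τ)⌋ := by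
    intro r
    have hc : Continuous fun s : ℝ => P * X + (s + (1 + 2 * r) * τ) := by fun_prop
    apply hc.continuousAt.eventually (floor_ev _)
    intro N hN
    apply h3 (2 * r0 - 2 * r) (N + i0)
    push_cast
    rw [hy] at hN; linarith
  have hQ' : ∀ r : ℕ, ∀ᶠ s in 𝓝 y, ⌊Q * X + (s + (1 + 2 * r) * τ)⌋ = ⌊Q * X + (y + (1 + 2 * r) * τ)⌋ := by
    intro r
    have hc : Continuous fun s : ℝ => Q * X + (s + (1 + 2 * r) * τ) := by fun_prop
    apply hc.continuousAt.eventually (floor_ev _)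
    intro N hN
    apply h2 (2 * r0 - 2 * r) (N + i0)
    push_cast
    rw [hy] at hN; linarith
  have hQ : ∀ r : ℕ, ∀ᶠ s in 𝓝 y, ⌊Q * X - (s + (1 + 2 * r) * τ)⌋ =
      (if r = r0 then i0 else ⌊Q * X - (y + (1 + 2 * r) * τ)⌋) + if r = r0 then ⌊y - s⌋ else 0 := by
    intro r
    by_cases hr : r = r0
    · subst hr
      refine Eventually.of_forall fun s => ?_
      simp only [if_true]
      rw [show Q * X - (s + (1 + 2 * r) * τ) = (y - s) + i0 by rw [hy]; ring, Int.floor_add_intCast, add_comm]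
    · simp only [if_neg hr, add_zero]
      have hc : Continuous fun s : ℝ => Q * X - (s + (1 + 2 * r) * τ) := by fun_prop
      apply hc.continuousAt.eventually (floor_ev _)
      intro N hN
      have hne : (2 * r0 - 2 * r : ℤ) ≠ 0 := by omega
      have := (hτ.intCast_mul hne).ne_int (N - i0)
      apply this
      push_cast
      rw [hy] at hN; linarith
  refine ⟨∑ r ∈ Finset.range t, ((if r = r0 then i0 else ⌊Q * X - (y + (1 + 2 * r) * τ)⌋) -
    ⌊P * X - (y + (1 + 2 * r) * τ)⌋ + ⌊Q * X + (y + (1 + 2 * r) * τ)⌋ -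
    ⌊P * X + (y + (1 + 2 * r) * τ)⌋), ?_⟩
  have hall : ∀ᶠ s in 𝓝 y, ∀ r ∈ Finset.range t, psiX P Q X (s + (1 + 2 * r) * τ) =
    ((if r = r0 then i0 else ⌊Q * X - (y + (1 + 2 * r) * τ)⌋) -
    ⌊P * X - (y + (1 + 2 * r) * τ)⌋ + ⌊Q * X + (y + (1 + 2 * r) * τ)⌋ -
    ⌊P * X + (y + (1 + 2 * r) * τ)⌋) + if r = r0 then ⌊y - s⌋ else 0 := by
    rw [Filter.eventually_all_finset]
    intro r _
    filter_upwards [hP r, hP' r, hQ r, hQ' r] with s a1 a2 a3 a4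
    unfold psiX
    rw [a1, a2, a3, a4]; ring
  filter_upwards [hall] with s hs
  rw [Finset.sum_congr rfl hs, Finset.sum_add_distrib, Finset.sum_ite_eq']
  rw [if_pos (Finset.mem_range.2 ht)]

/-- Existence of a colour change in the limit -/
theorem limit_change {P Q τ : ℝ} (hτ : Irrational τ) (hP0 : 0 ≤ P) (hP1 : P ≤ 1) (hPQ : P + Q = 2)
    {X1 X2 Y1 Y2 : ℝ} (hX : X1 < X2) (hY : Y1 < Y2) :
    ∃ X, X1 < X ∧ X < X2 ∧ (∀ c N : ℤ, Q * X - c * τ ≠ N) ∧ (P ≠ 0 → ∀ c N : ℤ, P * X - c * τ ≠ N) ∧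
      ∃ (j j' : ℕ) (N N' : ℤ), 1 ≤ j ∧ 1 ≤ j' ∧ Y1 < j * τ + N ∧ j * τ + N < Y2 ∧
        Y1 < j' * τ + N' ∧ j' * τ + N' < Y2 ∧ Dlim P Q τ X j ≠ Dlim P Q τ X j' := by
  have h2τ : Irrational (2 * τ) := by
    have := hτ.natCast_mul (m := 2) (by norm_num); exact_mod_cast this
  obtain ⟨X, hX1, hX2, hXg⟩ := generic_pt τ (({P, Q, Q - P, 2 * Q, P + Q} : Finset ℝ).erase 0)
    (by simp) hX
  have hg : ∀ u ∈ ({P, Q, Q - P, 2 * Q, P + Q} : Finset ℝ), u ≠ 0 → ∀ c N : ℤ, u * X - c * τ ≠ N :=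
    fun u hu h0 => hXg u (Finset.mem_erase.2 ⟨h0, hu⟩)
  refine ⟨X, hX1, hX2, hg Q (by simp) (by linarith), hg P (by simp), ?_⟩
  rcases hP1.eq_or_lt with rfl | hP1
  · obtain ⟨i, hi, N, a1, a2⟩ := dens h2τ hY 1
    obtain ⟨i', -, N', b1, b2⟩ := dens h2τ (a := Y1 - τ) (b := Y2 - τ) (by linarith) 1
    have hQ : Q = 1 := by linarith
    have hD : ∀ j, Dlim 1 Q τ X j = j := by
      intro j; simp [Dlim, chiX, hQ]
    refine ⟨2 * i, 2 * i' + 1, N, N', by omega, by omega, ?_, ?_, ?_, ?_, ?_⟩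
    · push_cast; linarith
    · push_cast; linarith
    · push_cast; linarith
    · push_cast; linarith
    · rw [hD, hD]; push_cast
      have : (2 : ZMod 2) = 0 := by decide
      rw [this]; simp
  · set η := (Y2 - Y1) / 5 with hη
    have hη0 : 0 < η := by rw [hη]; linarith
    obtain ⟨r0, -, i0, a1, a2⟩ := dens h2τ (a := Q * X - τ - (Y2 - 2 * η)) (b := Q * X - τ - (Y1 + 2 * η))
      (by linarith) 0
    obtain ⟨t, ht, Ns, b1, b2⟩ := dens h2τ (a := -η) (b := η) (by linarith) (r0 + 1)
    set y := Q * X - (1 + 2 * r0) * τ - i0 with hy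
    obtain ⟨C, hC⟩ := jump P Q τ X hτ (hg _ (by simp) (by linarith)) (hg _ (by simp) (by linarith))
      (hg _ (by simp) (by linarith)) r0 i0 t (by omega) y hy
    rw [Metric.eventually_nhds_iff] at hC
    obtain ⟨ε, hε, hC⟩ := hC
    set ε' := min ε (min η 1) with hε'
    have e1 : ε' ≤ ε := min_le_left _ _
    have e2 : ε' ≤ η := (min_le_right _ _).trans (min_le_left _ _)
    have e3 : ε' ≤ 1 := (min_le_right _ _).trans (min_le_right _ _)
    have e0 : 0 < ε' := lt_min hε (lt_min hη0 one_pos)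
    obtain ⟨j1, hj1, N1, c1, c2⟩ := dens hτ (a := y - ε') (b := y) (by linarith) 1
    obtain ⟨j2, hj2, N2, d1, d2⟩ := dens hτ (a := y) (b := y + ε') (by linarith) 1
    have per : ∀ (j : ℕ) (N : ℤ), ∑ r ∈ Finset.range t, psiX P Q X (j * τ + (1 + 2 * r) * τ) =
        ∑ r ∈ Finset.range t, psiX P Q X (j * τ + N + (1 + 2 * r) * τ) := by
      intro j N
      apply Finset.sum_congr rfl
      intro r _
      rw [add_right_comm, psiX_int]
    have s1 := hC (show dist (j1 * τ + N1) y < ε by rw [Real.dist_eq, abs_lt]; constructor <;> linarith)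
    have s2 := hC (show dist (j2 * τ + N2) y < ε by rw [Real.dist_eq, abs_lt]; constructor <;> linarith)
    rw [← per] at s1 s2
    have f1 : ⌊y - (j1 * τ + N1)⌋ = 0 := by
      rw [Int.floor_eq_iff]; push_cast; constructor <;> linarith
    have f2 : ⌊y - (j2 * τ + N2)⌋ = -1 := by
      rw [Int.floor_eq_iff]; push_cast; constructor <;> linarith
    rw [f1] at s1; rw [f2] at s2
    have D1 := Dlim_add P Q τ X j1 t
    have D2 := Dlim_add P Q τ X j2 t
    rw [s1] at D1; rw [s2] at D2
    push_cast at D1 D2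
    have hy1 : Y1 + 2 * η < y := by rw [hy]; linarith
    have hy2 : y < Y2 - 2 * η := by rw [hy]; linarith
    have key : Dlim P Q τ X j1 ≠ Dlim P Q τ X (j1 + 2 * t) ∨ Dlim P Q τ X j2 ≠ Dlim P Q τ X (j2 + 2 * t) := by
      by_contra hc
      push Not at hc
      rw [← hc.1] at D1; rw [← hc.2] at D2
      have g1 : (C : ZMod 2) = 0 := by linear_combination -D1
      have g2 : (C : ZMod 2) = 1 := by linear_combination -D2
      rw [g1] at g2; exact absurd g2 (by decide)
    rcases key with h | h
    · refine ⟨j1, j1 + 2 * t, N1, N1 + Ns, by omega, by omega, by linarith, by linarith, ?_, ?_, h⟩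
      · push_cast; linarith
      · push_cast; linarith
    · refine ⟨j2, j2 + 2 * t, N2, N2 + Ns, by omega, by omega, by linarith, by linarith, ?_, ?_, h⟩
      · push_cast; linarith
      · push_cast; linarith


namespace Param
variable (π : Param)

theorem lam_expand {α : ℤ} (hα : π.bet α = 1 ∨ π.bet α = -1) {n : ℤ} {j : ℕ} (hj : 1 ≤ j)
    (hjω : 2 * j < π.ω) (hn : (π.ω:ℤ) ∣ n - j * α) (d : ℤ) :
    π.lam n d = ∑ r ∈ Finset.range j,
      if d ≡ (2 * (r:ℤ) + 1 - j) * α [ZMOD π.ω] then (1 : ZMod 2) else 0 := by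
  have hbn : π.bet n = π.bet α * j := by
    rw [π.bet_congr hn, π.bet_mul_alpha hα _ (by simp; omega)]
  have key : ∀ r ∈ Finset.range j, (d ≡ (2 * (r:ℤ) + 1 - j) * α [ZMOD π.ω] ↔
      π.bet d = π.bet α * (2 * (r:ℤ) + 1 - j)) := by
    intro r hr
    rw [Finset.mem_range] at hr
    rw [← π.bet_mul_alpha hα (2 * (r:ℤ) + 1 - j) (by omega)]
    constructor
    · intro h; exact π.bet_congr h.symm.dvd
    · intro h; exact (Int.modEq_iff_dvd.2 (π.bet_inj h)).symm
  have hd := π.bet_lt d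
  rw [lam_eq]
  by_cases hL : π.Lam n d
  · rw [if_pos hL]
    unfold Lam Lp at hL
    obtain ⟨h1, h2⟩ := hL
    rw [hbn] at h1 h2
    obtain ⟨r0, hr0, hr1⟩ : ∃ r0 : ℕ, r0 < j ∧ π.bet d = π.bet α * (2 * (r0:ℤ) + 1 - j) := by
      rcases hα with h | h
      · rw [h] at h1 h2 ⊢
        exact ⟨((π.bet d + j - 1) / 2).toNat, by omega, by omega⟩
      · rw [h] at h1 h2 ⊢
        exact ⟨((-π.bet d + j - 1) / 2).toNat, by omega, by omega⟩
    rw [Finset.sum_eq_single r0]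
    · rw [if_pos ((key r0 (Finset.mem_range.2 hr0)).2 hr1)]
    · intro r hr hne
      rw [if_neg]
      rw [key r hr, hr1]
      rcases hα with h | h <;> rw [h] <;> omega
    · intro h; exact absurd (Finset.mem_range.2 hr0) h
  · rw [if_neg hL]
    symm
    apply Finset.sum_eq_zero
    intro r hr
    rw [if_neg]
    rw [key r hr]
    intro h
    apply hL
    unfold Lam Lp
    rw [hbn, h]
    rw [Finset.mem_range] at hr
    rcases hα with h | h <;> rw [h] <;> constructor <;> omega

theorem floor_rat_real (a v : ℤ) (w : ℕ) :
    ⌊((a:ℚ) - (v:ℚ)) / (((w:ℤ)):ℚ)⌋ = ⌊((a:ℝ) - (v:ℝ)) / (w:ℝ)⌋ := by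
  rw [← Rat.floor_cast (α := ℝ)]; push_cast; rfl

theorem col_formula {α : ℤ} (hα : π.bet α = 1 ∨ π.bet α = -1) {n : ℤ} {j : ℕ} (hj : 1 ≤ j)
    (hjω : 2 * j < π.ω) (hn : (π.ω:ℤ) ∣ n - j * α) {m : ℤ} (hm : 0 ≤ m) :
    π.col m n = j + ((∑ r ∈ Finset.range j,
      (⌊((π.kk' m : ℝ) - (((2 * (r:ℤ) + 1 - j) * α : ℤ) : ℝ)) / (π.ω:ℝ)⌋ -
        ⌊((π.kk m : ℝ) - (((2 * (r:ℤ) + 1 - j) * α : ℤ) : ℝ)) / (π.ω:ℝ)⌋) : ℤ) : ZMod 2) := by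
  have hw : (0:ℝ) < π.ω := by exact_mod_cast π.ω_pos
  unfold col
  rw [π.wsum_eq hm]
  congr 1
  · rw [lam_eq]
    have hbn : π.bet n = π.bet α * j := by
      rw [π.bet_congr hn, π.bet_mul_alpha hα _ (by simp; omega)]
    have : π.Lam n 0 ↔ j % 2 = 1 := by
      unfold Lam Lp
      rw [hbn, bet_zero]
      rcases hα with h | h <;> rw [h] <;> constructor <;> intro h <;> omega
    split_ifs with h
    · rw [this] at h
      have := ZMod.natCast_mod j 2
      rw [h] at this; rw [← this]; simp
    · rw [this] at h
      have h : j % 2 = 0 := by omega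
      have := ZMod.natCast_mod j 2
      rw [h] at this; rw [← this]; simp
  · simp only [π.lam_expand hα hj hjω hn]
    rw [Finset.sum_comm, Int.cast_sum]
    apply Finset.sum_congr rfl
    intro r _
    rw [Finset.sum_boole]
    have hc := Int.Ioc_filter_modEq_card (π.kk m) (π.kk' m) π.ωZ_pos ((2 * (r:ℤ) + 1 - j) * α)
    rw [floor_rat_real, floor_rat_real] at hc
    have hle : (π.kk m : ℝ) ≤ π.kk' m := by exact_mod_cast π.kk_le_kk' hm
    rw [max_eq_left] at hc
    · rw [← hc]; push_cast; rfl
    · rw [sub_nonneg]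
      apply Int.floor_le_floor
      gcongr

theorem kk_bounds {m : ℤ} (hm : 0 < m) : π.P * m - 1 < π.kk m ∧ (π.kk m : ℝ) ≤ π.P * m := by
  have hw : (0:ℝ) < π.ω := by exact_mod_cast π.ω_pos
  have h1 := (π.le_kk hm (π.kk m)).1 le_rfl
  have h2 := (π.le_kk hm (π.kk m + 1)).not.1 (by omega)
  push Not at h2
  have h1 : (π.ω:ℝ) * π.kk m ≤ 2 * π.p * m := by exact_mod_cast h1
  have h2 : 2 * (π.p:ℝ) * m < π.ω * (π.kk m + 1) := by exact_mod_cast h2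
  have hP := π.P_mul_ω
  have e : 2 * (π.p:ℝ) * m = π.ω * (π.P * m) := by
    rw [← hP]; ring
  rw [e] at h1 h2
  have h1 := le_of_mul_le_mul_left h1 hw
  have h2 := lt_of_mul_lt_mul_left h2 hw.le
  exact ⟨by linarith, h1⟩

end Param

open Filter Topology

/-- data of a tuned sequence -/
structure Tuned (π : ℕ → Param) (α : ℕ → ℕ) (P Q τ : ℝ) : Prop where
  bet : ∀ k, (π k).bet (α k) = 1 ∨ (π k).bet (α k) = -1
  P0 : 0 ≤ P
  P1 : P ≤ 1
  PQ : P + Q = 2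
  irr : Irrational τ
  hP : Tendsto (fun k => (π k).P) atTop (𝓝 P)
  hτ : Tendsto (fun k => (α k : ℝ) / ((π k).ω : ℝ)) atTop (𝓝 τ)
  hω : Tendsto (fun k => ((π k).ω : ℝ)) atTop atTop

namespace Tuned
variable {π : ℕ → Param} {α : ℕ → ℕ} {P Q τ : ℝ}

theorem P_near (T : Tuned π α P Q τ) {η : ℝ} (h : 0 < η) : ∀ᶠ k in atTop, |(π k).P - P| < η := by
  have := T.hP.eventually (Metric.ball_mem_nhds P h)
  simpa [Metric.mem_ball, Real.dist_eq] using this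

theorem ατ_near (T : Tuned π α P Q τ) (a : ℤ) {η : ℝ} (h : 0 < η) : ∀ᶠ k in atTop,
    |(a * α k : ℝ) / ((π k).ω : ℝ) - a * τ| < η := by
  have h1 : Tendsto (fun k => (a:ℝ) * ((α k : ℝ) / ((π k).ω : ℝ))) atTop (𝓝 (a * τ)) :=
    T.hτ.const_mul _
  have := h1.eventually (Metric.ball_mem_nhds _ h)
  filter_upwards [this] with k hk
  rw [Real.dist_eq] at hk
  rwa [mul_div_assoc]

theorem ω_large (T : Tuned π α P Q τ) (C : ℝ) : ∀ᶠ k in atTop, C < ((π k).ω : ℝ) := T.hω.eventually_gt_atTop C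

/-- closeness of the scaled values `kk`, `kk'` -/
theorem kk_close (T : Tuned π α P Q τ) {X : ℝ} (hX0 : 0 < X) (hX1 : X < 1) (a : ℤ) {η : ℝ} (h : 0 < η) :
    ∃ δ > 0, δ < X ∧ ∀ᶠ k in atTop, ∀ m : ℤ, |(m:ℝ) - X * (π k).ω| ≤ δ * (π k).ω →
      0 < m ∧
      |(((π k).kk m : ℝ) - ((a * (α k : ℤ) : ℤ) : ℝ)) / ((π k).ω:ℝ) - (P * X - a * τ)| ≤ η ∧
      |(((π k).kk' m : ℝ) - ((a * (α k : ℤ) : ℤ) : ℝ)) / ((π k).ω:ℝ) - (Q * X - a * τ)| ≤ η := by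
  refine ⟨min (X / 2) (η / 8), lt_min (by linarith) (by linarith), (min_le_left _ _).trans_lt (by linarith), ?_⟩
  have hδ1 := min_le_left (X / 2) (η / 8)
  have hδ2 := min_le_right (X / 2) (η / 8)
  set δ := min (X / 2) (η / 8)
  filter_upwards [T.P_near (show 0 < η / 8 by linarith), T.ατ_near a (show 0 < η / 8 by linarith),
    T.ω_large (8 / η)] with k hP ha hω m hm
  have hw : (0:ℝ) < (π k).ω := by exact_mod_cast (π k).ω_pos
  set w : ℝ := ((π k).ω : ℝ)
  have hm0 : 0 < m := by
    have : (0:ℝ) < m := by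
      rw [abs_le] at hm
      nlinarith
    exact_mod_cast this
  have hk := (π k).kk_bounds hm0
  have hk' : ((π k).kk' m : ℝ) = 2 * m - 1 - (π k).kk m := by unfold Param.kk'; push_cast; ring
  have hmw : |(m:ℝ) / w - X| ≤ δ := by
    rw [show (m:ℝ) / w - X = (m - X * w) / w by field_simp, abs_div, abs_of_pos hw, div_le_iff₀ hw]
    exact hm
  have hinv : 1 / w < η / 8 := by
    rw [div_lt_iff₀ h] at hω
    rw [div_lt_iff₀ hw]; nlinarith
  have hP0 := (π k).P_pos
  have hP1 := (π k).P_lt_one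
  have hkw : |((π k).kk m : ℝ) / w - (π k).P * (m / w)| ≤ 1 / w := by
    rw [show ((π k).kk m : ℝ) / w - (π k).P * (m / w) = ((π k).kk m - (π k).P * m) / w by ring,
      abs_div, abs_of_pos hw]
    gcongr
    rw [abs_le]; constructor <;> linarith
  have h1 : |(π k).P * (m / w) - (π k).P * X| ≤ η / 8 := by
    rw [← mul_sub, abs_mul, abs_of_pos hP0]
    nlinarith [abs_nonneg ((m:ℝ) / w - X)]
  have h2 : |(π k).P * X - P * X| ≤ η / 8 := by
    rw [← sub_mul, abs_mul, abs_of_pos hX0]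
    nlinarith [abs_nonneg ((π k).P - P)]
  have e1 : (((π k).kk m : ℝ) - ((a * (α k : ℤ) : ℤ) : ℝ)) / w - (P * X - a * τ) =
      ((π k).kk m : ℝ) / w - P * X - ((a * α k : ℝ) / w - a * τ) := by push_cast; ring
  have hQ : Q = 2 - P := by linarith [T.PQ]
  have e2 : (((π k).kk' m : ℝ) - ((a * (α k : ℤ) : ℤ) : ℝ)) / w - (Q * X - a * τ) =
      2 * ((m:ℝ) / w - X) - 1 / w - (((π k).kk m : ℝ) / w - P * X) - ((a * α k : ℝ) / w - a * τ) := by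
    rw [hk', hQ]; push_cast; ring
  have hiw : 0 < 1 / w := by positivity
  refine ⟨hm0, ?_, ?_⟩
  · rw [e1]
    rw [abs_le] at *
    rw [abs_lt] at ha
    constructor <;> linarith
  · rw [e2]
    rw [abs_le] at *
    rw [abs_lt] at ha
    constructor <;> linarith

/-- stability of the floors -/
theorem floor_stable (T : Tuned π α P Q τ) {X : ℝ} (hX0 : 0 < X) (hX1 : X < 1) (hQ : ∀ c N : ℤ, Q * X - c * τ ≠ N)
    (hP : P ≠ 0 → ∀ c N : ℤ, P * X - c * τ ≠ N) (a : ℤ) :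
    ∃ δ > 0, δ < X ∧ ∀ᶠ k in atTop, ∀ m : ℤ, |(m:ℝ) - X * (π k).ω| ≤ δ * (π k).ω →
      0 < m ∧
      ⌊(((π k).kk' m : ℝ) - ((a * (α k : ℤ) : ℤ) : ℝ)) / ((π k).ω:ℝ)⌋ -
      ⌊(((π k).kk m : ℝ) - ((a * (α k : ℤ) : ℤ) : ℝ)) / ((π k).ω:ℝ)⌋ = chiX P Q τ X a := by
  obtain ⟨η1, h1, hη1⟩ := floor_near (hQ a)
  by_cases hc : P = 0 ∧ a = 0
  · obtain ⟨hc, rfl⟩ := hc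
    obtain ⟨δ, d0, dX, hδ⟩ := T.kk_close hX0 hX1 0 (lt_min h1 (show (0:ℝ) < 1 / 2 by norm_num))
    refine ⟨δ, d0, dX, ?_⟩
    filter_upwards [hδ] with k hk m hm
    obtain ⟨b1, b2, b3⟩ := hk m hm
    have hw : (0:ℝ) < (π k).ω := by exact_mod_cast (π k).ω_pos
    refine ⟨b1, ?_⟩
    rw [hη1 _ (b3.trans (min_le_left _ _))]
    unfold chiX
    congr 1
    rw [hc]
    simp only [hc, zero_mul, Int.cast_zero, sub_zero, Int.floor_zero] at b2 ⊢
    have h0 : (0:ℤ) ≤ (π k).kk m := by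
      rw [(π k).le_kk b1]; positivity
    have h0 : (0:ℝ) ≤ (π k).kk m := by exact_mod_cast h0
    rw [Int.floor_eq_zero_iff]
    have := (abs_le.1 b2).2
    have := min_le_right η1 (1/2)
    exact ⟨by positivity, by linarith⟩
  · have hP' : ∀ N : ℤ, P * X - a * τ ≠ N := by
      by_cases hP0 : P = 0
      · have ha : a ≠ 0 := fun h => hc ⟨hP0, h⟩
        intro N h
        apply (T.irr.intCast_mul ha).ne_int (-N)
        push_cast; rw [hP0] at h; linarith
      · exact hP hP0 a
    obtain ⟨η2, h2, hη2⟩ := floor_near hP'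
    obtain ⟨δ, d0, dX, hδ⟩ := T.kk_close hX0 hX1 a (lt_min h1 h2)
    refine ⟨δ, d0, dX, ?_⟩
    filter_upwards [hδ] with k hk m hm
    obtain ⟨b1, b2, b3⟩ := hk m hm
    refine ⟨b1, ?_⟩
    rw [hη1 _ (b3.trans (min_le_left _ _)), hη2 _ (b2.trans (min_le_right _ _))]
    rfl

/-- stability of the colour -/
theorem col_stable (T : Tuned π α P Q τ) {X : ℝ} (hX0 : 0 < X) (hX1 : X < 1) (hQ : ∀ c N : ℤ, Q * X - c * τ ≠ N)
    (hP : P ≠ 0 → ∀ c N : ℤ, P * X - c * τ ≠ N) {j : ℕ} (hj : 1 ≤ j) (N : ℤ) :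
    ∃ δ > 0, ∀ᶠ k in atTop, ∀ m : ℤ, |(m:ℝ) - X * (π k).ω| ≤ δ * (π k).ω →
      (π k).col m (j * α k + N * (π k).ω) = Dlim P Q τ X j := by
  choose δ d0 dX hδ using fun a => T.floor_stable hX0 hX1 hQ hP a
  have hne : (Finset.range j).Nonempty := ⟨0, Finset.mem_range.2 hj⟩
  refine ⟨(Finset.range j).inf' hne (fun r => δ (2 * (r:ℤ) + 1 - j)), ?_, ?_⟩
  · rw [gt_iff_lt, Finset.lt_inf'_iff]; intro r _; exact d0 _
  have hall : ∀ᶠ k in atTop, ∀ r ∈ Finset.range j, ∀ m : ℤ,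
      |(m:ℝ) - X * (π k).ω| ≤ δ (2 * (r:ℤ) + 1 - j) * (π k).ω → 0 < m ∧
      ⌊(((π k).kk' m : ℝ) - (((2 * (r:ℤ) + 1 - j) * (α k : ℤ) : ℤ) : ℝ)) / ((π k).ω:ℝ)⌋ -
      ⌊(((π k).kk m : ℝ) - (((2 * (r:ℤ) + 1 - j) * (α k : ℤ) : ℤ) : ℝ)) / ((π k).ω:ℝ)⌋ =
        chiX P Q τ X (2 * (r:ℤ) + 1 - j) := by
    rw [Filter.eventually_all_finset]
    intro r _; exact hδ _
  filter_upwards [hall, T.ω_large (2 * j)] with k hk hω m hm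
  have hw : (0:ℝ) < (π k).ω := by exact_mod_cast (π k).ω_pos
  have hle : ∀ r ∈ Finset.range j, |(m:ℝ) - X * (π k).ω| ≤ δ (2 * (r:ℤ) + 1 - j) * (π k).ω := by
    intro r hr
    refine hm.trans ?_
    gcongr
    exact Finset.inf'_le _ hr
  have hm0 : 0 < m := (hk 0 (Finset.mem_range.2 hj) m (hle 0 (Finset.mem_range.2 hj))).1
  rw [(π k).col_formula (T.bet k) hj (by exact_mod_cast hω) ⟨N, by ring⟩ hm0.le]
  unfold Dlim
  congr 2
  apply Finset.sum_congr rfl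
  intro r hr
  exact (hk r hr m (hle r hr)).2

set_option maxHeartbeats 1600000 in
/-- big polygons through any small rectangle -/
theorem rect_polygon (T : Tuned π α P Q τ) {X1 X2 Y1 Y2 : ℝ} (hX : X1 < X2) (hY : Y1 < Y2) (hX1 : 0 ≤ X1) (hX2 : X2 ≤ 1)
    (hY1 : 0 ≤ Y1) (hY2 : Y2 ≤ 1) :
    ∃ δ > 0, ∀ᶠ k in atTop, ∀ A B : ℤ, ∃ m n : ℤ, X1 * (π k).ω < m ∧ m < X2 * (π k).ω ∧
      Y1 * (π k).ω < n ∧ (n:ℝ) + 1 < Y2 * (π k).ω ∧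
      vmid (((π k).ω:ℤ) ^ 2 * A + m) (((π k).ω:ℤ) * B + n) ∈ (π k).plaidSet ∧
      connectedComponentIn (π k).plaidSet (vmid (((π k).ω:ℤ) ^ 2 * A + m) (((π k).ω:ℤ) * B + n)) ⊆
        (π k).block A B ∧
      δ * (π k).ω ≤ Metric.diam (Prod.fst '' connectedComponentIn (π k).plaidSet
        (vmid (((π k).ω:ℤ) ^ 2 * A + m) (((π k).ω:ℤ) * B + n))) := by
  obtain ⟨X, hX1', hX2', gQ, gP, j, j', N, N', hj, hj', c1, c2, c3, c4, hne⟩ :=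
    limit_change (P := P) (Q := Q) T.irr T.P0 T.P1 T.PQ hX hY
  have hX0 : 0 < X := by linarith
  have hXlt : X < 1 := by linarith
  obtain ⟨δ1, d1, e1⟩ := T.col_stable hX0 hXlt gQ gP hj N
  obtain ⟨δ2, d2, e2⟩ := T.col_stable hX0 hXlt gQ gP hj' N'
  set δ := min δ1 δ2 with hδ
  have d0 : 0 < δ := lt_min d1 d2
  have hδ1 : δ ≤ δ1 := min_le_left _ _
  have hδ2 : δ ≤ δ2 := min_le_right _ _
  refine ⟨δ / 2, by linarith, ?_⟩
  have near : ∀ (j : ℕ) (N : ℤ), Y1 < j * τ + N → j * τ + N < Y2 → ∀ᶠ k in atTop,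
      Y1 * (π k).ω < ((j * α k + N * (π k).ω : ℤ) : ℝ) ∧
      ((j * α k + N * (π k).ω : ℤ) : ℝ) + 1 < Y2 * (π k).ω := by
    intro j N h1 h2
    set η := min (j * τ + N - Y1) (Y2 - (j * τ + N)) / 2 with hη
    have m1 := min_le_left (j * τ + N - Y1) (Y2 - (j * τ + N))
    have m2 := min_le_right (j * τ + N - Y1) (Y2 - (j * τ + N))
    have hη0 : 0 < η := by apply half_pos; apply lt_min <;> linarith
    filter_upwards [T.ατ_near j hη0, T.ω_large (1 / η)] with k hk hω
    have hw : (0:ℝ) < (π k).ω := by exact_mod_cast (π k).ω_pos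
    rw [div_lt_iff₀ hη0] at hω
    rw [abs_lt] at hk
    push_cast at hk ⊢
    set s : ℝ := (j * α k : ℝ) / (π k).ω with hs
    have es : (j * α k : ℝ) = s * (π k).ω := by rw [hs]; field_simp
    rw [es]
    constructor
    · nlinarith
    · nlinarith
  filter_upwards [e1, e2, near j N c1 c2, near j' N' c3 c4, T.ω_large (1 / (X - X1)),
    T.ω_large (8 / δ)] with k k1 k2 k3 k4 k5 k6 A B
  have hw : (0:ℝ) < (π k).ω := by exact_mod_cast (π k).ω_pos
  rw [div_lt_iff₀ (by linarith)] at k5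
  rw [div_lt_iff₀ d0] at k6
  set w : ℝ := ((π k).ω : ℝ) with hwdef
  set m : ℤ := ⌊X * w⌋ with hm
  set L : ℤ := ⌊δ * w / 2⌋ with hL
  have m1 : (m:ℝ) ≤ X * w := Int.floor_le _
  have m2 : X * w < m + 1 := Int.lt_floor_add_one _
  have l1 : (L:ℝ) ≤ δ * w / 2 := Int.floor_le _
  have l2 : δ * w / 2 < L + 1 := Int.lt_floor_add_one _
  have hL1 : 1 ≤ L := by
    have : (0:ℝ) < L := by nlinarith
    have : 0 < L := by exact_mod_cast this
    omega
  have hm0 : 0 ≤ m := Int.floor_nonneg.2 (by positivity)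
  have hmw : m ≤ (π k).ω := by
    have : (m:ℝ) ≤ w := by nlinarith
    rw [hwdef] at this
    exact_mod_cast this
  have close : ∀ m' : ℤ, m - L ≤ m' → m' ≤ m + L → |(m':ℝ) - X * w| ≤ δ * w := by
    intro m' a1 a2
    have a1 : (m:ℝ) - L ≤ m' := by exact_mod_cast a1
    have a2 : (m':ℝ) ≤ m + L := by exact_mod_cast a2
    rw [abs_le]; constructor <;> nlinarith
  have q1 : ∀ m' : ℤ, m - L ≤ m' → m' ≤ m + L → (π k).col m' (j * α k + N * (π k).ω) = Dlim P Q τ X j :=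
    fun m' a1 a2 => k1 m' ((close m' a1 a2).trans (by gcongr))
  have q2 : ∀ m' : ℤ, m - L ≤ m' → m' ≤ m + L → (π k).col m' (j' * α k + N' * (π k).ω) = Dlim P Q τ X j' :=
    fun m' a1 a2 => k2 m' ((close m' a1 a2).trans (by gcongr))
  have fin : ∀ (n1 n2 : ℤ), n1 ≤ n2 → Y1 * w < n1 → (n2:ℝ) + 1 < Y2 * w →
      (∃ D1 D2, D1 ≠ D2 ∧ ∀ m' : ℤ, m - L ≤ m' → m' ≤ m + L → (π k).col m' n1 = D1 ∧ (π k).col m' n2 = D2) →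
      ∃ m n : ℤ, X1 * w < m ∧ m < X2 * w ∧
      Y1 * w < n ∧ (n:ℝ) + 1 < Y2 * w ∧
      vmid (((π k).ω:ℤ) ^ 2 * A + m) (((π k).ω:ℤ) * B + n) ∈ (π k).plaidSet ∧
      connectedComponentIn (π k).plaidSet (vmid (((π k).ω:ℤ) ^ 2 * A + m) (((π k).ω:ℤ) * B + n)) ⊆
        (π k).block A B ∧
      δ / 2 * w ≤ Metric.diam (Prod.fst '' connectedComponentIn (π k).plaidSet
        (vmid (((π k).ω:ℤ) ^ 2 * A + m) (((π k).ω:ℤ) * B + n))) := by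
    rintro n1 n2 h12 g1 g2 ⟨D1, D2, hD, hcol⟩
    have z1 : 0 ≤ n1 := by
      have : (0:ℝ) ≤ n1 := by linarith [mul_nonneg hY1 hw.le]
      exact_mod_cast this
    have z2 : n2 ≤ (π k).ω := by
      have : (n2:ℝ) ≤ w := by linarith [mul_le_of_le_one_left hw.le hY2]
      rw [hwdef] at this
      exact_mod_cast this
    have cm := hcol m (by omega) (by omega)
    obtain ⟨n, b1, b2, b3, b4, b5, b6, b7⟩ := (π k).exists_polygon A B m n1 n2 L hm0 hmw z1 h12 z2 hL1
      (by rw [cm.1, cm.2]; exact hD)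
      (by intro m' a1 a2 _ _; rw [cm.1, cm.2]; exact hcol m' a1 a2)
    have b1 : (n1:ℝ) ≤ n := by exact_mod_cast b1
    have b2 : (n:ℝ) + 1 ≤ n2 := by exact_mod_cast b2
    exact ⟨m, n, by nlinarith, by nlinarith, by linarith, by linarith, b5, b6, le_trans (by nlinarith) b7⟩
  rcases le_total (j * α k + N * (π k).ω : ℤ) (j' * α k + N' * (π k).ω) with h | h
  · exact fin _ _ h k3.1 k4.2 ⟨_, _, hne, fun m' a1 a2 => ⟨q1 m' a1 a2, q2 m' a1 a2⟩⟩
  · exact fin _ _ h k4.1 k3.2 ⟨_, _, hne.symm, fun m' a1 a2 => ⟨q2 m' a1 a2, q1 m' a1 a2⟩⟩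

end Tuned


open Filter Topology

namespace Tuned
variable {π : ℕ → Param} {α : ℕ → ℕ} {P Q τ : ℝ}

/-- consecutive special lines are close -/
theorem gap_small (T : Tuned π α P Q τ) {ε : ℝ} (hε : 0 < ε) : ∃ K : ℕ, ∀ᶠ k in atTop, ∀ a b : ℤ,
    a ∈ (π k).Xs (α k) K → b ∈ (π k).Xs (α k) K →
    (∀ t ∈ (π k).Xs (α k) K, ¬ (a < t ∧ t < b)) → (b - a : ℝ) < ε * (π k).ω := by
  obtain ⟨j, hj, N, hv0, hve⟩ := dens T.irr (show (0:ℝ) < ε / 2 by linarith) 1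
  set v : ℝ := j * τ + N with hv
  obtain ⟨K, hK⟩ := exists_nat_gt (2 * j / v)
  refine ⟨K, ?_⟩
  filter_upwards [T.ατ_near j (half_pos hv0)] with k hk a b ha hb hab
  have hw : (0:ℝ) < (π k).ω := by exact_mod_cast (π k).ω_pos
  obtain ⟨vk, hvk⟩ : ∃ vk : ℤ, vk = j * α k + N * (π k).ω := ⟨_, rfl⟩
  have hvk' : (vk:ℝ) = j * α k + N * (π k).ω := by rw [hvk]; push_cast; ring
  push_cast at hk
  have e1 : (vk:ℝ) = ((j * α k : ℝ) / (π k).ω + N) * (π k).ω := by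
    rw [hvk']; field_simp
  rw [abs_lt] at hk
  have l1 : v / 2 * (π k).ω < vk := by rw [e1]; gcongr; linarith
  have l2 : (vk:ℝ) < ε * (π k).ω := by rw [e1]; gcongr; linarith
  have vpos : 0 < vk := by
    have : (0:ℝ) < vk := lt_trans (by positivity) l1
    exact_mod_cast this
  have ra := (π k).Xs_range ha
  have rb := (π k).Xs_range hb
  obtain ⟨i, hi⟩ : ∃ i : ℤ, i = a / vk + 1 := ⟨_, rfl⟩
  have d1 := Int.emod_add_mul_ediv a vk
  have d2 := Int.emod_nonneg a vpos.ne'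
  have d3 := Int.emod_lt_of_pos a vpos
  have d4 : 0 ≤ a / vk := Int.ediv_nonneg ra.1 vpos.le
  have hit : i * vk = vk * (a / vk) + vk := by rw [hi]; ring
  have t1 : a < i * vk := by rw [hit]; omega
  have t2 : i * vk ≤ a + vk := by rw [hit]; omega
  have hb2 : b ≤ i * vk := by
    by_contra hcon
    push Not at hcon
    apply hab (i * vk) _ ⟨t1, hcon⟩
    have hlt : i * vk < (π k).ω := by omega
    unfold Param.Xs
    rw [Finset.mem_insert, Finset.mem_image]
    right
    refine ⟨i * j, ?_, ?_⟩
    · have hi0 : 0 ≤ i := by omega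
      rw [Finset.mem_Icc]
      have h0 : 0 ≤ i * j := by positivity
      refine ⟨by omega, ?_⟩
      have : (i * j : ℝ) ≤ K := by
        refine le_of_lt (lt_trans ?_ hK)
        rw [lt_div_iff₀ hv0]
        have hlt' : (i:ℝ) * vk < (π k).ω := by exact_mod_cast hlt
        have hi0' : (0:ℝ) < i := by exact_mod_cast (show 0 < i by omega)
        have h3 : (i:ℝ) * (v / 2 * (π k).ω) < 1 * (π k).ω :=
          lt_of_lt_of_eq (lt_trans (by gcongr) hlt') (one_mul _).symm
        have h4 : (i:ℝ) * (v / 2) < 1 := by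
          rw [← mul_assoc] at h3
          exact lt_of_mul_lt_mul_right h3 hw.le
        have hj' : (0:ℝ) < j := by exact_mod_cast hj
        nlinarith
      exact_mod_cast this
    · have : i * j * (α k : ℤ) = i * vk + (π k).ω * (-(i * N)) := by rw [hvk]; ring
      rw [this, Int.add_mul_emod_self_left, Int.emod_eq_of_lt (by omega) hlt]
  have : (b:ℝ) ≤ a + vk := by exact_mod_cast hb2.trans t2
  linarith

theorem gap_one (T : Tuned π α P Q τ) (c : ℤ) : ∃ κ : ℝ, 0 < κ ∧ ∀ᶠ k in atTop, ∀ N : ℤ,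
    0 < c * α k + N * (π k).ω → κ * (π k).ω ≤ ((c * α k + N * (π k).ω : ℤ) : ℝ) := by
  by_cases hc : c = 0
  · refine ⟨1, one_pos, Eventually.of_forall ?_⟩
    intro k N h
    have hw := (π k).ω_pos
    rw [hc] at h ⊢
    have hN : 1 ≤ N := by
      by_contra hcon
      have : N ≤ 0 := by omega
      have : N * ((π k).ω:ℤ) ≤ 0 := mul_nonpos_of_nonpos_of_nonneg this (by positivity)
      omega
    have hN : (1:ℝ) ≤ N := by exact_mod_cast hN
    push_cast
    nlinarith [show (0:ℝ) < (π k).ω by exact_mod_cast hw]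
  · have hne : (c * τ - round (c * τ) : ℝ) ≠ 0 := by
      intro h
      apply (T.irr.intCast_mul hc).ne_int (round ((c:ℝ) * τ))
      linarith
    have hpos := abs_pos.2 hne
    set κ := |(c * τ - round (c * τ) : ℝ)| with hκ
    refine ⟨κ / 2, half_pos hpos, ?_⟩
    filter_upwards [T.ατ_near c (half_pos hpos)] with k hk N h
    have hw : (0:ℝ) < (π k).ω := by exact_mod_cast (π k).ω_pos
    have h' : (0:ℝ) < c * α k + N * (π k).ω := by exact_mod_cast h
    have r := round_le ((c:ℝ) * τ) (-N)
    rw [← hκ] at r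
    push_cast at r ⊢
    have e1 : (c * α k + N * (π k).ω : ℝ) = ((c * α k : ℝ) / (π k).ω + N) * (π k).ω := by
      field_simp
    rw [e1] at h' ⊢
    have h2 := pos_of_mul_pos_left h' hw.le
    gcongr
    rw [abs_lt] at hk
    rw [sub_neg_eq_add, le_abs] at r
    rcases r with r | r <;> linarith

/-- distinct special lines are far apart -/
theorem gap_large (T : Tuned π α P Q τ) (K : ℕ) : ∃ κ : ℝ, 0 < κ ∧ ∀ᶠ k in atTop, ∀ a b : ℤ,
    a ∈ (π k).Xs (α k) K → b ∈ (π k).Xs (α k) K → a < b → κ * (π k).ω ≤ (b - a : ℝ) := by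
  choose κ h0 hκ using fun c => T.gap_one c
  have hne : (Finset.Icc (-(2 * K : ℤ)) (2 * K)).Nonempty := ⟨0, by simp⟩
  refine ⟨(Finset.Icc (-(2 * K : ℤ)) (2 * K)).inf' hne κ, ?_, ?_⟩
  · rw [Finset.lt_inf'_iff]; intro r _; exact h0 _
  have hall : ∀ᶠ k in atTop, ∀ c ∈ Finset.Icc (-(2 * K : ℤ)) (2 * K), ∀ N : ℤ,
    0 < c * α k + N * (π k).ω → κ c * (π k).ω ≤ ((c * α k + N * (π k).ω : ℤ) : ℝ) := by
    rw [Filter.eventually_all_finset]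
    intro r _; exact hκ _
  filter_upwards [hall] with k hk a b ha hb hab
  have hw : (0:ℝ) < (π k).ω := by exact_mod_cast (π k).ω_pos
  have form : ∀ t ∈ (π k).Xs (α k) K, ∃ i N : ℤ, -(K:ℤ) ≤ i ∧ i ≤ K ∧ t = i * α k + N * (π k).ω := by
    intro t ht
    unfold Param.Xs at ht
    rw [Finset.mem_insert, Finset.mem_image] at ht
    rcases ht with rfl | ⟨i, hi, rfl⟩
    · exact ⟨0, 1, by omega, by omega, by ring⟩
    · rw [Finset.mem_Icc] at hi
      refine ⟨i, -(i * α k / (π k).ω), hi.1, hi.2, ?_⟩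
      rw [Int.emod_def]; ring
  obtain ⟨i, N, i1, i2, ea⟩ := form a ha
  obtain ⟨i', N', i1', i2', eb⟩ := form b hb
  have e : b - a = (i' - i) * α k + (N' - N) * (π k).ω := by rw [ea, eb]; ring
  have hm : i' - i ∈ Finset.Icc (-(2 * K : ℤ)) (2 * K) := by rw [Finset.mem_Icc]; omega
  have := hk (i' - i) hm (N' - N) (by omega)
  rw [← e] at this
  push_cast at this
  refine le_trans ?_ this
  gcongr
  exact Finset.inf'_le _ hm

/-- polygons in every square of a grid -/
theorem grid (T : Tuned π α P Q τ) {M : ℕ} (hM : 0 < M) :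
    ∃ δ > 0, ∀ᶠ k in atTop, ∀ i j : ℕ, i < M → j < M → ∀ A B : ℤ, ∃ m n : ℤ,
      (i / M : ℝ) * (π k).ω < m ∧ m < ((i + 1) / M : ℝ) * (π k).ω ∧
      (j / M : ℝ) * (π k).ω < n ∧ (n:ℝ) + 1 < ((j + 1) / M : ℝ) * (π k).ω ∧
      vmid (((π k).ω:ℤ) ^ 2 * A + m) (((π k).ω:ℤ) * B + n) ∈ (π k).plaidSet ∧
      connectedComponentIn (π k).plaidSet (vmid (((π k).ω:ℤ) ^ 2 * A + m) (((π k).ω:ℤ) * B + n)) ⊆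
        (π k).block A B ∧
      δ * (π k).ω ≤ Metric.diam (Prod.fst '' connectedComponentIn (π k).plaidSet
        (vmid (((π k).ω:ℤ) ^ 2 * A + m) (((π k).ω:ℤ) * B + n))) := by
  have hM' : (0:ℝ) < M := by exact_mod_cast hM
  have hr : ∀ i : ℕ, i < M → (i / M : ℝ) < (i + 1) / M ∧ (0:ℝ) ≤ i / M ∧ ((i + 1) / M : ℝ) ≤ 1 := by
    intro i hi
    refine ⟨by gcongr; linarith, by positivity, ?_⟩
    rw [div_le_one hM']; exact_mod_cast hi
  choose δ d0 hδ using fun (x : Fin M × Fin M) =>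
    T.rect_polygon (hr x.1 x.1.2).1 (hr x.2 x.2.2).1 (hr x.1 x.1.2).2.1 (hr x.1 x.1.2).2.2
      (hr x.2 x.2.2).2.1 (hr x.2 x.2.2).2.2
  have hne : (Finset.univ : Finset (Fin M × Fin M)).Nonempty := ⟨(⟨0, hM⟩, ⟨0, hM⟩), Finset.mem_univ _⟩
  refine ⟨Finset.univ.inf' hne δ, ?_, ?_⟩
  · rw [gt_iff_lt, Finset.lt_inf'_iff]; intro r _; exact d0 _
  filter_upwards [eventually_all.2 hδ] with k hk i j hi hj A B
  have hw : (0:ℝ) < (π k).ω := by exact_mod_cast (π k).ω_pos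
  obtain ⟨m, n, c1, c2, c3, c4, c5, c6, c7⟩ := hk (⟨i, hi⟩, ⟨j, hj⟩) A B
  refine ⟨m, n, c1, c2, c3, c4, c5, c6, le_trans ?_ c7⟩
  gcongr
  exact Finset.inf'_le _ (Finset.mem_univ _)

/-- arbitrarily (relatively) small big polygons -/
theorem small_big (T : Tuned π α P Q τ) {ε : ℝ} (hε : 0 < ε) :
    ∃ δ > 0, ∀ᶠ k in atTop, ∀ A B : ℤ, ∃ Γ, (π k).IsPlaidPolygon Γ ∧ Γ ⊆ (π k).block A B ∧
      δ * (π k).ω ≤ Metric.diam (Prod.fst '' Γ) ∧ Metric.diam (Prod.fst '' Γ) < ε * (π k).ω := by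
  obtain ⟨K, hK⟩ := T.gap_small hε
  obtain ⟨κ, k0, hκ⟩ := T.gap_large K
  obtain ⟨M, hM⟩ := exists_nat_gt (2 / κ)
  have hM' : (0:ℝ) < M := lt_trans (by positivity) hM
  have hM0 : 0 < M := by exact_mod_cast hM'
  obtain ⟨δ, d0, hδ⟩ := T.grid hM0
  refine ⟨δ, d0, ?_⟩
  filter_upwards [hK, hκ, hδ, T.ω_large (2 * K)] with k h1 h2 h3 h4 A B
  have hw : (0:ℝ) < (π k).ω := by exact_mod_cast (π k).ω_pos
  obtain ⟨a, b, c, d, ha, hb, hc, hd, hab, hcd, nab, ncd, gv, gh⟩ :=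
    (π k).zero_cell (T.bet k) K (by exact_mod_cast h4)
  have fnd : ∀ a b : ℤ, a ∈ (π k).Xs (α k) K → b ∈ (π k).Xs (α k) K → a < b →
      ∃ i : ℕ, i < M ∧ (a:ℝ) ≤ (i / M : ℝ) * (π k).ω ∧ ((i + 1) / M : ℝ) * (π k).ω ≤ b := by
    intro a b ha hb hab
    have hg := h2 a b ha hb hab
    have ra := (π k).Xs_range ha
    have rb := (π k).Xs_range hb
    have ra1 : (0:ℝ) ≤ a := by exact_mod_cast ra.1
    have rb2 : (b:ℝ) ≤ (π k).ω := by exact_mod_cast rb.2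
    have c1 := Nat.le_ceil (a * M / (π k).ω : ℝ)
    have c2 := Nat.ceil_lt_add_one (show (0:ℝ) ≤ a * M / (π k).ω by positivity)
    set i := ⌈(a * M / (π k).ω : ℝ)⌉₊
    rw [div_le_iff₀ hw] at c1
    rw [div_add_one hw.ne', lt_div_iff₀ hw] at c2
    rw [div_lt_iff₀ k0] at hM
    have e2 : ((i + 1) / M : ℝ) * (π k).ω ≤ b := by
      rw [div_mul_eq_mul_div, div_le_iff₀ hM']
      nlinarith [mul_lt_mul_of_pos_right hM hw, mul_le_mul_of_nonneg_right hg hM'.le]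
    refine ⟨i, ?_, ?_, e2⟩
    · have : ((i + 1) / M : ℝ) * (π k).ω ≤ 1 * (π k).ω := by linarith
      have := le_of_mul_le_mul_right this hw
      rw [div_le_one hM'] at this
      exact_mod_cast this
    · rw [div_mul_eq_mul_div, le_div_iff₀ hM']
      exact c1
  obtain ⟨i, hi, i1, i2⟩ := fnd a b ha hb hab
  obtain ⟨j, hj, j1, j2⟩ := fnd c d hc hd hcd
  obtain ⟨m, n, c1, c2, c3, c4, c5, c6, c7⟩ := h3 i j hi hj A B
  refine ⟨_, ⟨_, c5, rfl⟩, c6, c7, ?_⟩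
  have m1 : a < m := by exact_mod_cast lt_of_le_of_lt i1 c1
  have m2 : m < b := by exact_mod_cast lt_of_lt_of_le c2 i2
  have n1 : c < n := by exact_mod_cast lt_of_le_of_lt j1 c3
  have n2 : n + 1 < d := by exact_mod_cast lt_of_lt_of_le c4 j2
  refine lt_of_le_of_lt ((π k).trapped A B a b c d ((π k).Xs_range ha).1 ((π k).Xs_range hb).2 hab gv gh m n m1 m2
    n1.le (by omega) c5) (h1 a b ha hb nab)

/-- many distinct big polygons -/
theorem many (T : Tuned π α P Q τ) (N : ℕ) :
    ∃ δ > 0, ∀ᶠ k in atTop, ∀ A B : ℤ, ∃ S : Finset (Set (ℝ × ℝ)), S.card = N ∧ ∀ Γ ∈ S,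
      (π k).IsPlaidPolygon Γ ∧ Γ ⊆ (π k).block A B ∧ δ * (π k).ω ≤ Metric.diam (Prod.fst '' Γ) := by
  induction N with
  | zero =>
    exact ⟨1, one_pos, Eventually.of_forall fun k A B => ⟨∅, by simp, by simp⟩⟩
  | succ N ih =>
    obtain ⟨ε, e0, he⟩ := ih
    obtain ⟨δ, d0, hδ⟩ := T.small_big e0
    refine ⟨min δ ε, lt_min d0 e0, ?_⟩
    filter_upwards [he, hδ] with k h1 h2 A B
    have hw : (0:ℝ) < (π k).ω := by exact_mod_cast (π k).ω_pos
    obtain ⟨S, hS, h3⟩ := h1 A B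
    obtain ⟨Γ, g1, g2, g3, g4⟩ := h2 A B
    have hn : Γ ∉ S := fun h => absurd (h3 Γ h).2.2 (not_le.2 g4)
    refine ⟨insert Γ S, by rw [Finset.card_insert_of_notMem hn, hS], ?_⟩
    intro Γ' hΓ'
    rw [Finset.mem_insert] at hΓ'
    rcases hΓ' with rfl | h
    · exact ⟨g1, g2, le_trans (by gcongr; exact min_le_left _ _) g3⟩
    · obtain ⟨q1, q2, q3⟩ := h3 Γ' h
      exact ⟨q1, q2, le_trans (by gcongr; exact min_le_right _ _) q3⟩

theorem main (T : Tuned π α P Q τ) (B : ℕ → ℤ × ℤ) (N : ℕ) (hN : 0 < N) :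
    ∃ δ : ℝ, 0 < δ ∧ ∀ᶠ k in Filter.atTop,
      ∃ S : Finset (Set (ℝ × ℝ)), N ≤ S.card ∧
        (∀ Γ ∈ S, (π k).IsPlaidPolygon Γ ∧ Γ ⊆ (π k).block (B k).1 (B k).2 ∧
          δ * ((π k).ω : ℝ) ≤ Metric.diam (Prod.fst '' Γ)) ∧
        (∀ z ∈ (π k).block (B k).1 (B k).2,
          ∃ Γ ∈ S, ∃ w ∈ Γ, dist z w ≤ ((π k).ω : ℝ) / N) := by
  obtain ⟨δ1, d1, h1⟩ := T.many N
  obtain ⟨δ2, d2, h2⟩ := T.grid hN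
  have hN' : (0:ℝ) < N := by exact_mod_cast hN
  refine ⟨min δ1 δ2, lt_min d1 d2, ?_⟩
  filter_upwards [h1, h2] with k h1 h2
  have hw : (0:ℝ) < (π k).ω := by exact_mod_cast (π k).ω_pos
  obtain ⟨S, hS, h3⟩ := h1 (B k).1 (B k).2
  choose m n c1 c2 c3 c4 c5 c6 c7 using fun x : Fin N × Fin N =>
    h2 x.1 x.2 x.1.2 x.2.2 (B k).1 (B k).2
  refine ⟨S ∪ Finset.univ.image (fun x : Fin N × Fin N => connectedComponentIn (π k).plaidSet
    (vmid (((π k).ω:ℤ) ^ 2 * (B k).1 + m x) (((π k).ω:ℤ) * (B k).2 + n x))), ?_, ?_, ?_⟩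
  · exact hS.symm.le.trans (Finset.card_le_card Finset.subset_union_left)
  · intro Γ hΓ
    rw [Finset.mem_union, Finset.mem_image] at hΓ
    rcases hΓ with h | ⟨x, _, rfl⟩
    · obtain ⟨q1, q2, q3⟩ := h3 Γ h
      exact ⟨q1, q2, le_trans (by gcongr; exact min_le_left _ _) q3⟩
    · exact ⟨⟨_, c5 x, rfl⟩, c6 x, le_trans (by gcongr; exact min_le_right _ _) (c7 x)⟩
  · intro z hz
    unfold Param.block at hz
    obtain ⟨⟨z1, z2⟩, z3, z4⟩ := hz
    simp only at z1 z2 z3 z4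
    have cellx : ∀ u : ℝ, 0 ≤ u → u ≤ (π k).ω → ∃ i : Fin N,
        (((i:ℕ):ℝ) / N : ℝ) * (π k).ω ≤ u ∧ u ≤ ((((i:ℕ):ℝ) + 1) / N : ℝ) * (π k).ω := by
      intro u u0 u1
      by_cases hu : u = (π k).ω
      · refine ⟨⟨N - 1, by omega⟩, ?_, ?_⟩
        · rw [hu]
          apply mul_le_of_le_one_left hw.le
          rw [div_le_one hN']
          simp
        · rw [hu, Nat.cast_sub hN]
          simp [hN'.ne']
      · have u1 : u < (π k).ω := lt_of_le_of_ne u1 hu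
        have f1 := Nat.floor_le (show (0:ℝ) ≤ u * N / (π k).ω by positivity)
        have f2 := Nat.lt_floor_add_one (u * N / (π k).ω : ℝ)
        rw [le_div_iff₀ hw] at f1
        rw [div_lt_iff₀ hw] at f2
        refine ⟨⟨⌊(u * N / (π k).ω : ℝ)⌋₊, ?_⟩, ?_, ?_⟩
        · rw [Nat.floor_lt (by positivity), div_lt_iff₀ hw]; nlinarith
        · rw [div_mul_eq_mul_div, div_le_iff₀ hN']; exact f1
        · rw [div_mul_eq_mul_div, le_div_iff₀ hN']; exact f2.le
    obtain ⟨i, i1, i2⟩ := cellx (z.1 - (π k).ω ^ 2 * (B k).1) (by linarith) (by linarith)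
    obtain ⟨j, j1, j2⟩ := cellx (z.2 - (π k).ω * (B k).2) (by linarith) (by linarith)
    refine ⟨_, Finset.mem_union_right _ (Finset.mem_image_of_mem _ (Finset.mem_univ (i, j))),
      _, mem_connectedComponentIn (c5 (i, j)), ?_⟩
    have w1 := c1 (i, j)
    have w2 := c2 (i, j)
    have w3 := c3 (i, j)
    have w4 := c4 (i, j)
    simp only at w1 w2 w3 w4
    have ei : ((((i:ℕ):ℝ) + 1) / N : ℝ) * (π k).ω = (((i:ℕ):ℝ) / N : ℝ) * (π k).ω + (π k).ω / N := by ring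
    have ej : ((((j:ℕ):ℝ) + 1) / N : ℝ) * (π k).ω = (((j:ℕ):ℝ) / N : ℝ) * (π k).ω + (π k).ω / N := by ring
    rw [ei] at i2 w2
    rw [ej] at j2 w4
    rw [Prod.dist_eq, max_le_iff, Real.dist_eq, Real.dist_eq, abs_le, abs_le]
    unfold vmid
    simp only
    push_cast
    refine ⟨⟨?_, ?_⟩, ?_, ?_⟩ <;> linarith

end Tuned

theorem Param.bet_of_modEq (π : Param) {α : ℕ} (h : ((2 * α * π.p : ℤ) ≡ 1 [ZMOD (π.ω : ℤ)] ∨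
        (2 * α * π.p : ℤ) ≡ -1 [ZMOD (π.ω : ℤ)])) : π.bet (α:ℤ) = 1 ∨ π.bet (α:ℤ) = -1 := by
  have hw : 3 ≤ π.ω := by
    have := π.p_pos
    have := π.p_lt_q
    unfold Param.ω; omega
  rcases h with h | h
  · left
    apply π.bet_unique
    · have := h.symm.dvd
      exact dvdc this (by ring)
    · simp; omega
  · right
    apply π.bet_unique
    · have := h.symm.dvd
      exact dvdc this (by ring)
    · simp; omega

theorem ω_tendsto (π : ℕ → Param) (α : ℕ → ℕ) (hα : ∀ k, 2 * α k < (π k).ω) (τ : ℝ) (hτ : Irrational τ)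
    (hτconv : Tendsto (fun k => (α k : ℝ) / ((π k).ω : ℝ)) atTop (𝓝 τ)) :
    Tendsto (fun k => ((π k).ω : ℝ)) atTop atTop := by
  apply tendsto_natCast_atTop_atTop.comp
  rw [tendsto_atTop]
  intro W
  have hfin : Set.Finite ((fun x : ℕ × ℕ => (x.1:ℝ) / x.2) '' (Set.Iic W ×ˢ Set.Iic W)) :=
    ((Set.finite_Iic W).prod (Set.finite_Iic W)).image _
  have hmem : τ ∉ ((fun x : ℕ × ℕ => (x.1:ℝ) / x.2) '' (Set.Iic W ×ˢ Set.Iic W)) := by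
    rintro ⟨x, _, hx⟩
    apply hτ
    exact ⟨(x.1:ℚ) / x.2, by push_cast; exact hx⟩
  have := hτconv.eventually (hfin.isClosed.isOpen_compl.mem_nhds hmem)
  filter_upwards [this] with k hk
  by_contra hcon
  apply hk
  have := hα k
  exact ⟨(α k, (π k).ω), ⟨by simp; omega, by simp; omega⟩, rfl⟩

theorem tuned_of (π : ℕ → Param) (α : ℕ → ℕ)
    (hα : ∀ k, 0 < α k ∧ 2 * α k < (π k).ω ∧
      ((2 * α k * (π k).p : ℤ) ≡ 1 [ZMOD ((π k).ω : ℤ)] ∨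
        (2 * α k * (π k).p : ℤ) ≡ -1 [ZMOD ((π k).ω : ℤ)]))
    (x : ℝ)
    (hconv : Filter.Tendsto (fun k => ((π k).p : ℝ) / ((π k).q : ℝ))
      Filter.atTop (nhds x))
    (τ : ℝ) (hτ : Irrational τ)
    (hτconv : Filter.Tendsto (fun k => (α k : ℝ) / ((π k).ω : ℝ))
      Filter.atTop (nhds τ)) :
    Tuned π α (2 * x / (1 + x)) (2 - 2 * x / (1 + x)) τ := by
  have hx0 : 0 ≤ x := ge_of_tendsto' hconv (fun k => by positivity)
  have hx1 : x ≤ 1 := by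
    refine le_of_tendsto' hconv (fun k => ?_)
    have := (π k).p_lt_q
    have := (π k).p_pos
    rw [div_le_one (by exact_mod_cast (by omega))]
    exact_mod_cast (π k).p_lt_q.le
  refine ⟨fun k => (π k).bet_of_modEq (hα k).2.2, by positivity, ?_, by ring, hτ, ?_, hτconv,
    ω_tendsto π α (fun k => (hα k).2.1) τ hτ hτconv⟩
  · rw [div_le_one (by linarith)]; linarith
  · have h := (hconv.const_mul 2).div (hconv.const_add 1) (by linarith)
    refine h.congr (fun k => ?_)
    have hq : (0:ℝ) < (π k).q := by exact_mod_cast (lt_trans (π k).p_pos (π k).p_lt_q)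
    have hp : (0:ℝ) < (π k).p := by exact_mod_cast (π k).p_pos
    simp only [Pi.div_apply]
    unfold Param.P Param.ω
    push_cast
    field_simp
    ring

/-- Let `p_k/q_k` be an irrationally tuned sequence of even rational parameters: the ratios
`p_k/q_k` converge, and the tunes `τ(p_k/q_k) = α_k/ω_k` (where `α_k ∈ (0, ω_k/2)` is the
integer with `2 α_k p_k ≡ ±1 (mod ω_k)`) converge to an irrational limit `τ`.  Let `B_k` be
any sequence of associated blocks.  Then for every positive integer `N` there is `δ > 0` such
that, for all sufficiently large `k`: at least `N` distinct plaid polygons contained in `B_k`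
have `x`-diameter at least `δ·ω_k`, and every point of `B_k` lies within distance `ω_k/N` of
one of these polygons. -/
theorem tuned_big_polygons (π : ℕ → Param) (α : ℕ → ℕ)
    (hα : ∀ k, 0 < α k ∧ 2 * α k < (π k).ω ∧
      ((2 * α k * (π k).p : ℤ) ≡ 1 [ZMOD ((π k).ω : ℤ)] ∨
        (2 * α k * (π k).p : ℤ) ≡ -1 [ZMOD ((π k).ω : ℤ)]))
    (x : ℝ)
    (hconv : Filter.Tendsto (fun k => ((π k).p : ℝ) / ((π k).q : ℝ))
      Filter.atTop (nhds x))
    (τ : ℝ) (hτ : Irrational τ)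
    (hτconv : Filter.Tendsto (fun k => (α k : ℝ) / ((π k).ω : ℝ))
      Filter.atTop (nhds τ))
    (B : ℕ → ℤ × ℤ) (N : ℕ) (hN : 0 < N) :
    ∃ δ : ℝ, 0 < δ ∧ ∀ᶠ k in Filter.atTop,
      ∃ S : Finset (Set (ℝ × ℝ)), N ≤ S.card ∧
        (∀ Γ ∈ S, (π k).IsPlaidPolygon Γ ∧ Γ ⊆ (π k).block (B k).1 (B k).2 ∧
          δ * ((π k).ω : ℝ) ≤ Metric.diam (Prod.fst '' Γ)) ∧
        (∀ z ∈ (π k).block (B k).1 (B k).2,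
          ∃ Γ ∈ S, ∃ w ∈ Γ, dist z w ≤ ((π k).ω : ℝ) / N) := by
  exact (tuned_of π α hα x hconv τ hτ hτconv).main B N hN
end
end

section
/- Let (p_k), (q_k) be sequences of coprime positive integers with p_k·q_k even, set ω_k = p_k + q_k, and suppose p_k/q_k converges to an irrational number. For each k let a_k be an integer with 2·p_k·a_k ≡ −1 (mod ω_k). Then there does not exist a uniformly bounded sequence of nonzero integers (b_k) such that the residues of 2·a_k·b_k modulo ω_k, taken as the representatives of smallest absolute value, are uniformly bounded. -/
/-- Let `(p_k)`, `(q_k)` be sequences of coprime positive integers with `p_k·q_k` even, set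
`ω_k = p_k + q_k`, and suppose `p_k/q_k` converges to an irrational number.  For each `k` let
`a_k` be an integer with `2·p_k·a_k ≡ -1 (mod ω_k)`.  Then there is no uniformly bounded
sequence of nonzero integers `(b_k)` such that the residues of `2·a_k·b_k` modulo `ω_k` of
smallest absolute value (`Int.bmod`, which for odd `ω_k` is the unique representative in
`(-ω_k/2, ω_k/2)`) are uniformly bounded. -/
theorem no_bounded_multiple (p q : ℕ → ℕ) (hp : ∀ k, 0 < p k) (hq : ∀ k, 0 < q k)
    (hcop : ∀ k, Nat.Coprime (p k) (q k)) (heven : ∀ k, Even (p k * q k))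
    (x : ℝ) (hx : Irrational x)
    (hconv : Filter.Tendsto (fun k => (p k : ℝ) / (q k : ℝ)) Filter.atTop (nhds x))
    (a : ℕ → ℤ)
    (ha : ∀ k, (2 * (p k : ℤ) * a k) ≡ -1 [ZMOD ((p k + q k : ℕ) : ℤ)]) :
    ¬ ∃ (b : ℕ → ℤ) (C C' : ℕ),
        (∀ k, b k ≠ 0) ∧ (∀ k, |b k| ≤ (C : ℤ)) ∧
        (∀ k, |Int.bmod (2 * a k * b k) (p k + q k)| ≤ (C' : ℤ)) := by
  rintro ⟨b, C, C', hb0, hbC, hcC⟩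
  have key : ∀ n : ℕ, ∃ ε : ℝ, 0 < ε ∧ ∀ k ≤ n, ∀ m : ℤ, ε ≤ dist x (m / k) := by
    intro n
    have h1 : ∀ᶠ ε : ℝ in nhdsWithin 0 (Set.Ioi 0), ∀ k ≤ n, ∀ m : ℤ, ε ≤ dist x (m / k) :=
      (hx.eventually_forall_le_dist_cast_div_of_denom_le n).filter_mono nhdsWithin_le_nhds
    obtain ⟨ε, h, h'⟩ := (h1.and self_mem_nhdsWithin).exists
    exact ⟨ε, h', h⟩
  obtain ⟨ε, hε, hεd⟩ := key (C' + C' + C)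
  obtain ⟨N, hN⟩ := exists_nat_gt (2 * (C : ℝ) / ε)
  obtain ⟨δ, hδ, hδd⟩ := key (N + C)
  obtain ⟨k, hk1, hk2⟩ := ((Metric.tendsto_nhds.1 hconv (ε / 2) (by positivity)).and
    (Metric.tendsto_nhds.1 hconv δ hδ)).exists
  have hqN : N + C < q k := by
    by_contra hcon
    have := hδd (q k) (by omega) (p k)
    rw [dist_comm] at this
    push_cast at this
    linarith
  obtain ⟨P, hP⟩ : ∃ P : ℤ, P = p k := ⟨_, rfl⟩
  obtain ⟨Q, hQ⟩ : ∃ Q : ℤ, Q = q k := ⟨_, rfl⟩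
  obtain ⟨c, hc⟩ : ∃ c, c = Int.bmod (2 * a k * b k) (p k + q k) := ⟨_, rfl⟩
  have hcb := hcC k
  rw [← hc] at hcb
  have hbb := hbC k
  have hb := hb0 k
  have hP0 : 0 < P := by have := hp k; omega
  have hQ0 : (N : ℤ) + C < Q := by omega
  have hdvd1 : (P + Q) ∣ c - 2 * a k * b k := by
    have : (((p k + q k : ℕ) : ℤ)) ∣ 2 * a k * b k - c := by
      rw [hc]; exact Int.dvd_self_sub_bmod
    rw [hP, hQ, dvd_sub_comm]; exact_mod_cast this
  have hdvd2 : (P + Q) ∣ -1 - 2 * P * a k := by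
    have := (ha k).dvd
    rw [hP, hQ]; exact_mod_cast this
  obtain ⟨m, hm⟩ : (P + Q) ∣ P * c + b k := by
    have := dvd_sub (hdvd1.mul_left P) (hdvd2.mul_left (b k))
    have e : P * (c - 2 * a k * b k) - b k * (-1 - 2 * P * a k) = P * c + b k := by ring
    rwa [e] at this
  generalize b k = B at *
  obtain ⟨hb1, hb2⟩ := abs_le.1 hbb
  obtain ⟨hc1, hc2⟩ := abs_le.1 hcb
  have hC0 : (0 : ℤ) ≤ C := by positivity
  have hC0' : (0 : ℤ) ≤ C' := by positivity
  have hN0 : (0 : ℤ) ≤ N := by positivity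
  have hm1 : m ≤ C' + C := by
    by_contra! h
    nlinarith [mul_le_mul_of_nonneg_left hc2 hP0.le]
  have hm2 : -(C' + C : ℤ) ≤ m := by
    by_contra! h
    nlinarith [mul_le_mul_of_nonneg_left hc1 hP0.le]
  have hd : P * (c - m) + B = m * Q := by linarith
  by_cases hd0 : c - m = 0
  · rw [hd0] at hd
    have hm0 : m ≠ 0 := by rintro rfl; apply hb; linarith
    rcases lt_or_gt_of_ne hm0 with h | h <;> nlinarith
  · obtain ⟨D, M, hD0, hDn, hDM⟩ : ∃ (D : ℕ) (M : ℤ), 0 < D ∧ D ≤ C' + C' + C ∧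
        |P * (D : ℤ) - M * Q| ≤ C := by
      rcases lt_or_gt_of_ne hd0 with h | h
      · refine ⟨(m - c).toNat, -m, by omega, by omega, ?_⟩
        rw [Int.toNat_of_nonneg (by omega), abs_le]
        constructor <;> linarith
      · refine ⟨(c - m).toNat, m, by omega, by omega, ?_⟩
        rw [Int.toNat_of_nonneg (by omega), abs_le]
        constructor <;> linarith
    have h1 := hεd D hDn M
    have h2 := dist_triangle_left x ((M : ℝ) / D) ((p k : ℝ) / q k)
    have hq0 : (0 : ℝ) < q k := by exact_mod_cast hq k
    have hD1 : (1 : ℝ) ≤ D := by exact_mod_cast hD0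
    have h3 : dist ((p k : ℝ) / q k) ((M : ℝ) / D) * (q k * D) ≤ C := by
      rw [Real.dist_eq]
      have : (q k * D : ℝ) = |(q k * D : ℝ)| := (abs_of_nonneg (by positivity)).symm
      rw [this, ← abs_mul]
      have e : ((p k : ℝ) / q k - M / D) * (q k * D) = p k * D - M * q k := by
        field_simp
      rw [e]
      rw [hP, hQ] at hDM
      exact_mod_cast hDM
    have h4 : ε / 2 < dist ((p k : ℝ) / q k) ((M : ℝ) / D) := by linarith
    have h5 : (N : ℝ) < q k := by exact_mod_cast (by omega : N < q k)
    rw [div_lt_iff₀ hε] at hN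
    have h6 : (q k : ℝ) ≤ q k * D := by nlinarith
    have h7 : ε / 2 * q k ≤ dist ((p k : ℝ) / q k) ((M : ℝ) / D) * (q k * D) :=
      mul_le_mul h4.le h6 hq0.le dist_nonneg
    nlinarith
end
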